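/- arXiv:2103.06263 — 6 statements merged into one kernel-verified Lean document; each statement's English description precedes it below -/
import Mathlib

section
/- Let d ≥ 1, let w ∈ ℝ^d have nonnegative entries with w ≠ 0, let b > 0 and p ≥ 1. Let μ be the Lebesgue measure restricted to the cube [0,1]^d (a Borel probability measure on ℝ^d), set y₁ = 0 and y₂ = 2b·w/‖w‖², and for t ∈ [0,1] let ν_t = t·δ_{y₁} + (1−t)·δ_{y₂}. With transportation cost c(x,y) = ‖x−y‖^p (Euclidean norm), the number t* = Vol({x ∈ [0,1]^d : wᵀx ≤ b}) (the Lebesgue measure of the knapsack polytope) lies in [0,1] and minimizes t ↦ W_c(μ, ν_t) over [0,1], i.e., W_c(μ, ν_{t*}) = inf_{t ∈ [0,1]} W_c(μ, ν_t). -/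
open MeasureTheory Set
open scoped ENNReal

noncomputable section

/-- The unit cube of `ℝ^d` has volume one. -/
lemma volume_unitCube (d : ℕ) :
    volume {x : EuclideanSpace ℝ (Fin d) | ∀ i, x i ∈ Icc (0 : ℝ) 1} = 1 := by
  have h : {x : EuclideanSpace ℝ (Fin d) | ∀ i, x i ∈ Icc (0 : ℝ) 1} =
      (fun x : EuclideanSpace ℝ (Fin d) => x.ofLp) ⁻¹' Icc (0 : Fin d → ℝ) 1 := by
    ext x
    simp [Pi.le_def, forall_and]
  have hmp := PiLp.volume_preserving_ofLp (Fin d)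
  rw [h, hmp.measure_preimage measurableSet_Icc.nullMeasurableSet, Real.volume_Icc_pi]
  simp

/-- The hyperplane `⟪w, x⟫ = b` is the perpendicular bisector of `0` and `(2b/‖w‖²) w`. -/
lemma norm_le_norm_sub_smul_iff {E : Type*} [NormedAddCommGroup E] [InnerProductSpace ℝ E]
    {w : E} (hw : w ≠ 0) {b : ℝ} (hb : 0 < b) (x : E) :
    ‖x‖ ≤ ‖x - (2 * b / ‖w‖ ^ 2) • w‖ ↔ inner ℝ x w ≤ b := by
  have hw' : 0 < ‖w‖ ^ 2 := by positivity
  have hy : ‖(2 * b / ‖w‖ ^ 2) • w‖ ^ 2 = 2 * b / ‖w‖ ^ 2 * (2 * b) := by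
    rw [norm_smul, mul_pow, Real.norm_eq_abs, sq_abs]
    field_simp
  have hpos : 0 < 2 * b / ‖w‖ ^ 2 := by positivity
  rw [← sq_le_sq₀ (norm_nonneg _) (norm_nonneg _), norm_sub_sq_real, hy, real_inner_smul_right]
  constructor
  · intro h
    refine le_of_mul_le_mul_left ?_ hpos
    linarith
  · intro h
    nlinarith [mul_le_mul_of_nonneg_left h hpos.le]

/-- If the second marginal of `π` is carried by two points, the transport cost of `π` is at least
the integral of the cost to the cheaper of these points. -/
lemma lintegral_min_le_lintegral {X Y : Type*} [MeasurableSpace X] [MeasurableSpace Y]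
    [MeasurableSingletonClass Y] {π : Measure (X × Y)} {c : X → Y → ℝ≥0∞} {y₁ y₂ : Y}
    {a₁ a₂ : ℝ≥0∞} (hc : ∀ y, Measurable fun x => c x y)
    (hπ : π.map Prod.snd = a₁ • Measure.dirac y₁ + a₂ • Measure.dirac y₂) :
    ∫⁻ x, min (c x y₁) (c x y₂) ∂(π.map Prod.fst) ≤ ∫⁻ q, c q.1 q.2 ∂π := by
  have hmeas : MeasurableSet ({y₁, y₂} : Set Y) := (measurableSet_singleton y₂).insert y₁
  have hae : ∀ᵐ q ∂π, q.2 ∈ ({y₁, y₂} : Set Y) := by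
    refine ae_of_ae_map (p := fun y => y ∈ ({y₁, y₂} : Set Y)) measurable_snd.aemeasurable ?_
    rw [hπ, ae_iff]
    change (a₁ • Measure.dirac y₁ + a₂ • Measure.dirac y₂) ({y₁, y₂} : Set Y)ᶜ = 0
    simp [hmeas.compl]
  rw [lintegral_map ((hc y₁).min (hc y₂)) measurable_fst]
  refine lintegral_mono_ae (hae.mono fun q hq => ?_)
  rcases hq with h | h
  · simp [h]
  · rw [mem_singleton_iff] at h
    simp [h]

/-- The push-forward of a measure under a two-valued map is a combination of two Dirac masses. -/
lemma map_piecewise_const {X Y : Type*} [MeasurableSpace X] [MeasurableSpace Y]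
    (μ : Measure X) {A : Set X} [DecidablePred (· ∈ A)] (hA : MeasurableSet A) (y₁ y₂ : Y) :
    μ.map (A.piecewise (fun _ => y₁) (fun _ => y₂)) =
      μ A • Measure.dirac y₁ + μ Aᶜ • Measure.dirac y₂ := by
  ext s hs
  rw [Measure.map_apply (measurable_const.piecewise hA measurable_const) hs, piecewise_preimage]
  by_cases h₁ : y₁ ∈ s <;> by_cases h₂ : y₂ ∈ s <;>
    simp [h₁, h₂, hs, Set.ite, ← Set.compl_eq_univ_sdiff, measure_add_measure_compl hA]


/-- The volume of the knapsack polytope `{x ∈ [0,1]^d : wᵀx ≤ b}` lies in `[0,1]` and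
minimizes `t ↦ W_c(μ, ν_t)` over `[0,1]`, where `μ` is the Lebesgue measure on the unit
cube, `ν_t = t δ_{y₁} + (1−t) δ_{y₂}` with `y₁ = 0`, `y₂ = 2b w/‖w‖²`, and
`c(x,y) = ‖x−y‖^p`. -/
theorem stmt_0
    (d : ℕ) (hd : 1 ≤ d)
    (w : EuclideanSpace ℝ (Fin d)) (hw_nonneg : ∀ i, 0 ≤ w i) (hw_ne : w ≠ 0)
    (b : ℝ) (hb : 0 < b) (p : ℝ) (hp : 1 ≤ p)
    (cube : Set (EuclideanSpace ℝ (Fin d)))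
    (hcube : cube = {x : EuclideanSpace ℝ (Fin d) | ∀ i, x i ∈ Icc (0 : ℝ) 1})
    (μ : Measure (EuclideanSpace ℝ (Fin d))) (hμ : μ = volume.restrict cube)
    (y₁ y₂ : EuclideanSpace ℝ (Fin d))
    (hy₁ : y₁ = 0) (hy₂ : y₂ = (2 * b / ‖w‖ ^ 2) • w)
    (ν : ℝ → Measure (EuclideanSpace ℝ (Fin d)))
    (hν : ∀ t, ν t = ENNReal.ofReal t • Measure.dirac y₁ +
      ENNReal.ofReal (1 - t) • Measure.dirac y₂)
    (W : Measure (EuclideanSpace ℝ (Fin d)) → Measure (EuclideanSpace ℝ (Fin d)) → ℝ≥0∞)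
    (hW : ∀ μ' ν', W μ' ν' =
      ⨅ π ∈ {π : Measure (EuclideanSpace ℝ (Fin d) × EuclideanSpace ℝ (Fin d)) |
          IsProbabilityMeasure π ∧ π.map Prod.fst = μ' ∧ π.map Prod.snd = ν'},
        ∫⁻ q, ENNReal.ofReal (‖q.1 - q.2‖ ^ p) ∂π)
    (tstar : ℝ)
    (htstar : tstar = (volume (cube ∩ {x | ∑ i, w i * x i ≤ b})).toReal) :
    tstar ∈ Icc (0 : ℝ) 1 ∧ W μ (ν tstar) = ⨅ t ∈ Icc (0 : ℝ) 1, W μ (ν t) := by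
  classical
  have hcv := volume_unitCube d
  rw [← hcube] at hcv
  set A : Set (EuclideanSpace ℝ (Fin d)) := {x | ∑ i, w i * x i ≤ b} with hA
  have hAm : MeasurableSet A := measurableSet_le (by fun_prop) measurable_const
  have : IsProbabilityMeasure μ := ⟨by rw [hμ, Measure.restrict_apply_univ, hcv]⟩
  have hts : tstar = (μ A).toReal := by
    rw [htstar, hμ, Measure.restrict_apply hAm, inter_comm]
  have hmem : tstar ∈ Icc (0 : ℝ) 1 := by
    rw [hts]
    exact ⟨measureReal_nonneg, measureReal_le_one⟩
  have hcost : ∀ y : EuclideanSpace ℝ (Fin d),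
      Measurable fun x : EuclideanSpace ℝ (Fin d) => ENNReal.ofReal (‖x - y‖ ^ p) :=
    fun y => by fun_prop
  have hlower : ∀ t, ∫⁻ x, min (ENNReal.ofReal (‖x - y₁‖ ^ p)) (ENNReal.ofReal (‖x - y₂‖ ^ p)) ∂μ
      ≤ W μ (ν t) := by
    intro t
    rw [hW]
    refine le_iInf₂ fun π hπ => ?_
    obtain ⟨-, hπ₁, hπ₂⟩ := hπ
    rw [← hπ₁]
    exact lintegral_min_le_lintegral hcost (hπ₂.trans (hν t))
  have hupper : W μ (ν tstar) ≤
      ∫⁻ x, min (ENNReal.ofReal (‖x - y₁‖ ^ p)) (ENNReal.ofReal (‖x - y₂‖ ^ p)) ∂μ := by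
    set T := A.piecewise (fun _ => y₁) (fun _ => y₂) with hT
    have hTm : Measurable T := measurable_const.piecewise hAm measurable_const
    have hgm : Measurable fun x => (x, T x) := measurable_id.prodMk hTm
    have hνT : μ.map T = ν tstar := by
      have h₁ : ENNReal.ofReal tstar = μ A := by rw [hts, ENNReal.ofReal_toReal (by finiteness)]
      have h₂ : ENNReal.ofReal (1 - tstar) = μ Aᶜ := by
        rw [ENNReal.ofReal_sub _ hmem.1, h₁, ENNReal.ofReal_one, prob_compl_eq_one_sub hAm]
      rw [hν, h₁, h₂, hT, map_piecewise_const μ hAm]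
    rw [hW]
    refine iInf₂_le_of_le (μ.map fun x => (x, T x)) ⟨?_, ?_, ?_⟩ ?_
    · exact Measure.isProbabilityMeasure_map hgm.aemeasurable
    · rw [Measure.map_map measurable_fst hgm]
      exact Measure.map_id
    · rw [Measure.map_map measurable_snd hgm]
      exact hνT
    · rw [lintegral_map (by fun_prop) hgm]
      refine lintegral_mono fun x => ?_
      have hiff : ‖x - y₁‖ ≤ ‖x - y₂‖ ↔ x ∈ A := by
        rw [hy₁, hy₂, sub_zero, norm_le_norm_sub_smul_iff hw_ne hb, hA, mem_ofPred_eq,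
          PiLp.inner_apply]
        simp
      by_cases hx : x ∈ A
      · have h := hiff.2 hx
        simp only [hT, piecewise_eq_of_mem _ _ _ hx]
        refine le_min le_rfl ?_
        gcongr
      · have h := (not_le.1 (mt hiff.1 hx)).le
        simp only [hT, piecewise_eq_of_notMem _ _ _ hx]
        refine le_min ?_ le_rfl
        gcongr
  exact ⟨hmem, le_antisymm (le_iInf₂ fun t _ => hupper.trans (hlower t)) (iInf₂_le tstar hmem)⟩
end
end

section
/- Let X ⊆ ℝ^m be closed, let μ be a Borel probability measure on X, let y₁,…,y_N ∈ ℝ^k be distinct points and ν = Σ_{i=1}^N ν_i δ_{y_i} with ν ∈ Δ^N. Let c : X × ℝ^k → [0,∞] be such that x ↦ c(x,y_i) is lower semicontinuous and μ-integrable for each i ∈ {1,…,N}. Then the semi-discrete optimal transport problem admits the dual representation W_c(μ, ν) = sup_{φ ∈ ℝ^N} Σ_{i=1}^N ν_i φ_i − ∫_X ψ_c(φ, x) dμ(x), where ψ_c(φ, x) = max_{i ∈ {1,…,N}} (φ_i − c(x, y_i)) is the discrete c-transform. -/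
open MeasureTheory Set
open scoped ENNReal

noncomputable section

/-- A measurable fractional partition (partition of unity) indexed by a finite type. -/
structure IsFractionalPartition {Ω ι : Type*} [MeasurableSpace Ω] [Fintype ι]
    (f : ι → Ω → ℝ) : Prop where
  measurable : ∀ i, Measurable (f i)
  nonneg : ∀ i x, 0 ≤ f i x
  sum_eq_one : ∀ x, ∑ i, f i x = 1

namespace IsFractionalPartition

variable {Ω ι : Type*} [MeasurableSpace Ω] [Fintype ι] {f g : ι → Ω → ℝ}

theorem le_one (hf : IsFractionalPartition f) (i : ι) (x : Ω) : f i x ≤ 1 :=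
  hf.sum_eq_one x ▸ Finset.single_le_sum (fun j _ => hf.nonneg j x) (Finset.mem_univ i)

theorem norm_le_one (hf : IsFractionalPartition f) (i : ι) (x : Ω) : ‖f i x‖ ≤ 1 := by
  rw [Real.norm_of_nonneg (hf.nonneg i x)]
  exact hf.le_one i x

theorem integrable_mul (hf : IsFractionalPartition f) {μ : Measure Ω} {C : Ω → ℝ}
    (hC : Integrable C μ) (i : ι) : Integrable (fun x => f i x * C x) μ :=
  hC.bdd_mul (hf.measurable i).aestronglyMeasurable (ae_of_all _ (hf.norm_le_one i))

theorem integrable (hf : IsFractionalPartition f) (μ : Measure Ω) [IsFiniteMeasure μ] (i : ι) :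
    Integrable (f i) μ := by
  simpa using hf.integrable_mul (integrable_const (1 : ℝ) (μ := μ)) i

theorem sum_integral (hf : IsFractionalPartition f) (μ : Measure Ω) [IsProbabilityMeasure μ] :
    ∑ i, ∫ x, f i x ∂μ = 1 := by
  rw [← integral_finsetSum _ fun i _ => hf.integrable μ i]
  simp [hf.sum_eq_one]

theorem convexCombination (hf : IsFractionalPartition f) (hg : IsFractionalPartition g) {a b : ℝ}
    (ha : 0 ≤ a) (hb : 0 ≤ b) (hab : a + b = 1) :
    IsFractionalPartition fun i x => a * f i x + b * g i x where
  measurable i := ((hf.measurable i).const_mul a).add ((hg.measurable i).const_mul b)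
  nonneg i x := add_nonneg (mul_nonneg ha (hf.nonneg i x)) (mul_nonneg hb (hg.nonneg i x))
  sum_eq_one x := by
    rw [Finset.sum_add_distrib, ← Finset.mul_sum, ← Finset.mul_sum, hf.sum_eq_one, hg.sum_eq_one]
    linarith

theorem const {w : ι → ℝ} (hw : ∀ i, 0 ≤ w i) (hw1 : ∑ i, w i = 1) :
    IsFractionalPartition fun i (_ : Ω) => w i :=
  ⟨fun _ => measurable_const, fun i _ => hw i, fun _ => hw1⟩

/-- A measurable fractional selection of the maximisers of finitely many functions. -/
theorem exists_sum_mul_eq_iSup [Nonempty ι] {h : ι → Ω → ℝ} (hh : ∀ i, Measurable (h i)) :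
    ∃ f : ι → Ω → ℝ, IsFractionalPartition f ∧ ∀ x, ∑ i, f i x * h i x = ⨆ i, h i x := by
  let E : ι → Set Ω := fun i => {x | ∀ j, h j x ≤ h i x}
  have hE : ∀ i, MeasurableSet (E i) := fun i => by
    simp only [E, ofPred_forall]
    exact MeasurableSet.iInter fun j => measurableSet_le (hh j) (hh i)
  let e : ι → Ω → ℝ := fun i => (E i).indicator 1
  have he : ∀ i x, 0 ≤ e i x := fun i x => indicator_nonneg (fun _ _ => zero_le_one) x
  have hem : ∀ i, Measurable (e i) := fun i => measurable_one.indicator (hE i)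
  have hpos : ∀ x, 0 < ∑ i, e i x := fun x => by
    obtain ⟨i, hi⟩ := exists_eq_ciSup_of_finite (f := fun i => h i x)
    have hxi : x ∈ E i := fun j => by
      rw [hi]
      exact le_ciSup (f := fun i => h i x) (Set.finite_range _).bddAbove j
    refine lt_of_lt_of_le zero_lt_one ?_
    calc (1 : ℝ) = e i x := by simp [e, hxi]
      _ ≤ _ := Finset.single_le_sum (fun j _ => he j x) (Finset.mem_univ i)
  have hsum : ∀ x, ∑ i, e i x / ∑ j, e j x = 1 := fun x => by
    rw [← Finset.sum_div, div_self (hpos x).ne']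
  refine ⟨fun i x => e i x / ∑ j, e j x, ⟨fun i => ?_, fun i x => ?_, hsum⟩, fun x => ?_⟩
  · exact (hem i).div (Finset.measurable_sum _ fun j _ => hem j)
  · exact div_nonneg (he i x) (hpos x).le
  · have : ∀ i, e i x / (∑ j, e j x) * h i x = e i x / (∑ j, e j x) * ⨆ j, h j x := fun i => by
      by_cases hx : x ∈ E i
      · rw [le_antisymm (le_ciSup (f := fun i => h i x) (Set.finite_range _).bddAbove i)
          (ciSup_le hx)]
      · simp [e, hx]
    rw [Finset.sum_congr rfl fun i _ => this i, ← Finset.sum_mul, hsum, one_mul]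

/-- A fractional partition can be modified to have prescribed masses `w`, the increase being
controlled by the difference between the old and the new masses. -/
theorem exists_integral_eq (hf : IsFractionalPartition f) (μ : Measure Ω) [IsProbabilityMeasure μ]
    {w : ι → ℝ} (hw : ∀ i, 0 ≤ w i) (hw1 : ∑ i, w i = 1) :
    ∃ (g : ι → Ω → ℝ) (r : Ω → ℝ), IsFractionalPartition g ∧ (∀ i, ∫ x, g i x ∂μ = w i) ∧
      Measurable r ∧ (∀ x, 0 ≤ r x) ∧ (∀ x, r x ≤ 1) ∧ (∀ i x, g i x ≤ f i x + r x) ∧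
      ∫ x, r x ∂μ ≤ ∑ i, |∫ x, f i x ∂μ - w i| := by
  set a : ι → ℝ := fun i => ∫ x, f i x ∂μ with ha
  have ha0 : ∀ i, 0 ≤ a i := fun i => integral_nonneg (hf.nonneg i)
  have ha1 : ∑ i, a i = 1 := hf.sum_integral μ
  set s : ι → ℝ := fun i => min 1 (w i / a i) with hs
  have hs0 : ∀ i, 0 ≤ s i := fun i => le_min zero_le_one (div_nonneg (hw i) (ha0 i))
  have hs1 : ∀ i, s i ≤ 1 := fun i => min_le_left _ _
  have hsa : ∀ i, s i * a i = min (a i) (w i) := fun i => by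
    rcases (ha0 i).eq_or_lt with h | h
    · rw [← h, mul_zero, min_eq_left (hw i)]
    · rw [hs]
      simp only
      rw [min_mul_of_nonneg _ _ h.le, one_mul, div_mul_cancel₀ _ h.ne']
  set r : Ω → ℝ := fun x => 1 - ∑ i, s i * f i x with hr
  have hsf : ∀ i x, s i * f i x ≤ f i x := fun i x =>
    mul_le_of_le_one_left (hf.nonneg i x) (hs1 i)
  have hr0 : ∀ x, 0 ≤ r x := fun x => by
    rw [hr]
    simp only
    rw [← hf.sum_eq_one x, sub_nonneg]
    exact Finset.sum_le_sum fun i _ => hsf i x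
  have hr1 : ∀ x, r x ≤ 1 := fun x =>
    sub_le_self _ (Finset.sum_nonneg fun i _ => mul_nonneg (hs0 i) (hf.nonneg i x))
  have hsfi : ∀ i, Integrable (fun x => s i * f i x) μ := fun i => (hf.integrable μ i).const_mul _
  have hri : Integrable r μ := (integrable_const _).sub (integrable_finsetSum _ fun i _ => hsfi i)
  have hrm : Measurable r :=
    measurable_const.sub (Finset.measurable_sum _ fun i _ => (hf.measurable i).const_mul _)
  set R : ℝ := ∫ x, r x ∂μ with hR
  have hRval : R = 1 - ∑ i, min (a i) (w i) := by
    rw [hR, hr, integral_sub (integrable_const _) (integrable_finsetSum _ fun i _ => hsfi i),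
      integral_finsetSum _ fun i _ => hsfi i]
    simp only [integral_const_mul, ← hsa, integral_const, probReal_univ, one_smul]
    rfl
  have hRw : R = ∑ i, (w i - min (a i) (w i)) := by
    rw [hRval, Finset.sum_sub_distrib, hw1]
  have hwm : ∀ i, 0 ≤ w i - min (a i) (w i) := fun i => sub_nonneg.2 (min_le_right _ _)
  have hRle : R ≤ ∑ i, |a i - w i| := by
    rw [hRw]
    refine Finset.sum_le_sum fun i _ => ?_
    rcases le_total (a i) (w i) with h | h
    · rw [min_eq_left h, abs_sub_comm]
      exact le_abs_self _
    · rw [min_eq_right h, sub_self]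
      exact abs_nonneg _
  obtain ⟨v, hv0, hv1, hvR⟩ : ∃ v : ι → ℝ, (∀ i, 0 ≤ v i) ∧ ∑ i, v i = 1 ∧
      ∀ i, v i * R = w i - min (a i) (w i) := by
    rcases (integral_nonneg hr0 : 0 ≤ R).eq_or_lt with h | h
    · refine ⟨w, hw, hw1, fun i => ?_⟩
      have := (Finset.sum_eq_zero_iff_of_nonneg fun i _ => hwm i).1 (hRw.symm.trans h.symm) i
        (Finset.mem_univ i)
      rw [this, hR, ← h, mul_zero]
    · refine ⟨fun i => (w i - min (a i) (w i)) / R, fun i => div_nonneg (hwm i) h.le, ?_,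
        fun i => div_mul_cancel₀ _ h.ne'⟩
      rw [← Finset.sum_div, ← hRw, div_self h.ne']
  have hv_le : ∀ i, v i ≤ 1 := fun i =>
    hv1 ▸ Finset.single_le_sum (fun j _ => hv0 j) (Finset.mem_univ i)
  refine ⟨fun i x => s i * f i x + v i * r x, r, ⟨fun i => ?_, fun i x => ?_, fun x => ?_⟩,
    fun i => ?_, hrm, hr0, hr1, fun i x => ?_, hRle⟩
  · exact ((hf.measurable i).const_mul _).add (hrm.const_mul _)
  · exact add_nonneg (mul_nonneg (hs0 i) (hf.nonneg i x)) (mul_nonneg (hv0 i) (hr0 x))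
  · rw [Finset.sum_add_distrib, ← Finset.sum_mul, hv1, hr]
    ring
  · rw [integral_add (hsfi i) (hri.const_mul _), integral_const_mul, integral_const_mul, hvR]
    change s i * a i + _ = _
    rw [hsa]
    ring
  · exact add_le_add (hsf i x) (mul_le_of_le_one_left (hr0 x) (hv_le i))

end IsFractionalPartition

theorem exists_integral_max_sub_lt {Ω : Type*} [MeasurableSpace Ω] {μ : Measure Ω} {C : Ω → ℝ}
    (hC : Integrable C μ) (hC0 : ∀ x, 0 ≤ C x) {ε : ℝ} (hε : 0 < ε) :
    ∃ n : ℕ, ∫ x, max (C x - n) 0 ∂μ < ε := by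
  have h : Filter.Tendsto (fun n : ℕ => ∫ x, max (C x - n) 0 ∂μ) Filter.atTop
      (nhds (∫ _, (0 : ℝ) ∂μ)) := by
    refine tendsto_integral_of_dominated_convergence C (fun n => ?_) hC
      (fun n => ae_of_all _ fun x => ?_) (ae_of_all _ fun x => ?_)
    · exact (hC.1.sub aestronglyMeasurable_const).sup aestronglyMeasurable_const
    · rw [Real.norm_of_nonneg (le_max_right _ _)]
      exact max_le (sub_le_self _ (Nat.cast_nonneg n)) (hC0 x)
    · obtain ⟨n, hn⟩ := exists_nat_ge (C x)
      refine tendsto_const_nhds.congr' ?_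
      filter_upwards [Filter.eventually_ge_atTop n] with k hk
      have : (n : ℝ) ≤ k := by exact_mod_cast hk
      rw [max_eq_right (by linarith)]
  rw [integral_zero] at h
  exact (h.eventually (gt_mem_nhds hε)).exists

theorem integrable_iSup_sub {Ω ι : Type*} [MeasurableSpace Ω] [Fintype ι] [Nonempty ι]
    {μ : Measure Ω} [IsFiniteMeasure μ] {C : ι → Ω → ℝ} (hCm : ∀ i, Measurable (C i))
    (hCi : ∀ i, Integrable (C i) μ) (φ : ι → ℝ) :
    Integrable (fun x => ⨆ i, (φ i - C i x)) μ := by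
  obtain ⟨f, hf, hfs⟩ := IsFractionalPartition.exists_sum_mul_eq_iSup
    (h := fun i x => φ i - C i x) fun i => measurable_const.sub (hCm i)
  simp only [← hfs]
  exact integrable_finsetSum _ fun i _ =>
    hf.integrable_mul ((integrable_const _).sub (hCi i)) i

section Duality

variable {Ω ι : Type*} [MeasurableSpace Ω] [Fintype ι] {μ : Measure Ω} [IsProbabilityMeasure μ]
  {C : ι → Ω → ℝ} {w : ι → ℝ} {D : ℝ}

/-- A cost bound which is approached by fractional partitions whose masses are close to `w` is
approached by fractional partitions whose masses are exactly `w`. -/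
theorem exists_integral_eq_of_approx (hCi : ∀ i, Integrable (C i) μ) (hC0 : ∀ i x, 0 ≤ C i x)
    (hw : ∀ i, 0 ≤ w i) (hw1 : ∑ i, w i = 1)
    (happrox : ∀ δ > 0, ∃ f, IsFractionalPartition f ∧ (∀ i, |∫ x, f i x ∂μ - w i| < δ) ∧
      ∑ i, ∫ x, f i x * C i x ∂μ < D + δ) {ε : ℝ} (hε : 0 < ε) :
    ∃ g, IsFractionalPartition g ∧ (∀ i, ∫ x, g i x ∂μ = w i) ∧
      ∑ i, ∫ x, g i x * C i x ∂μ ≤ D + ε := by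
  set K : ℝ := (Fintype.card ι : ℝ) with hK
  have hK0 : 0 ≤ K := Nat.cast_nonneg _
  have hη : 0 < ε / (3 * (K + 1)) := by positivity
  choose n hn using fun i => exists_integral_max_sub_lt (hCi i) (hC0 i) hη
  set S : ℝ := ∑ i, (n i : ℝ) with hS
  have hS0 : 0 ≤ S := Finset.sum_nonneg fun i _ => Nat.cast_nonneg _
  obtain ⟨f, hf, hfw, hfD⟩ := happrox (ε / (3 * (S * K + 1))) (by positivity)
  obtain ⟨g, r, hg, hgw, hrm, hr0, hr1, hgf, hR⟩ := hf.exists_integral_eq μ hw hw1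
  refine ⟨g, hg, hgw, ?_⟩
  have hri : Integrable r μ := (integrable_const (1 : ℝ)).mono' hrm.aestronglyMeasurable
    (ae_of_all _ fun x => by rw [Real.norm_of_nonneg (hr0 x)]; exact hr1 x)
  set δ := ε / (3 * (S * K + 1)) with hδ
  have hδ0 : 0 < δ := by positivity
  have hRδ : ∫ x, r x ∂μ ≤ K * δ := hR.trans <| by
    calc ∑ i, |∫ x, f i x ∂μ - w i| ≤ ∑ _i : ι, δ := Finset.sum_le_sum fun i _ => (hfw i).le
      _ = K * δ := by simp [hK]
  have hterm : ∀ i, ∫ x, g i x * C i x ∂μ ≤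
      ∫ x, f i x * C i x ∂μ + (n i * (K * δ) + ε / (3 * (K + 1))) := fun i => by
    have hmax : Integrable (fun x => max (C i x - n i) 0) μ :=
      ((hCi i).sub (integrable_const _)).sup (integrable_const 0)
    calc ∫ x, g i x * C i x ∂μ
        ≤ ∫ x, (f i x * C i x + (n i * r x + max (C i x - n i) 0)) ∂μ := by
          refine integral_mono (hg.integrable_mul (hCi i) i)
            ((hf.integrable_mul (hCi i) i).add ((hri.const_mul _).add hmax)) fun x => ?_
          have h1 := mul_le_mul_of_nonneg_right (hgf i x) (hC0 i x)
          have h2 : r x * (C i x - n i) ≤ max (C i x - n i) 0 := by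
            rcases le_total (C i x - n i) 0 with h | h
            · exact (mul_nonpos_of_nonneg_of_nonpos (hr0 x) h).trans (le_max_right _ _)
            · exact (mul_le_of_le_one_left h (hr1 x)).trans (le_max_left _ _)
          simp only
          linarith
      _ = ∫ x, f i x * C i x ∂μ + (n i * ∫ x, r x ∂μ + ∫ x, max (C i x - n i) 0 ∂μ) := by
          have hsum : Integrable (fun x => n i * r x + max (C i x - n i) 0) μ :=
            (hri.const_mul _).add hmax
          rw [integral_add (hf.integrable_mul (hCi i) i) hsum, integral_add (hri.const_mul _) hmax, integral_const_mul]
      _ ≤ _ := by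
          have := mul_le_mul_of_nonneg_left hRδ (Nat.cast_nonneg (α := ℝ) (n i))
          linarith [hn i]
  have hK1 : K * (ε / (3 * (K + 1))) ≤ ε / 3 := by
    rw [mul_div_assoc', div_le_div_iff₀ (by positivity) (by norm_num)]
    nlinarith
  have hS1 : S * (K * δ) + δ = ε / 3 := by
    rw [hδ]
    field_simp
  calc ∑ i, ∫ x, g i x * C i x ∂μ
      ≤ ∑ i, (∫ x, f i x * C i x ∂μ + (n i * (K * δ) + ε / (3 * (K + 1)))) :=
        Finset.sum_le_sum fun i _ => hterm i
    _ = ∑ i, ∫ x, f i x * C i x ∂μ + (S * (K * δ) + K * (ε / (3 * (K + 1)))) := by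
        simp [Finset.sum_add_distrib, ← Finset.sum_mul, hS, hK]
    _ ≤ D + ε := by linarith

/-- Strong duality for the semi-discrete transport problem, formulated with fractional
partitions in place of transport plans. -/
theorem exists_fractionalPartition_le_of_dual_le [Nonempty ι] (hCm : ∀ i, Measurable (C i))
    (hCi : ∀ i, Integrable (C i) μ) (hC0 : ∀ i x, 0 ≤ C i x)
    (hw : ∀ i, 0 ≤ w i) (hw1 : ∑ i, w i = 1)
    (hdual : ∀ φ : ι → ℝ, ∑ i, w i * φ i - ∫ x, ⨆ i, (φ i - C i x) ∂μ ≤ D)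
    {ε : ℝ} (hε : 0 < ε) :
    ∃ g, IsFractionalPartition g ∧ (∀ i, ∫ x, g i x ∂μ = w i) ∧
      ∑ i, ∫ x, g i x * C i x ∂μ ≤ D + ε := by
  classical
  refine exists_integral_eq_of_approx hCi hC0 hw hw1 ?_ hε
  let A : Set ((ι → ℝ) × ℝ) := {p | ∃ f, IsFractionalPartition f ∧
    (∀ i, ∫ x, f i x ∂μ = p.1 i) ∧ ∑ i, ∫ x, f i x * C i x ∂μ ≤ p.2}
  have hA : Convex ℝ A := by
    rintro p ⟨f, hf, hfp, hfc⟩ q ⟨g, hg, hgq, hgc⟩ a b ha hb hab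
    refine ⟨_, hf.convexCombination hg ha hb hab, fun i => ?_, ?_⟩
    · rw [integral_add ((hf.integrable μ i).const_mul a) ((hg.integrable μ i).const_mul b),
        integral_const_mul, integral_const_mul, hfp, hgq]
      simp
    · have : ∀ i, ∫ x, (a * f i x + b * g i x) * C i x ∂μ =
          a * ∫ x, f i x * C i x ∂μ + b * ∫ x, g i x * C i x ∂μ := fun i => by
        rw [← integral_const_mul, ← integral_const_mul, ← integral_add
          ((hf.integrable_mul (hCi i) i).const_mul a) ((hg.integrable_mul (hCi i) i).const_mul b)]
        congr 1
        ext x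
        ring
      simp only [this, Finset.sum_add_distrib, ← Finset.mul_sum]
      simp only [Prod.snd_add, Prod.smul_snd, smul_eq_mul]
      gcongr
  have hmem : (w, D) ∈ closure A := by
    by_contra hnot
    obtain ⟨L, u, hLu, huL⟩ := geometric_hahn_banach_point_closed hA.closure isClosed_closure hnot
    replace huL : ∀ p ∈ A, u < L p := fun p hp => huL p (subset_closure hp)
    set α : ι → ℝ := fun i => L (Pi.single i 1, 0) with hα
    set β : ℝ := L (0, 1) with hβ
    have hL : ∀ (v : ι → ℝ) (t : ℝ), L (v, t) = ∑ i, v i * α i + t * β := fun v t => by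
      have h1 : (v, t) = ∑ i, v i • ((Pi.single i 1, 0) : (ι → ℝ) × ℝ) + t • (0, 1) := by
        ext j
        · simp [Prod.fst_sum, Finset.sum_apply, Pi.single_apply]
        · simp [Prod.snd_sum]
      rw [h1, map_add, map_sum, map_smul, smul_eq_mul]
      simp only [map_smul, smul_eq_mul, hα, hβ]
    set T : ℝ := ∑ i, ∫ x, w i * C i x ∂μ with hT
    have hwA : ∀ t, T ≤ t → (w, t) ∈ A := fun t ht =>
      ⟨_, IsFractionalPartition.const hw hw1, fun i => by simp, ht⟩
    rw [hL] at hLu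
    have hβ0 : 0 < β := by
      have h := huL _ (hwA (max T D) (le_max_left _ _))
      rw [hL] at h
      have h2 : 0 < (max T D - D) * β := by linarith
      exact pos_of_mul_pos_right h2 (sub_nonneg.2 (le_max_right _ _))
    set φ : ι → ℝ := fun i => -(α i / β) with hφ
    have hαφ : ∀ i, α i = -(φ i * β) := fun i => by
      rw [hφ]
      field_simp
    obtain ⟨f, hf, hfs⟩ := IsFractionalPartition.exists_sum_mul_eq_iSup
      (h := fun i x => φ i - C i x) fun i => measurable_const.sub (hCm i)
    have hfA := huL (fun i => ∫ x, f i x ∂μ, ∑ i, ∫ x, f i x * C i x ∂μ)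
      ⟨f, hf, fun i => rfl, le_rfl⟩
    rw [hL] at hfA
    have hint : ∫ x, ⨆ i, (φ i - C i x) ∂μ =
        ∑ i, (∫ x, f i x ∂μ) * φ i - ∑ i, ∫ x, f i x * C i x ∂μ := by
      simp only [← hfs]
      have hi : ∀ i, Integrable (fun x => f i x * (φ i - C i x)) μ := fun i =>
        hf.integrable_mul ((integrable_const _).sub (hCi i)) i
      rw [integral_finsetSum _ fun i _ => hi i, ← Finset.sum_sub_distrib]
      refine Finset.sum_congr rfl fun i _ => ?_
      simp only [mul_sub]
      rw [integral_sub ((hf.integrable μ i).mul_const _) (hf.integrable_mul (hCi i) i),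
        integral_mul_const]
    have hd := hdual φ
    have hs : ∀ v : ι → ℝ, ∑ i, v i * α i = -((∑ i, v i * φ i) * β) := fun v => by
      rw [Finset.sum_mul, ← Finset.sum_neg_distrib]
      refine Finset.sum_congr rfl fun i _ => ?_
      rw [hαφ]
      ring
    rw [hs] at hLu hfA
    rw [hint] at hd
    nlinarith [mul_le_mul_of_nonneg_right hd hβ0.le]
  intro δ hδ
  obtain ⟨p, ⟨f, hf, hfp, hfc⟩, hp⟩ := Metric.mem_closure_iff.1 hmem δ hδ
  rw [Prod.dist_eq, max_lt_iff] at hp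
  refine ⟨f, hf, fun i => ?_, hfc.trans_lt ?_⟩
  · rw [hfp, abs_sub_comm]
    exact (dist_le_pi_dist w p.1 i).trans_lt hp.1
  · have := abs_lt.1 (Real.dist_eq D p.2 ▸ hp.2)
    linarith

end Duality

theorem toReal_iSup_coe_sub {ι : Type*} [Finite ι] [Nonempty ι] (φ : ι → ℝ) {a : ι → ℝ≥0∞}
    (ha : ∀ i, a i ≠ ⊤) :
    (⨆ i, ((φ i : EReal) - (a i : EReal))).toReal = ⨆ i, (φ i - (a i).toReal) := by
  have h : ∀ i, (φ i : EReal) - (a i : EReal) = ((φ i - (a i).toReal : ℝ) : EReal) := fun i => by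
    rw [EReal.coe_sub, EReal.coe_ennreal_toReal (ha i)]
  simp only [h]
  obtain ⟨i, hi⟩ := exists_eq_ciSup_of_finite (f := fun i => φ i - (a i).toReal)
  have : ⨆ i, ((φ i - (a i).toReal : ℝ) : EReal) =
      ((⨆ i, (φ i - (a i).toReal) : ℝ) : EReal) := by
    refine le_antisymm (iSup_le fun j => EReal.coe_le_coe_iff.2 ?_) ?_
    · exact le_ciSup (f := fun i => φ i - (a i).toReal) (Set.finite_range _).bddAbove j
    · rw [← hi]
      exact le_iSup (fun i => ((φ i - (a i).toReal : ℝ) : EReal)) i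
  rw [this, EReal.toReal_coe]

theorem ofReal_integral_le_lintegral_of_ae_le {Ω : Type*} [MeasurableSpace Ω] {μ : Measure Ω}
    {f : Ω → ℝ} (hf : Integrable f μ) {g : Ω → ℝ≥0∞} (h : ∀ᵐ x ∂μ, ENNReal.ofReal (f x) ≤ g x) :
    ENNReal.ofReal (∫ x, f x ∂μ) ≤ ∫⁻ x, g x ∂μ := by
  have hp : Integrable (fun x => max (f x) 0) μ := hf.sup (integrable_const_iff.2 (Or.inl rfl))
  calc ENNReal.ofReal (∫ x, f x ∂μ) ≤ ENNReal.ofReal (∫ x, max (f x) 0 ∂μ) :=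
        ENNReal.ofReal_le_ofReal (integral_mono hf hp fun x => le_max_left _ _)
    _ = ∫⁻ x, ENNReal.ofReal (max (f x) 0) ∂μ :=
        ofReal_integral_eq_lintegral_ofReal hp (ae_of_all _ fun x => le_max_right _ _)
    _ ≤ ∫⁻ x, g x ∂μ := by
        refine lintegral_mono_ae ?_
        filter_upwards [h] with x hx
        rcases le_total (f x) 0 with h0 | h0
        · simp [max_eq_right h0]
        · rwa [max_eq_left h0]

section Plans

variable {Ω E ι : Type*} [MeasurableSpace Ω] [MeasurableSpace E] [Fintype ι] {μ : Measure Ω}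
  [IsProbabilityMeasure μ] {y : ι → E} {w : ι → ℝ} {c : Ω → E → ℝ≥0∞}

/-- The transport plan sending the share `g i` of `μ` to the atom `y i`. -/
theorem exists_plan_of_fractionalPartition {g : ι → Ω → ℝ} (hg : IsFractionalPartition g)
    (hgw : ∀ i, ∫ x, g i x ∂μ = w i) (hc : ∀ i, Measurable fun x => c x (y i))
    (hc_int : ∀ i, ∫⁻ x, c x (y i) ∂μ ≠ ⊤) :
    ∃ π : Measure (Ω × E), IsProbabilityMeasure π ∧ π.map Prod.fst = μ ∧
      π.map Prod.snd = ∑ i, ENNReal.ofReal (w i) • Measure.dirac (y i) ∧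
      ∫⁻ q, c q.1 q.2 ∂π ≤ ENNReal.ofReal (∑ i, ∫ x, g i x * (c x (y i)).toReal ∂μ) := by
  let ρ : ι → Measure Ω := fun i => μ.withDensity fun x => ENNReal.ofReal (g i x)
  let π : Measure (Ω × E) := ∑ i, (ρ i).map fun x => (x, y i)
  have hpair : ∀ i, Measurable fun x : Ω => (x, y i) := fun i => measurable_prodMk_right
  have hgm : ∀ i, Measurable fun x => ENNReal.ofReal (g i x) := fun i =>
    (hg.measurable i).ennreal_ofReal
  have hfst : π.map Prod.fst = μ := by
    rw [Measure.map_finset_sum measurable_fst.aemeasurable]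
    have : ∀ i, ((ρ i).map fun x => (x, y i)).map Prod.fst = ρ i := fun i => by
      rw [Measure.map_map measurable_fst (hpair i)]
      exact Measure.map_id
    simp only [this]
    ext s hs
    rw [Measure.finsetSum_apply]
    simp only [ρ, withDensity_apply _ hs]
    rw [← lintegral_finsetSum _ fun i _ => hgm i]
    simp only [← ENNReal.ofReal_sum_of_nonneg fun i _ => hg.nonneg i _, hg.sum_eq_one]
    simp
  refine ⟨π, ?_, hfst, ?_, ?_⟩
  · have : IsProbabilityMeasure (π.map Prod.fst) := hfst ▸ inferInstance
    exact Measure.isProbabilityMeasure_of_map Prod.fst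
  · rw [Measure.map_finset_sum measurable_snd.aemeasurable]
    refine Finset.sum_congr rfl fun i _ => ?_
    rw [Measure.map_map measurable_snd (hpair i)]
    have : (Prod.snd ∘ fun x : Ω => (x, y i)) = fun _ => y i := rfl
    rw [this, Measure.map_const, withDensity_apply _ MeasurableSet.univ, setLIntegral_univ,
      ← ofReal_integral_eq_lintegral_ofReal (hg.integrable μ i) (ae_of_all _ (hg.nonneg i)), hgw]
  · have hint : ∀ i, Integrable (fun x => (c x (y i)).toReal) μ := fun i =>
      integrable_toReal_of_lintegral_ne_top (hc i).aemeasurable (hc_int i)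
    rw [lintegral_finsetSum_measure, ENNReal.ofReal_sum_of_nonneg fun i _ =>
      integral_nonneg fun x => mul_nonneg (hg.nonneg i x) ENNReal.toReal_nonneg]
    refine Finset.sum_le_sum fun i _ => (lintegral_map_le _ _).trans ?_
    rw [lintegral_withDensity_eq_lintegral_mul _ (hgm i) (hc i),
      ofReal_integral_eq_lintegral_ofReal (hg.integrable_mul (hint i) i)
        (ae_of_all _ fun x => mul_nonneg (hg.nonneg i x) ENNReal.toReal_nonneg)]
    refine lintegral_mono_ae ?_
    filter_upwards [ae_lt_top (hc i) (hc_int i)] with x hx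
    rw [ENNReal.ofReal_mul (hg.nonneg i x), ENNReal.ofReal_toReal hx.ne]
    rfl

/-- Weak duality for the semi-discrete transport problem. -/
theorem ofReal_dual_le_lintegral [MeasurableSingletonClass E] [Nonempty ι]
    (hy : Function.Injective y) (hw : ∀ i, 0 ≤ w i)
    (hc : ∀ i, Measurable fun x => c x (y i)) (hc_int : ∀ i, ∫⁻ x, c x (y i) ∂μ ≠ ⊤)
    {π : Measure (Ω × E)} (hfst : π.map Prod.fst = μ)
    (hsnd : π.map Prod.snd = ∑ i, ENNReal.ofReal (w i) • Measure.dirac (y i)) (φ : ι → ℝ) :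
    ENNReal.ofReal (∑ i, w i * φ i - ∫ x, ⨆ i, (φ i - (c x (y i)).toReal) ∂μ) ≤
      ∫⁻ q, c q.1 q.2 ∂π := by
  classical
  let Φ : E → ℝ := fun z => ∑ i, ({y i} : Set E).indicator (fun _ => φ i) z
  have hΦy : ∀ i, Φ (y i) = φ i := fun i => by
    simp [Φ, Set.indicator_apply, hy.eq_iff]
  have hΦm : Measurable Φ := Finset.measurable_sum _ fun i _ =>
    measurable_const.indicator (measurableSet_singleton _)
  let M : Ω → ℝ := fun x => ⨆ i, (φ i - (c x (y i)).toReal)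
  have hM : Integrable M μ := integrable_iSup_sub (fun i => (hc i).ennreal_toReal)
    (fun i => integrable_toReal_of_lintegral_ne_top (hc i).aemeasurable (hc_int i)) φ
  have hΦd : ∀ i ∈ Finset.univ, Integrable Φ (ENNReal.ofReal (w i) • Measure.dirac (y i)) :=
    fun i _ => (integrable_dirac (by finiteness)).smul_measure ENNReal.ofReal_ne_top
  have hΦi : Integrable Φ (π.map Prod.snd) := by
    rw [hsnd]
    exact integrable_finsetSum_measure.2 hΦd
  have hΦint : ∫ q, Φ q.2 ∂π = ∑ i, w i * φ i := by
    rw [← integral_map measurable_snd.aemeasurable hΦm.aestronglyMeasurable, hsnd,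
      integral_finsetSum_measure hΦd]
    simp [integral_smul_measure, hΦy, ENNReal.toReal_ofReal, hw]
  have hMint : ∫ q, M q.1 ∂π = ∫ x, M x ∂μ := by
    rw [← hfst] at hM ⊢
    rw [integral_map measurable_fst.aemeasurable hM.1]
  have hΦi' : Integrable (fun q : Ω × E => Φ q.2) π := hΦi.comp_measurable measurable_snd
  have hMi' : Integrable (fun q : Ω × E => M q.1) π :=
    (hfst.symm ▸ hM : Integrable M (π.map Prod.fst)).comp_measurable measurable_fst
  change ENNReal.ofReal (_ - ∫ x, M x ∂μ) ≤ _
  rw [← hΦint, ← hMint, ← integral_sub hΦi' hMi']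
  refine ofReal_integral_le_lintegral_of_ae_le (hΦi'.sub hMi') ?_
  have hrange : ∀ᵐ z ∂(π.map Prod.snd), z ∈ Set.range y := by
    rw [hsnd, ae_iff, Measure.finsetSum_apply]
    refine Finset.sum_eq_zero fun i _ => ?_
    simp [Measure.dirac_apply]
  have hfin : ∀ᵐ x ∂(π.map Prod.fst), ∀ i, c x (y i) < ⊤ := by
    rw [hfst]
    exact ae_all_iff.2 fun i => ae_lt_top (hc i) (hc_int i)
  filter_upwards [ae_of_ae_map measurable_snd.aemeasurable hrange,
    ae_of_ae_map measurable_fst.aemeasurable hfin] with q hq2 hq1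
  obtain ⟨i, hi⟩ := hq2
  rw [Pi.sub_apply, ← hi, hΦy]
  refine ENNReal.ofReal_le_of_le_toReal ?_
  have : φ i - (c q.1 (y i)).toReal ≤ M q.1 :=
    le_ciSup (f := fun i => φ i - (c q.1 (y i)).toReal) (Set.finite_range _).bddAbove i
  linarith

end Plans

/-- Kantorovich duality for semi-discrete optimal transport via the discrete
`c`-transform `ψ_c(φ, x) = maxᵢ (φᵢ − c(x, yᵢ))` (Lemma 3.1 of the paper). -/
theorem stmt_2
    (m k N : ℕ) (hN : 1 ≤ N)
    (X : Set (EuclideanSpace ℝ (Fin m))) (hX : IsClosed X)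
    (μ : Measure (EuclideanSpace ℝ (Fin m))) (hμ : IsProbabilityMeasure μ)
    (hμX : μ Xᶜ = 0)
    (y : Fin N → EuclideanSpace ℝ (Fin k)) (hy : Function.Injective y)
    (ν : Fin N → ℝ) (hν_nonneg : ∀ i, 0 ≤ ν i) (hν_sum : ∑ i, ν i = 1)
    (c : EuclideanSpace ℝ (Fin m) → EuclideanSpace ℝ (Fin k) → ℝ≥0∞)
    (hc_lsc : ∀ i, LowerSemicontinuous fun x => c x (y i))
    (hc_int : ∀ i, ∫⁻ x, c x (y i) ∂μ ≠ ⊤)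
    (ψ : (Fin N → ℝ) → EuclideanSpace ℝ (Fin m) → EReal)
    (hψ : ∀ φ x, ψ φ x = ⨆ i, ((φ i : EReal) - ((c x (y i) : ℝ≥0∞) : EReal))) :
    (⨅ π ∈ {π : Measure (EuclideanSpace ℝ (Fin m) × EuclideanSpace ℝ (Fin k)) |
        IsProbabilityMeasure π ∧ π.map Prod.fst = μ ∧
        π.map Prod.snd = ∑ i, ENNReal.ofReal (ν i) • Measure.dirac (y i)},
      ∫⁻ q, c q.1 q.2 ∂π) =
    ENNReal.ofReal (⨆ φ : Fin N → ℝ,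
      (∑ i, ν i * φ i - ∫ x, (ψ φ x).toReal ∂μ)) := by
  have : Nonempty (Fin N) := ⟨⟨0, hN⟩⟩
  have hcm : ∀ i, Measurable fun x => c x (y i) := fun i => (hc_lsc i).measurable
  set C : Fin N → EuclideanSpace ℝ (Fin m) → ℝ := fun i x => (c x (y i)).toReal with hC
  have hCm : ∀ i, Measurable (C i) := fun i => (hcm i).ennreal_toReal
  have hCi : ∀ i, Integrable (C i) μ := fun i =>
    integrable_toReal_of_lintegral_ne_top (hcm i).aemeasurable (hc_int i)
  have hψint : ∀ φ, ∫ x, (ψ φ x).toReal ∂μ = ∫ x, ⨆ i, (φ i - C i x) ∂μ := fun φ => by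
    refine integral_congr_ae ?_
    filter_upwards [ae_all_iff.2 fun i => ae_lt_top (hcm i) (hc_int i)] with x hx
    rw [hψ, toReal_iSup_coe_sub φ fun i => (hx i).ne]
  simp only [hψint]
  refine le_antisymm ?_ (le_iInf₂ fun π ⟨_, hfst, hsnd⟩ => ?_)
  · have hbdd : BddAbove (range fun φ : Fin N → ℝ =>
        ∑ i, ν i * φ i - ∫ x, ⨆ i, (φ i - C i x) ∂μ) := by
      refine ⟨∑ i, ν i * ∫ x, C i x ∂μ, ?_⟩
      rintro _ ⟨φ, rfl⟩
      have hle : ∀ i, φ i - ∫ x, C i x ∂μ ≤ ∫ x, ⨆ i, (φ i - C i x) ∂μ := fun i => by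
        calc φ i - ∫ x, C i x ∂μ = ∫ x, (φ i - C i x) ∂μ := by
              rw [integral_sub (integrable_const _) (hCi i)]
              simp
          _ ≤ _ := integral_mono ((integrable_const _).sub (hCi i))
              (integrable_iSup_sub hCm hCi φ) fun x =>
                le_ciSup (f := fun i => φ i - C i x) (Set.finite_range _).bddAbove i
      have h := Finset.sum_le_sum fun i (_ : i ∈ Finset.univ) =>
        mul_le_mul_of_nonneg_left (hle i) (hν_nonneg i)
      simp only [mul_sub, Finset.sum_sub_distrib, ← Finset.sum_mul, hν_sum, one_mul] at h
      simp only
      linarith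
    refine ENNReal.le_of_forall_pos_le_add fun ε hε _ => ?_
    obtain ⟨g, hg, hgν, hgc⟩ := exists_fractionalPartition_le_of_dual_le hCm hCi
      (fun i x => ENNReal.toReal_nonneg) hν_nonneg hν_sum (fun φ => le_ciSup hbdd φ)
      (NNReal.coe_pos.2 hε)
    obtain ⟨π, hπ, hfst, hsnd, hcost⟩ := exists_plan_of_fractionalPartition hg hgν hcm hc_int
    calc _ ≤ ∫⁻ q, c q.1 q.2 ∂π := iInf₂_le π ⟨hπ, hfst, hsnd⟩
      _ ≤ _ := hcost
      _ ≤ _ := ENNReal.ofReal_le_ofReal hgc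
      _ ≤ _ := ENNReal.ofReal_add_le
      _ = _ := by rw [ENNReal.ofReal_coe_nnreal]
  · rcases eq_or_ne (∫⁻ q, c q.1 q.2 ∂π) ⊤ with htop | htop
    · exact htop ▸ le_top
    · refine ENNReal.ofReal_le_of_le_toReal (ciSup_le fun φ => ?_)
      exact (ENNReal.ofReal_le_iff_le_toReal htop).1
        (ofReal_dual_le_lintegral hy hν_nonneg hcm hc_int hfst hsnd φ)
end
end

section
/- Let X ⊆ ℝ^m be closed, let μ be a Borel probability measure on X, let y₁,…,y_N ∈ ℝ^k be distinct, let ν = Σ_{i=1}^N ν_i δ_{y_i} and η = Σ_{i=1}^N η_i δ_{y_i} with ν, η ∈ Δ^N and ν_i > 0, η_i > 0 for all i. Let c : X × ℝ^k → [0,∞] be such that x ↦ c(x,y_i) is lower semicontinuous and μ-integrable for each i, and let f : [0,∞) → ℝ be convex and lower semicontinuous with f(1) = 0. Then the regularized primal optimal transport problem inf { ∫ c dπ + ∫ f( dπ/d(μ⊗η) ) d(μ⊗η) : π ∈ Π(μ,ν), π absolutely continuous with respect to μ⊗η } has the same optimal value as the dual problem sup_{φ ∈ ℝ^N} ∫_X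 [ min_{p ∈ Δ^N} Σ_{i=1}^N ( φ_i ν_i − (φ_i − c(x, y_i)) p_i + f(p_i/η_i) η_i ) ] dμ(x), and the infimum in the primal problem is attained. -/
open MeasureTheory Set
open scoped ENNReal

noncomputable section

open Filter Topology

/-- In an inner product space, almost norm-minimal elements of a bounded decreasing sequence of
nonempty convex sets form a Cauchy sequence. -/
lemma exists_cauchySeq_mem_of_antitone_convex {H : Type*} [NormedAddCommGroup H]
    [InnerProductSpace ℝ H] {s : ℕ → Set H} (hs : Antitone s) (hconv : ∀ n, Convex ℝ (s n))
    (hne : ∀ n, (s n).Nonempty) {R : ℝ} (hR : ∀ a ∈ s 0, ‖a‖ ≤ R) :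
    ∃ q : ℕ → H, (∀ n, q n ∈ s n) ∧ CauchySeq q := by
  set d : ℕ → ℝ := fun n => sInf ((fun a => ‖a‖ ^ 2) '' s n)
  have hbdd : ∀ n, BddBelow ((fun a : H => ‖a‖ ^ 2) '' s n) := fun n =>
    ⟨0, by rintro _ ⟨a, -, rfl⟩; positivity⟩
  have hdle : ∀ n, ∀ a ∈ s n, d n ≤ ‖a‖ ^ 2 := fun n a ha =>
    csInf_le (hbdd n) ⟨a, ha, rfl⟩
  have hdmono : Monotone d := fun n m hnm =>
    csInf_le_csInf (hbdd n) ((hne m).image _) (image_mono (hs hnm))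
  have hdbdd : BddAbove (range d) := by
    refine ⟨R ^ 2, ?_⟩
    rintro _ ⟨n, rfl⟩
    obtain ⟨a, ha⟩ := hne n
    exact (hdle n a ha).trans
      (pow_le_pow_left₀ (norm_nonneg _) (hR a (hs (Nat.zero_le n) ha)) 2)
  have hex : ∀ n : ℕ, ∃ a ∈ s n, ‖a‖ ^ 2 < d n + 1 / ((n : ℝ) + 1) := by
    intro n
    have hlt : d n < d n + 1 / ((n : ℝ) + 1) := by
      have : 0 < 1 / ((n : ℝ) + 1) := by positivity
      linarith
    obtain ⟨_, ⟨a, ha, rfl⟩, hlt⟩ := exists_lt_of_csInf_lt ((hne n).image _) hlt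
    exact ⟨a, ha, hlt⟩
  choose q hq hqlt using hex
  refine ⟨q, hq, ?_⟩
  set l := ⨆ n, d n
  have hlim : Tendsto d atTop (𝓝 l) := tendsto_atTop_ciSup hdmono hdbdd
  set b : ℕ → ℝ := fun n => √(4 * (1 / ((n : ℝ) + 1)) + 2 * (l - d n))
  have hb : Tendsto b atTop (𝓝 0) := by
    have h1 : Tendsto (fun n : ℕ => 4 * (1 / ((n : ℝ) + 1)) + 2 * (l - d n)) atTop
        (𝓝 (4 * 0 + 2 * (l - l))) :=
      (tendsto_one_div_add_atTop_nhds_zero_nat.const_mul 4).add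
        ((tendsto_const_nhds.sub hlim).const_mul 2)
    have h2 := (Real.continuous_sqrt.tendsto _).comp h1
    simp only [mul_zero, sub_self, add_zero, Real.sqrt_zero] at h2
    exact h2
  refine cauchySeq_of_le_tendsto_0' b (fun n m hnm => ?_) hb
  rw [dist_eq_norm]
  apply Real.le_sqrt_of_sq_le
  have hmid : (1 / 2 : ℝ) • q n + (1 / 2 : ℝ) • q m ∈ s n :=
    hconv n (hq n) (hs hnm (hq m)) (by norm_num) (by norm_num) (by norm_num)
  have h1 := hdle n _ hmid
  rw [← smul_add, norm_smul, mul_pow] at h1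
  have h2 := parallelogram_law_with_norm ℝ (q n) (q m)
  have h3 : 1 / ((m : ℝ) + 1) ≤ 1 / ((n : ℝ) + 1) := by
    apply one_div_le_one_div_of_le (by positivity)
    have : (n : ℝ) ≤ m := by exact_mod_cast hnm
    linarith
  have h4 : d m ≤ l := le_ciSup hdbdd m
  have h5 := hqlt n
  have h6 := hqlt m
  norm_num at h1 h2 h3 h5 h6 ⊢
  linarith

section Selections

variable {Ω ι : Type*} [Fintype ι]

/-- The pointwise cost of `q` at `x`: a linear term with coefficients `C · x` plus a penalty. -/
def pointCost (C : ι → Ω → ℝ) (h : EuclideanSpace ℝ ι → ℝ) (x : Ω) (q : EuclideanSpace ℝ ι) : ℝ :=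
  ∑ i, C i x * q i + h q

variable {K : Set (EuclideanSpace ℝ ι)} {C : ι → Ω → ℝ} {h : EuclideanSpace ℝ ι → ℝ}

lemma exists_pointCost_bound (hK : IsCompact K) (hh : ContinuousOn h K) :
    ∃ R, 0 ≤ R ∧ (∀ q ∈ K, ‖q‖ ≤ R) ∧
      ∀ (C : ι → Ω → ℝ) (x : Ω), ∀ q ∈ K, ‖pointCost C h x q‖ ≤ R * ∑ i, |C i x| + R := by
  obtain ⟨R₁, h₁⟩ := hK.isBounded.exists_norm_le
  obtain ⟨R₂, h₂⟩ := hK.exists_bound_of_continuousOn hh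
  set R := max 0 (max R₁ R₂)
  have hR₁ : R₁ ≤ R := (le_max_left _ _).trans (le_max_right _ _)
  have hR₂ : R₂ ≤ R := (le_max_right _ _).trans (le_max_right _ _)
  refine ⟨R, le_max_left _ _, fun q hq => (h₁ q hq).trans hR₁, fun C x q hq => ?_⟩
  refine (norm_add_le _ _).trans (add_le_add ?_ ((h₂ q hq).trans hR₂))
  refine (norm_sum_le _ _).trans ?_
  rw [Finset.mul_sum]
  refine Finset.sum_le_sum fun i _ => ?_
  rw [norm_mul, mul_comm, Real.norm_eq_abs (C i x)]
  exact mul_le_mul_of_nonneg_right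
    ((PiLp.norm_apply_le q i).trans ((h₁ q hq).trans hR₁)) (abs_nonneg _)

lemma pointCost_combo_le (hconv : ConvexOn ℝ K h) {x : Ω} {q q' : EuclideanSpace ℝ ι}
    (hq : q ∈ K) (hq' : q' ∈ K) {a b : ℝ} (ha : 0 ≤ a) (hb : 0 ≤ b) (hab : a + b = 1) :
    pointCost C h x (a • q + b • q') ≤ a * pointCost C h x q + b * pointCost C h x q' := by
  have h1 := hconv.2 hq hq' ha hb hab
  have h2 : ∑ i, C i x * (a • q + b • q') i
      = a * ∑ i, C i x * q i + b * ∑ i, C i x * q' i := by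
    rw [Finset.mul_sum, Finset.mul_sum, ← Finset.sum_add_distrib]
    refine Finset.sum_congr rfl fun i _ => ?_
    simp only [PiLp.add_apply, PiLp.smul_apply, smul_eq_mul]
    ring
  simp only [pointCost, h2]
  simp only [smul_eq_mul] at h1
  linarith

/-- The least value of the pointwise cost over `K`. -/
def minCost (C : ι → Ω → ℝ) (h : EuclideanSpace ℝ ι → ℝ) (K : Set (EuclideanSpace ℝ ι)) (x : Ω) :
    ℝ :=
  sInf (pointCost C h x '' K)

lemma continuousOn_pointCost (hh : ContinuousOn h K) (x : Ω) :
    ContinuousOn (pointCost C h x) K :=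
  (continuous_finsetSum _ fun i _ => continuous_const.mul
    (EuclideanSpace.proj (𝕜 := ℝ) i).continuous).continuousOn.add hh

lemma exists_isLeast_pointCost (hK : IsCompact K) (hne : K.Nonempty) (hh : ContinuousOn h K)
    (x : Ω) : ∃ q ∈ K, minCost C h K x = pointCost C h x q ∧
      ∀ q' ∈ K, pointCost C h x q ≤ pointCost C h x q' := by
  obtain ⟨q, hq, hmin⟩ := hK.exists_isMinOn hne (continuousOn_pointCost (C := C) hh x)
  refine ⟨q, hq, IsLeast.csInf_eq ⟨⟨q, hq, rfl⟩, ?_⟩, fun q' hq' => hmin hq'⟩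
  rintro _ ⟨q', hq', rfl⟩
  exact hmin hq'

lemma minCost_le (hK : IsCompact K) (hh : ContinuousOn h K) (x : Ω) {q : EuclideanSpace ℝ ι}
    (hq : q ∈ K) : minCost C h K x ≤ pointCost C h x q := by
  obtain ⟨q₀, -, h1, h2⟩ := exists_isLeast_pointCost (C := C) hK ⟨q, hq⟩ hh x
  exact h1.trans_le (h2 q hq)

lemma exists_seq_forall_pointCost_lt (hK : IsCompact K) (hne : K.Nonempty)
    (hh : ContinuousOn h K) : ∃ u : ℕ → EuclideanSpace ℝ ι, (∀ n, u n ∈ K) ∧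
      ∀ (C : ι → Ω → ℝ) (x : Ω) (ε : ℝ), 0 < ε →
        ∃ n, pointCost C h x (u n) < minCost C h K x + ε := by
  have := hne.to_subtype
  obtain ⟨u, hu⟩ := TopologicalSpace.exists_dense_seq K
  refine ⟨fun n => u n, fun n => (u n).2, fun C x ε hε => ?_⟩
  obtain ⟨q, hq, h1, -⟩ := exists_isLeast_pointCost (C := C) hK hne hh x
  have hcont : Continuous fun a : K => pointCost C h x a :=
    continuousOn_iff_continuous_domRestrict.1 (continuousOn_pointCost hh x)
  exact hu.exists_mem_open (isOpen_lt hcont continuous_const)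
    ⟨⟨q, hq⟩, by simpa [h1] using hε⟩

/-- The measurable maps with values in `K`. -/
def measurableSelections (Ω : Type*) [MeasurableSpace Ω] (K : Set (EuclideanSpace ℝ ι)) :
    Set (Ω → EuclideanSpace ℝ ι) :=
  {p | Measurable p ∧ ∀ x, p x ∈ K}

variable [MeasurableSpace Ω] {μ : Measure Ω} {p p' : Ω → EuclideanSpace ℝ ι}

lemma convex_measurableSelections (hK : Convex ℝ K) : Convex ℝ (measurableSelections Ω K) :=
  fun _ hp _ hp' _ _ ha hb hab =>
    ⟨(hp.1.const_smul _).add (hp'.1.const_smul _), fun x => hK (hp.2 x) (hp'.2 x) ha hb hab⟩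

lemma measurable_coord (hp : Measurable p) (i : ι) : Measurable fun x => p x i :=
  (EuclideanSpace.proj (𝕜 := ℝ) i).continuous.measurable.comp hp

lemma measurable_comp_selection (hh : ContinuousOn h K) (hp : p ∈ measurableSelections Ω K) :
    Measurable fun x => h (p x) :=
  (continuousOn_iff_continuous_domRestrict.1 hh).measurable.comp
    (hp.1.subtype_mk (h := hp.2))

lemma measurable_pointCost (hC : ∀ i, Measurable (C i)) (hh : ContinuousOn h K)
    (hp : p ∈ measurableSelections Ω K) : Measurable fun x => pointCost C h x (p x) :=
  (Finset.measurable_sum _ fun i _ => (hC i).mul (measurable_coord hp.1 i)).add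
    (measurable_comp_selection hh hp)

lemma integrable_coord [IsFiniteMeasure μ] (hK : IsCompact K)
    (hp : p ∈ measurableSelections Ω K) (i : ι) : Integrable (fun x => p x i) μ := by
  obtain ⟨R, h₁⟩ := hK.isBounded.exists_norm_le
  exact Integrable.of_bound (measurable_coord hp.1 i).aestronglyMeasurable R
    (Eventually.of_forall fun x => (PiLp.norm_apply_le _ i).trans (h₁ _ (hp.2 x)))

lemma integrable_pointCost [IsFiniteMeasure μ] (hK : IsCompact K) (hh : ContinuousOn h K)
    (hC : ∀ i, Measurable (C i)) (hCi : ∀ i, Integrable (C i) μ)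
    (hp : p ∈ measurableSelections Ω K) : Integrable (fun x => pointCost C h x (p x)) μ := by
  obtain ⟨R, -, -, h₂⟩ := exists_pointCost_bound (Ω := Ω) hK hh
  refine Integrable.mono' (g := fun x => R * ∑ i, |C i x| + R) ?_
    (measurable_pointCost hC hh hp).aestronglyMeasurable
    (Eventually.of_forall fun x => h₂ C x _ (hp.2 x))
  exact ((integrable_finsetSum _ fun i _ => (hCi i).abs).const_mul _).add (integrable_const _)

lemma integral_pointCost_combo_le [IsFiniteMeasure μ] (hK : IsCompact K) (hh : ContinuousOn h K)
    (hconv : ConvexOn ℝ K h) (hC : ∀ i, Measurable (C i)) (hCi : ∀ i, Integrable (C i) μ)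
    (hp : p ∈ measurableSelections Ω K) (hp' : p' ∈ measurableSelections Ω K)
    {a b : ℝ} (ha : 0 ≤ a) (hb : 0 ≤ b) (hab : a + b = 1) :
    ∫ x, pointCost C h x ((a • p + b • p') x) ∂μ
      ≤ a * ∫ x, pointCost C h x (p x) ∂μ + b * ∫ x, pointCost C h x (p' x) ∂μ := by
  have i1 := integrable_pointCost (μ := μ) hK hh hC hCi hp
  have i2 := integrable_pointCost (μ := μ) hK hh hC hCi hp'
  rw [← integral_const_mul, ← integral_const_mul, ← integral_add (i1.const_mul _) (i2.const_mul _)]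
  exact integral_mono (integrable_pointCost hK hh hC hCi
    (convex_measurableSelections hconv.1 hp hp' ha hb hab))
    ((i1.const_mul _).add (i2.const_mul _))
    fun x => pointCost_combo_le hconv (hp.2 x) (hp'.2 x) ha hb hab

lemma integral_coord_combo [IsFiniteMeasure μ] (hK : IsCompact K)
    (hp : p ∈ measurableSelections Ω K) (hp' : p' ∈ measurableSelections Ω K) (a b : ℝ) (i : ι) :
    ∫ x, (a • p + b • p') x i ∂μ = a * ∫ x, p x i ∂μ + b * ∫ x, p' x i ∂μ := by
  have i1 := integrable_coord (μ := μ) hK hp i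
  have i2 := integrable_coord (μ := μ) hK hp' i
  rw [← integral_const_mul, ← integral_const_mul, ← integral_add (i1.const_mul _) (i2.const_mul _)]
  rfl

/-- Constraints on the mean and on the cost that can be met approximately can be met exactly. -/
lemma exists_selection_of_forall_approx [IsProbabilityMeasure μ] (hK : IsCompact K)
    (hh : ContinuousOn h K) (hconv : ConvexOn ℝ K h) (hC : ∀ i, Measurable (C i))
    (hCi : ∀ i, Integrable (C i) μ) {ν : ι → ℝ} {T : ℝ}
    (happ : ∀ ε : ℝ, 0 < ε → ∃ p ∈ measurableSelections Ω K,
      (∀ i, |∫ x, p x i ∂μ - ν i| ≤ ε) ∧ ∫ x, pointCost C h x (p x) ∂μ ≤ T + ε) :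
    ∃ p ∈ measurableSelections Ω K,
      (∀ i, ∫ x, p x i ∂μ = ν i) ∧ ∫ x, pointCost C h x (p x) ∂μ ≤ T := by
  classical
  obtain ⟨R, hR0, hRK, hRC⟩ := exists_pointCost_bound (Ω := Ω) hK hh
  set ε : ℕ → ℝ := fun n => 1 / ((n : ℝ) + 1)
  have hεpos : ∀ n, 0 < ε n := fun n => by positivity
  have hεanti : Antitone ε := fun n m hnm =>
    one_div_le_one_div_of_le (by positivity) (by gcongr)
  set s : ℕ → Set (Lp (EuclideanSpace ℝ ι) 2 μ) := fun n =>
    {P | ∃ p ∈ measurableSelections Ω K, P =ᵐ[μ] p ∧ (∀ i, |∫ x, p x i ∂μ - ν i| ≤ ε n) ∧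
      ∫ x, pointCost C h x (p x) ∂μ ≤ T + ε n}
  have hs : Antitone s := by
    rintro n m hnm P ⟨p, hp, hPp, h1, h2⟩
    exact ⟨p, hp, hPp, fun i => (h1 i).trans (hεanti hnm),
      h2.trans (by have := hεanti hnm; linarith)⟩
  have hsconv : ∀ n, Convex ℝ (s n) := by
    rintro n P ⟨p, hp, hPp, h1, h2⟩ P' ⟨p', hp', hPp', h1', h2'⟩ a b ha hb hab
    refine ⟨a • p + b • p', convex_measurableSelections hconv.1 hp hp' ha hb hab, ?_, ?_, ?_⟩
    · filter_upwards [Lp.coeFn_add (a • P) (b • P'), Lp.coeFn_smul a P, Lp.coeFn_smul b P',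
        hPp, hPp'] with x e1 e2 e3 e4 e5
      rw [e1, Pi.add_apply, e2, e3, Pi.smul_apply, Pi.smul_apply, e4, e5]
      rfl
    · intro i
      rw [integral_coord_combo hK hp hp']
      have e : a * ∫ x, p x i ∂μ + b * ∫ x, p' x i ∂μ - ν i
          = a * (∫ x, p x i ∂μ - ν i) + b * (∫ x, p' x i ∂μ - ν i) := by
        linear_combination ν i * hab
      rw [e]
      refine (abs_add_le _ _).trans ?_
      rw [abs_mul, abs_mul, abs_of_nonneg ha, abs_of_nonneg hb]
      calc _ ≤ a * ε n + b * ε n := by gcongr <;> [exact h1 i; exact h1' i]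
        _ = ε n := by rw [← add_mul, hab, one_mul]
    · refine (integral_pointCost_combo_le hK hh hconv hC hCi hp hp' ha hb hab).trans ?_
      calc _ ≤ a * (T + ε n) + b * (T + ε n) := by gcongr
        _ = T + ε n := by rw [← add_mul, hab, one_mul]
  have hsne : ∀ n, (s n).Nonempty := by
    intro n
    obtain ⟨p, hp, h1, h2⟩ := happ (ε n) (hεpos n)
    have hm : MemLp p 2 μ := MemLp.of_bound hp.1.aestronglyMeasurable R
      (Eventually.of_forall fun x => hRK _ (hp.2 x))
    exact ⟨hm.toLp p, p, hp, hm.coeFn_toLp, h1, h2⟩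
  have hsbdd : ∀ P ∈ s 0, ‖P‖ ≤ R := by
    rintro P ⟨p, hp, hPp, -, -⟩
    have := Lp.norm_le_of_ae_bound (f := P) (p := 2) (C := R) hR0
      (by filter_upwards [hPp] with x hx; rw [hx]; exact hRK _ (hp.2 x))
    simpa [measureUnivNNReal] using this
  obtain ⟨q, hq, hcau⟩ := exists_cauchySeq_mem_of_antitone_convex hs hsconv hsne hsbdd
  obtain ⟨P, hP⟩ := cauchySeq_tendsto_of_complete hcau
  choose p hp hqp h1 h2 using hq
  obtain ⟨ns, hns, hae⟩ := (tendstoInMeasure_of_tendsto_Lp hP).exists_seq_tendsto_ae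
  have hpae : ∀ᵐ x ∂μ, Tendsto (fun k => p (ns k) x) atTop (𝓝 (P x)) := by
    have : ∀ᵐ x ∂μ, ∀ n, q n x = p n x := ae_all_iff.2 hqp
    filter_upwards [hae, this] with x hx hx'
    simpa only [hx'] using hx
  obtain ⟨p₀, hp₀, -⟩ := happ 1 one_pos
  have hPm : Measurable (P : Ω → EuclideanSpace ℝ ι) := (Lp.stronglyMeasurable P).measurable
  set p' : Ω → EuclideanSpace ℝ ι := fun x => if P x ∈ K then P x else p₀ x
  have hp' : p' ∈ measurableSelections Ω K := by
    refine ⟨Measurable.ite (hPm hK.isClosed.measurableSet) hPm hp₀.1, fun x => ?_⟩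
    by_cases hx : P x ∈ K
    · simp [p', hx]
    · simp [p', hx, hp₀.2 x]
  have hlim : ∀ᵐ x ∂μ, Tendsto (fun k => p (ns k) x) atTop (𝓝 (p' x)) := by
    filter_upwards [hpae] with x hx
    have : P x ∈ K := hK.isClosed.mem_of_tendsto hx (Eventually.of_forall fun k => (hp _).2 x)
    simpa [p', this] using hx
  have hεlim : Tendsto (fun k => ε (ns k)) atTop (𝓝 0) :=
    tendsto_one_div_add_atTop_nhds_zero_nat.comp hns.tendsto_atTop
  refine ⟨p', hp', fun i => ?_, ?_⟩
  · have hl : Tendsto (fun k => ∫ x, p (ns k) x i ∂μ) atTop (𝓝 (∫ x, p' x i ∂μ)) := by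
      refine tendsto_integral_of_dominated_convergence (fun _ => R)
        (fun k => (measurable_coord (hp _).1 i).aestronglyMeasurable) (integrable_const _)
        (fun k => Eventually.of_forall fun x =>
          (PiLp.norm_apply_le _ i).trans (hRK _ ((hp _).2 x))) ?_
      filter_upwards [hlim] with x hx
      exact ((EuclideanSpace.proj (𝕜 := ℝ) i).continuous.tendsto _).comp hx
    have h0 : |∫ x, p' x i ∂μ - ν i| ≤ 0 :=
      le_of_tendsto_of_tendsto' (hl.sub_const _).abs hεlim fun k => h1 _ i
    exact sub_eq_zero.1 (abs_eq_zero.1 (le_antisymm h0 (abs_nonneg _)))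
  · have hl : Tendsto (fun k => ∫ x, pointCost C h x (p (ns k) x) ∂μ) atTop
        (𝓝 (∫ x, pointCost C h x (p' x) ∂μ)) := by
      refine tendsto_integral_of_dominated_convergence (fun x => R * ∑ i, |C i x| + R)
        (fun k => (measurable_pointCost hC hh (hp _)).aestronglyMeasurable)
        (((integrable_finsetSum _ fun i _ => (hCi i).abs).const_mul _).add (integrable_const _))
        (fun k => Eventually.of_forall fun x => hRC C x _ ((hp _).2 x)) ?_
      filter_upwards [hlim] with x hx
      refine Tendsto.add (tendsto_finsetSum _ fun i _ => Tendsto.const_mul _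
        (((EuclideanSpace.proj (𝕜 := ℝ) i).continuous.tendsto _).comp hx)) ?_
      exact (hh _ (hp'.2 x)).tendsto.comp (tendsto_nhdsWithin_iff.2
        ⟨hx, Eventually.of_forall fun k => (hp _).2 x⟩)
    have := hεlim.const_add T
    rw [add_zero] at this
    exact le_of_tendsto_of_tendsto' hl this fun k => h2 _

lemma measurable_minCost (hK : IsCompact K) (hne : K.Nonempty) (hh : ContinuousOn h K)
    (hC : ∀ i, Measurable (C i)) : Measurable (minCost C h K) := by
  obtain ⟨u, huK, hu⟩ := exists_seq_forall_pointCost_lt (Ω := Ω) hK hne hh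
  have e : minCost C h K = fun x => ⨅ n, pointCost C h x (u n) := by
    funext x
    have hbdd : BddBelow (range fun n => pointCost C h x (u n)) :=
      ⟨minCost C h K x, by rintro _ ⟨n, rfl⟩; exact minCost_le hK hh x (huK n)⟩
    refine le_antisymm (le_ciInf fun n => minCost_le hK hh x (huK n)) ?_
    refine le_of_forall_pos_le_add fun ε hε => ?_
    obtain ⟨n, hn⟩ := hu C x ε hε
    exact (ciInf_le hbdd n).trans hn.le
  rw [e]
  exact Measurable.iInf fun n =>
    measurable_pointCost (p := fun _ => u n) hC hh ⟨measurable_const, fun _ => huK n⟩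

lemma exists_selection_pointCost_le (hK : IsCompact K) (hne : K.Nonempty)
    (hh : ContinuousOn h K) (hC : ∀ i, Measurable (C i)) {ε : ℝ} (hε : 0 < ε) :
    ∃ p ∈ measurableSelections Ω K, ∀ x, pointCost C h x (p x) ≤ minCost C h K x + ε := by
  classical
  obtain ⟨u, huK, hu⟩ := exists_seq_forall_pointCost_lt (Ω := Ω) hK hne hh
  have hex := fun x => hu C x ε hε
  refine ⟨fun x => u (Nat.find (hex x)), ⟨?_, fun x => huK _⟩, fun x => (Nat.find_spec (hex x)).le⟩
  exact Measurable.find (f := fun n _ => u n)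
    (p := fun n x => pointCost C h x (u n) < minCost C h K x + ε) (fun n => measurable_const)
    (fun n => measurableSet_lt
      (measurable_pointCost (p := fun _ => u n) hC hh ⟨measurable_const, fun _ => huK n⟩)
      ((measurable_minCost hK hne hh hC).add_const _)) hex

lemma integrable_minCost [IsFiniteMeasure μ] (hK : IsCompact K) (hne : K.Nonempty)
    (hh : ContinuousOn h K) (hC : ∀ i, Measurable (C i)) (hCi : ∀ i, Integrable (C i) μ) :
    Integrable (minCost C h K) μ := by
  obtain ⟨R, -, -, h₂⟩ := exists_pointCost_bound (Ω := Ω) hK hh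
  refine Integrable.mono' (g := fun x => R * ∑ i, |C i x| + R) ?_
    (measurable_minCost hK hne hh hC).aestronglyMeasurable (Eventually.of_forall fun x => ?_)
  · exact ((integrable_finsetSum _ fun i _ => (hCi i).abs).const_mul _).add (integrable_const _)
  · obtain ⟨q, hq, h1, -⟩ := exists_isLeast_pointCost (C := C) hK hne hh x
    rw [h1]
    exact h₂ C x q hq

/-- The dual objective of the problem of minimizing the mean cost under the constraint that the
selection has mean `ν`. -/
def dualObjective (μ : Measure Ω) (C : ι → Ω → ℝ) (h : EuclideanSpace ℝ ι → ℝ)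
    (K : Set (EuclideanSpace ℝ ι)) (ν φ : ι → ℝ) : ℝ :=
  ∫ x, (∑ i, φ i * ν i + minCost (fun i x => C i x - φ i) h K x) ∂μ

lemma integral_pointCost_sub [IsProbabilityMeasure μ] (hK : IsCompact K) (hh : ContinuousOn h K)
    (hC : ∀ i, Measurable (C i)) (hCi : ∀ i, Integrable (C i) μ)
    (hp : p ∈ measurableSelections Ω K) (φ : ι → ℝ) :
    ∫ x, pointCost (fun i x => C i x - φ i) h x (p x) ∂μ
      = ∫ x, pointCost C h x (p x) ∂μ - ∑ i, φ i * ∫ x, p x i ∂μ := by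
  simp_rw [← integral_const_mul]
  rw [← integral_finsetSum _ fun i _ => (integrable_coord hK hp i).const_mul _,
    ← integral_sub (integrable_pointCost hK hh hC hCi hp)
      (integrable_finsetSum _ fun i _ => (integrable_coord hK hp i).const_mul _)]
  refine integral_congr_ae (Eventually.of_forall fun x => ?_)
  simp only [pointCost, sub_mul, Finset.sum_sub_distrib]
  ring

lemma dualObjective_eq [IsProbabilityMeasure μ] (hK : IsCompact K) (hne : K.Nonempty)
    (hh : ContinuousOn h K) (hC : ∀ i, Measurable (C i)) (hCi : ∀ i, Integrable (C i) μ)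
    (ν φ : ι → ℝ) : dualObjective μ C h K ν φ
      = ∑ i, φ i * ν i + ∫ x, minCost (fun i x => C i x - φ i) h K x ∂μ := by
  have hi : Integrable (fun x => minCost (fun i x => C i x - φ i) h K x) μ :=
    integrable_minCost hK hne hh (fun i => (hC i).sub_const _)
      fun i => (hCi i).sub (integrable_const _)
  rw [dualObjective, integral_add (integrable_const _) hi]
  simp

/-- Weak duality. -/
lemma dualObjective_le [IsProbabilityMeasure μ] (hK : IsCompact K)
    (hh : ContinuousOn h K) (hC : ∀ i, Measurable (C i)) (hCi : ∀ i, Integrable (C i) μ)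
    (hp : p ∈ measurableSelections Ω K) {ν : ι → ℝ} (hν : ∀ i, ∫ x, p x i ∂μ = ν i)
    (φ : ι → ℝ) : dualObjective μ C h K ν φ ≤ ∫ x, pointCost C h x (p x) ∂μ := by
  have hC' : ∀ i, Measurable fun x => C i x - φ i := fun i => (hC i).sub_const _
  have hCi' : ∀ i, Integrable (fun x => C i x - φ i) μ :=
    fun i => (hCi i).sub (integrable_const _)
  have hne : K.Nonempty := by
    obtain ⟨x⟩ := nonempty_of_isProbabilityMeasure μ
    exact ⟨_, hp.2 x⟩
  have h1 := integral_pointCost_sub (μ := μ) hK hh hC hCi hp φ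
  have h2 : ∫ x, minCost (fun i x => C i x - φ i) h K x ∂μ
      ≤ ∫ x, pointCost (fun i x => C i x - φ i) h x (p x) ∂μ :=
    integral_mono (integrable_minCost hK hne hh hC' hCi') (integrable_pointCost hK hh hC' hCi' hp)
      fun x => minCost_le hK hh x (hp.2 x)
  simp only [hν] at h1
  rw [dualObjective_eq hK hne hh hC hCi]
  linarith

/-- Strong duality with a primal solution: some selection of mean `ν` has mean cost at most the
supremum of the dual objective. -/
theorem exists_selection_integral_le_iSup_dualObjective [IsProbabilityMeasure μ]
    (hK : IsCompact K) (hh : ContinuousOn h K) (hconv : ConvexOn ℝ K h)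
    (hC : ∀ i, Measurable (C i)) (hCi : ∀ i, Integrable (C i) μ)
    {ν : EuclideanSpace ℝ ι} (hν : ν ∈ K) :
    ∃ p ∈ measurableSelections Ω K, (∀ i, ∫ x, p x i ∂μ = ν i) ∧
      ∫ x, pointCost C h x (p x) ∂μ ≤ ⨆ φ : ι → ℝ, dualObjective μ C h K ν φ := by
  classical
  set T := ⨆ φ : ι → ℝ, dualObjective μ C h K ν φ
  have hνS : (fun _ => ν) ∈ measurableSelections Ω K := ⟨measurable_const, fun _ => hν⟩
  have hbdd : BddAbove (range fun φ : ι → ℝ => dualObjective μ C h K ν φ) := by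
    refine ⟨∫ x, pointCost C h x ν ∂μ, ?_⟩
    rintro _ ⟨φ, rfl⟩
    exact dualObjective_le hK hh hC hCi hνS (by simp) φ
  set A : Set ((ι → ℝ) × ℝ) := {z | ∃ p ∈ measurableSelections Ω K,
    (∀ i, ∫ x, p x i ∂μ = z.1 i) ∧ ∫ x, pointCost C h x (p x) ∂μ ≤ z.2}
  suffices hmem : ((ν : ι → ℝ), T) ∈ A from hmem
  by_contra hnot
  have hAconv : Convex ℝ A := by
    rintro ⟨u, t⟩ ⟨p, hp, h1, h2⟩ ⟨u', t'⟩ ⟨p', hp', h1', h2'⟩ a b ha hb hab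
    refine ⟨a • p + b • p', convex_measurableSelections hconv.1 hp hp' ha hb hab, fun i => ?_, ?_⟩
    · rw [integral_coord_combo hK hp hp', h1, h1']
      rfl
    · refine (integral_pointCost_combo_le hK hh hconv hC hCi hp hp' ha hb hab).trans ?_
      exact add_le_add (mul_le_mul_of_nonneg_left h2 ha) (mul_le_mul_of_nonneg_left h2' hb)
  have hAclosed : IsClosed A := by
    refine isClosed_of_closure_subset ?_
    rintro ⟨u, t⟩ hz
    refine exists_selection_of_forall_approx hK hh hconv hC hCi fun ε hε => ?_
    obtain ⟨⟨u', t'⟩, ⟨p, hp, h1, h2⟩, hd⟩ := Metric.mem_closure_iff.1 hz ε hε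
    rw [Prod.dist_eq, max_lt_iff] at hd
    refine ⟨p, hp, fun i => ?_, ?_⟩
    · rw [h1, ← Real.dist_eq, dist_comm]
      exact (dist_le_pi_dist u u' i).trans hd.1.le
    · have := hd.2
      rw [Real.dist_eq, abs_lt] at this
      simp only at h2 this
      linarith
  obtain ⟨g, s, hg, hgA⟩ := geometric_hahn_banach_point_closed hAconv hAclosed hnot
  set b := g (0, 1) with hb
  set a : ι → ℝ := fun i => g (Pi.single i 1, 0) with ha
  have hgz : ∀ (u : ι → ℝ) (t : ℝ), g (u, t) = ∑ i, u i * a i + t * b := by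
    intro u t
    have e : (u, t) = ∑ i, u i • ((Pi.single i 1 : ι → ℝ), (0 : ℝ)) + t • ((0 : ι → ℝ), (1 : ℝ)) := by
      refine Prod.ext ?_ ?_
      · rw [Prod.fst_add, Prod.fst_sum]
        ext j
        simp [Finset.sum_apply, Pi.single_apply]
      · rw [Prod.snd_add, Prod.snd_sum]
        simp
    rw [e, map_add, map_sum]
    simp only [map_smul, smul_eq_mul, ha, hb]
  have hJA : ∀ p ∈ measurableSelections Ω K, ∀ r : ℝ, 0 ≤ r →
      s < ∑ i, (∫ x, p x i ∂μ) * a i + (∫ x, pointCost C h x (p x) ∂μ + r) * b := by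
    intro p hp r hr
    rw [← hgz]
    exact hgA _ ⟨p, hp, fun _ => rfl, by simpa using hr⟩
  rw [hgz] at hg
  have hJν := hJA _ hνS
  simp only [integral_const, probReal_univ, one_smul] at hJν
  have hb0 : 0 < b := by
    set J := ∫ x, pointCost C h x ν ∂μ
    have h1 := hJν (max 0 (T - J)) (le_max_left _ _)
    have h2 : 0 ≤ J + max 0 (T - J) - T := by linarith [le_max_right 0 (T - J)]
    by_contra hneg
    nlinarith
  have hK' : K.Nonempty := ⟨_, hν⟩
  set φ : ι → ℝ := fun i => -(a i / b) with hφ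
  have hC' : ∀ i, Measurable fun x => C i x - φ i := fun i => (hC i).sub_const _
  have hCi' : ∀ i, Integrable (fun x => C i x - φ i) μ :=
    fun i => (hCi i).sub (integrable_const _)
  have hsum : ∀ u : ι → ℝ, ∑ i, φ i * u i = -(∑ i, u i * a i) / b := by
    intro u
    rw [neg_div, Finset.sum_div, ← Finset.sum_neg_distrib]
    refine Finset.sum_congr rfl fun i _ => ?_
    simp only [hφ]
    ring
  have hlow : s / b ≤ ∫ x, minCost (fun i x => C i x - φ i) h K x ∂μ := by
    refine le_of_forall_pos_le_add fun ε hε => ?_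
    obtain ⟨p, hp, hpε⟩ := exists_selection_pointCost_le hK hK' hh hC' hε
    have h1 := hJA p hp 0 le_rfl
    have h2 := integral_pointCost_sub (μ := μ) hK hh hC hCi hp φ
    have h3 := integral_mono (μ := μ) (integrable_pointCost hK hh hC' hCi' hp)
      ((integrable_minCost hK hK' hh hC' hCi').add (integrable_const ε)) hpε
    rw [integral_add' (integrable_minCost hK hK' hh hC' hCi') (integrable_const ε)] at h3
    simp only [integral_const, probReal_univ, one_smul] at h3
    refine le_trans ?_ h3
    rw [h2, hsum, div_le_iff₀ hb0, sub_mul, div_mul_cancel₀ _ hb0.ne']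
    linarith
  have hD : dualObjective μ C h K ν φ ≤ T := le_ciSup hbdd φ
  rw [dualObjective_eq hK hK' hh hC hCi, hsum] at hD
  have h4 : -(∑ i, ν i * a i) / b + s / b ≤ T := by linarith
  rw [← add_div, div_le_iff₀ hb0] at h4
  linarith

end Selections

/-- A lower semicontinuous convex function on a closed half-line is continuous there. -/
lemma ConvexOn.continuousOn_Ici_of_lowerSemicontinuousOn {f : ℝ → ℝ} {a : ℝ}
    (hf : ConvexOn ℝ (Ici a) f) (hlsc : LowerSemicontinuousOn f (Ici a)) :
    ContinuousOn f (Ici a) := by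
  intro x hx
  rcases eq_or_lt_of_le (mem_Ici.1 hx) with rfl | hlt
  · refine tendsto_order.2 ⟨fun b hb => hlsc a hx b hb, fun b hb => ?_⟩
    have hlim : Tendsto (fun t => (1 - (t - a)) * f a + (t - a) * f (a + 1)) (𝓝[Ici a] a)
        (𝓝 (f a)) := by
      have : Continuous fun t => (1 - (t - a)) * f a + (t - a) * f (a + 1) := by fun_prop
      simpa using (this.tendsto a).mono_left nhdsWithin_le_nhds
    have h1 : ∀ᶠ t in 𝓝[Ici a] a, t < a + 1 :=
      mem_nhdsWithin_of_mem_nhds (Iio_mem_nhds (by linarith))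
    filter_upwards [hlim.eventually (gt_mem_nhds hb), h1, self_mem_nhdsWithin] with t h2 h3 h4
    refine lt_of_le_of_lt ?_ h2
    have h5 := hf.2 hx (show a + 1 ∈ Ici a by simp) (show 0 ≤ 1 - (t - a) by linarith)
      (show 0 ≤ t - a by linarith [mem_Ici.1 h4]) (by ring)
    simp only [smul_eq_mul] at h5
    convert h5 using 2
    ring
  · have := hf.continuousOn_interior
    rw [interior_Ici] at this
    exact (this.continuousAt (Ioi_mem_nhds hlt)).continuousWithinAt

lemma ereal_coe_finsetSum {ι : Type*} (s : Finset ι) (g : ι → ℝ) :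
    ((∑ i ∈ s, g i : ℝ) : EReal) = ∑ i ∈ s, (g i : EReal) :=
  map_sum (⟨⟨Real.toEReal, EReal.coe_zero⟩, EReal.coe_add⟩ : ℝ →+ EReal) g s

section Simplex

variable {ι : Type*} [Fintype ι]

/-- The probability simplex, as a subset of Euclidean space. -/
def simplex (ι : Type*) [Fintype ι] : Set (EuclideanSpace ℝ ι) :=
  {q | (∀ i, 0 ≤ q i) ∧ ∑ i, q i = 1}

lemma le_one_of_mem_simplex {q : EuclideanSpace ℝ ι} (hq : q ∈ simplex ι) (i : ι) : q i ≤ 1 :=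
  hq.2 ▸ Finset.single_le_sum (fun j _ => hq.1 j) (Finset.mem_univ i)

lemma convex_simplex : Convex ℝ (simplex ι) := by
  rintro q ⟨h0, h1⟩ q' ⟨h0', h1'⟩ a b ha hb hab
  refine ⟨fun i => ?_, ?_⟩
  · have := h0 i
    have := h0' i
    simp only [PiLp.add_apply, PiLp.smul_apply, smul_eq_mul]
    positivity
  · simp only [PiLp.add_apply, PiLp.smul_apply, smul_eq_mul, Finset.sum_add_distrib,
      ← Finset.mul_sum, h1, h1', mul_one, hab]

lemma isCompact_simplex : IsCompact (simplex ι) := by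
  have e : simplex ι = WithLp.toLp 2 '' stdSimplex ℝ ι := by
    ext q
    exact ⟨fun hq => ⟨q.ofLp, ⟨hq.1, hq.2⟩, rfl⟩, by rintro ⟨v, ⟨h0, h1⟩, rfl⟩; exact ⟨h0, h1⟩⟩
  rw [e]
  exact (isCompact_stdSimplex ℝ ι).image (PiLp.continuous_toLp 2 _)

/-- The penalty term of the regularized transport problem. -/
def divergence (f : ℝ → ℝ) (η : ι → ℝ) (q : EuclideanSpace ℝ ι) : ℝ :=
  ∑ i, f (q i / η i) * η i

lemma continuousOn_comp_coord_div {f : ℝ → ℝ} {η : ι → ℝ} (hη : ∀ i, 0 < η i)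
    (hf : ContinuousOn f (Ici 0)) (i : ι) :
    ContinuousOn (fun q : EuclideanSpace ℝ ι => f (q i / η i)) (simplex ι) :=
  hf.comp ((EuclideanSpace.proj (𝕜 := ℝ) i).continuous.div_const _).continuousOn
    fun _ hq => div_nonneg (hq.1 i) (hη i).le

lemma continuousOn_divergence {f : ℝ → ℝ} {η : ι → ℝ} (hη : ∀ i, 0 < η i)
    (hf : ContinuousOn f (Ici 0)) : ContinuousOn (divergence f η) (simplex ι) :=
  continuousOn_finsetSum _ fun i _ => (continuousOn_comp_coord_div hη hf i).mul_const _

lemma convexOn_divergence {f : ℝ → ℝ} {η : ι → ℝ} (hη : ∀ i, 0 < η i)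
    (hf : ConvexOn ℝ (Ici 0) f) : ConvexOn ℝ (simplex ι) (divergence f η) := by
  refine ⟨convex_simplex, fun q hq q' hq' a b ha hb hab => ?_⟩
  simp only [divergence, smul_eq_mul, Finset.mul_sum]
  rw [← Finset.sum_add_distrib]
  refine Finset.sum_le_sum fun i _ => ?_
  have h1 := hf.2 (x := q i / η i) (y := q' i / η i) (div_nonneg (hq.1 i) (hη i).le)
    (div_nonneg (hq'.1 i) (hη i).le) ha hb hab
  have e : (a • q + b • q') i / η i = a • (q i / η i) + b • (q' i / η i) := by
    simp only [PiLp.add_apply, PiLp.smul_apply, smul_eq_mul]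
    ring
  rw [e]
  have h2 := mul_le_mul_of_nonneg_right h1 (hη i).le
  simp only [smul_eq_mul] at h2 ⊢
  linarith

/-- Where the transport costs are finite, the extended-real infimum defining the dual integrand
is the real minimum. -/
lemma iInf_extendedCost_toReal {Ω Y : Type*} {ν η : ι → ℝ} (hη : ∀ i, 0 < η i)
    (hne : (simplex ι).Nonempty) {f : ℝ → ℝ} (hf : ContinuousOn f (Ici 0))
    {c : Ω → Y → ℝ≥0∞} {y : ι → Y} (φ : ι → ℝ) {x : Ω} (hx : ∀ i, c x (y i) ≠ ⊤) :
    (⨅ p ∈ {p : ι → ℝ | (∀ i, 0 ≤ p i) ∧ ∑ i, p i = 1}, ∑ i, (((φ i * ν i : ℝ) : EReal)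
        + (((c x (y i) : ℝ≥0∞) : EReal) - ((φ i : ℝ) : EReal)) * ((p i : ℝ) : EReal)
        + ((f (p i / η i) * η i : ℝ) : EReal))).toReal
      = ∑ i, φ i * ν i
        + minCost (fun i x => (c x (y i)).toReal - φ i) (divergence f η) (simplex ι) x := by
  have e : ∀ p : ι → ℝ, ∑ i, (((φ i * ν i : ℝ) : EReal)
        + (((c x (y i) : ℝ≥0∞) : EReal) - ((φ i : ℝ) : EReal)) * ((p i : ℝ) : EReal)
        + ((f (p i / η i) * η i : ℝ) : EReal))
      = ((∑ i, φ i * ν i + pointCost (fun i x => (c x (y i)).toReal - φ i) (divergence f η) x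
        (WithLp.toLp 2 p) : ℝ) : EReal) := by
    intro p
    simp only [pointCost, divergence]
    rw [← Finset.sum_add_distrib, ← Finset.sum_add_distrib, ereal_coe_finsetSum]
    refine Finset.sum_congr rfl fun i _ => ?_
    have ec : ((c x (y i) : ℝ≥0∞) : EReal) = (((c x (y i)).toReal : ℝ) : EReal) := by
      rw [EReal.coe_ennreal_toReal (hx i)]
    rw [ec]
    norm_cast
    ring
  simp only [e]
  obtain ⟨q, hq, h1, h2⟩ := exists_isLeast_pointCost
    (C := fun i x => (c x (y i)).toReal - φ i) isCompact_simplex hne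
    (continuousOn_divergence hη hf) x
  rw [h1]
  have hinf : (⨅ p ∈ {p : ι → ℝ | (∀ i, 0 ≤ p i) ∧ ∑ i, p i = 1}, ((∑ i, φ i * ν i
        + pointCost (fun i x => (c x (y i)).toReal - φ i) (divergence f η) x
        (WithLp.toLp 2 p) : ℝ) : EReal))
      = ((∑ i, φ i * ν i + pointCost (fun i x => (c x (y i)).toReal - φ i) (divergence f η) x q :
        ℝ) : EReal) := by
    refine le_antisymm (iInf₂_le q.ofLp hq) (le_iInf₂ fun p hp => ?_)
    exact EReal.coe_le_coe_iff.2 (add_le_add_right (h2 _ hp) _)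
  rw [hinf, EReal.toReal_coe]

end Simplex

section FiniteSecondMarginal

variable {Ω Y ι : Type*} [MeasurableSpace Ω] [MeasurableSpace Y] [MeasurableSingletonClass Y]
  [Fintype ι] {μ : Measure Ω} {y : ι → Y}

lemma prod_sum_smul_dirac [SFinite μ] (w : ι → ℝ) :
    μ.prod (∑ i, ENNReal.ofReal (w i) • Measure.dirac (y i))
      = ∑ i, ENNReal.ofReal (w i) • μ.map fun x => (x, y i) := by
  have : IsFiniteMeasure (∑ i, ENNReal.ofReal (w i) • Measure.dirac (y i)) :=
    ⟨by simp [Measure.finsetSum_apply]⟩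
  ext s hs
  have hm : ∀ i, MeasurableSet ((fun x => (x, y i)) ⁻¹' s) := fun i =>
    measurable_prodMk_right hs
  rw [Measure.prod_apply hs, Measure.finsetSum_apply]
  have e : ∀ x, (∑ i, ENNReal.ofReal (w i) • Measure.dirac (y i)) (Prod.mk x ⁻¹' s)
      = ∑ i, ENNReal.ofReal (w i) * ((fun x => (x, y i)) ⁻¹' s).indicator 1 x := by
    intro x
    rw [Measure.finsetSum_apply]
    refine Finset.sum_congr rfl fun i _ => ?_
    rw [Measure.smul_apply, Measure.dirac_apply, smul_eq_mul]
    rfl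
  simp_rw [e]
  rw [lintegral_finsetSum _ fun i _ => (measurable_one.indicator (hm i)).const_mul _]
  refine Finset.sum_congr rfl fun i _ => ?_
  rw [lintegral_const_mul _ (measurable_one.indicator (hm i)), lintegral_indicator_one (hm i),
    Measure.smul_apply, Measure.map_apply measurable_prodMk_right hs, smul_eq_mul]

variable [IsProbabilityMeasure μ]

lemma lintegral_prod_sum_smul_dirac (w : ι → ℝ) (F : Ω × Y → ℝ≥0∞) :
    ∫⁻ z, F z ∂μ.prod (∑ i, ENNReal.ofReal (w i) • Measure.dirac (y i))
      = ∑ i, ENNReal.ofReal (w i) * ∫⁻ x, F (x, y i) ∂μ := by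
  rw [prod_sum_smul_dirac, lintegral_finsetSum_measure]
  refine Finset.sum_congr rfl fun i _ => ?_
  rw [lintegral_smul_measure, (measurableEmbedding_prod_mk_right (y i)).lintegral_map, smul_eq_mul]

lemma ae_prod_sum_smul_dirac_iff {w : ι → ℝ} (hw : ∀ i, 0 < w i) {P : Ω × Y → Prop} :
    (∀ᵐ z ∂μ.prod (∑ i, ENNReal.ofReal (w i) • Measure.dirac (y i)), P z)
      ↔ ∀ i, ∀ᵐ x ∂μ, P (x, y i) := by
  rw [prod_sum_smul_dirac, ae_finsetSum_measure_iff]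
  refine ⟨fun H i => ?_, fun H i _ => ?_⟩
  · have := H i (Finset.mem_univ i)
    rw [Measure.ae_ennreal_smul_measure_iff (by simpa using hw i)] at this
    exact (measurableEmbedding_prod_mk_right (y i)).ae_map_iff.1 this
  · rw [Measure.ae_ennreal_smul_measure_iff (by simpa using hw i)]
    exact (measurableEmbedding_prod_mk_right (y i)).ae_map_iff.2 (H i)

lemma integrable_prod_sum_smul_dirac {w : ι → ℝ} {F : Ω × Y → ℝ}
    (hF : ∀ i, Integrable (fun x => F (x, y i)) μ) :
    Integrable F (μ.prod (∑ i, ENNReal.ofReal (w i) • Measure.dirac (y i))) := by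
  rw [prod_sum_smul_dirac, integrable_finsetSum_measure]
  exact fun i _ => ((measurableEmbedding_prod_mk_right (y i)).integrable_map_iff.2
    (hF i)).smul_measure ENNReal.ofReal_ne_top

lemma integral_prod_sum_smul_dirac {w : ι → ℝ} (hw : ∀ i, 0 < w i) {F : Ω × Y → ℝ}
    (hF : ∀ i, Integrable (fun x => F (x, y i)) μ) :
    ∫ z, F z ∂μ.prod (∑ i, ENNReal.ofReal (w i) • Measure.dirac (y i))
      = ∑ i, w i * ∫ x, F (x, y i) ∂μ := by
  rw [prod_sum_smul_dirac, integral_finsetSum_measure fun i _ =>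
    ((measurableEmbedding_prod_mk_right (y i)).integrable_map_iff.2
      (hF i)).smul_measure ENNReal.ofReal_ne_top]
  refine Finset.sum_congr rfl fun i _ => ?_
  rw [integral_smul_measure, (measurableEmbedding_prod_mk_right (y i)).integral_map,
    ENNReal.toReal_ofReal (hw i).le, smul_eq_mul]

lemma withDensity_prod_sum_smul_dirac_apply (w : ι → ℝ) (d : Ω × Y → ℝ≥0∞)
    {s : Set (Ω × Y)} (hs : MeasurableSet s) :
    (μ.prod (∑ i, ENNReal.ofReal (w i) • Measure.dirac (y i))).withDensity d s
      = ∑ i, ENNReal.ofReal (w i) * ∫⁻ x, s.indicator d (x, y i) ∂μ := by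
  rw [withDensity_apply _ hs, ← lintegral_indicator hs, lintegral_prod_sum_smul_dirac]

/-- A measure with the prescribed marginals and a density is described by a measurable family of
probability vectors. -/
lemma exists_selection_of_marginals {ν η : ι → ℝ} (hy : Function.Injective y)
    (hν : WithLp.toLp 2 ν ∈ simplex ι) (hη : ∀ i, 0 < η i) {π : Measure (Ω × Y)}
    [IsProbabilityMeasure π] (hfst : π.map Prod.fst = μ)
    (hsnd : π.map Prod.snd = ∑ i, ENNReal.ofReal (ν i) • Measure.dirac (y i))
    (hac : π ≪ μ.prod (∑ i, ENNReal.ofReal (η i) • Measure.dirac (y i))) :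
    ∃ p ∈ measurableSelections Ω (simplex ι), (∀ i, ∫ x, p x i ∂μ = ν i) ∧
      ∀ i, ∀ᵐ x ∂μ, π.rnDeriv (μ.prod (∑ i, ENNReal.ofReal (η i) • Measure.dirac (y i))) (x, y i)
        = ENNReal.ofReal (p x i / η i) := by
  classical
  set M := μ.prod (∑ i, ENNReal.ofReal (η i) • Measure.dirac (y i))
  have hfin : IsFiniteMeasure (∑ i, ENNReal.ofReal (η i) • Measure.dirac (y i)) :=
    ⟨by simp [Measure.finsetSum_apply]⟩
  set ρ := π.rnDeriv M
  have hρm : Measurable ρ := Measure.measurable_rnDeriv π M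
  have hπ : π = M.withDensity ρ := (Measure.withDensity_rnDeriv_eq π M hac).symm
  set r : ι → Ω → ℝ≥0∞ := fun i x => ENNReal.ofReal (η i) * ρ (x, y i)
  have hρi : ∀ i, Measurable fun x => ρ (x, y i) := fun i => hρm.comp measurable_prodMk_right
  have hrm : ∀ i, Measurable (r i) := fun i => (hρi i).const_mul _
  have hη0 : ∀ i, ENNReal.ofReal (η i) ≠ 0 := fun i => by simpa using hη i
  have hsum : ∀ᵐ x ∂μ, ∑ i, r i x = 1 := by
    refine ae_eq_of_forall_setLIntegral_eq_of_sigmaFinite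
      (Finset.measurable_sum _ fun i _ => hrm i) measurable_const fun s hs _ => ?_
    have h1 : π (Prod.fst ⁻¹' s) = μ s := by rw [← Measure.map_apply measurable_fst hs, hfst]
    rw [hπ, withDensity_prod_sum_smul_dirac_apply _ _ (measurable_fst hs)] at h1
    rw [setLIntegral_one, ← h1, lintegral_finsetSum _ fun i _ => hrm i]
    refine Finset.sum_congr rfl fun i _ => ?_
    rw [lintegral_const_mul _ (hρi i), ← lintegral_indicator hs]
    rfl
  have hint : ∀ j, ∫⁻ x, r j x ∂μ = ENNReal.ofReal (ν j) := by
    intro j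
    have h1 : π (Prod.snd ⁻¹' {y j}) = ENNReal.ofReal (ν j) := by
      rw [← Measure.map_apply measurable_snd (measurableSet_singleton _), hsnd,
        Measure.finsetSum_apply, Finset.sum_eq_single j]
      · simp
      · intro i _ hij
        simp [hy.ne hij]
      · simp
    rw [hπ, withDensity_prod_sum_smul_dirac_apply _ _ (measurable_snd (measurableSet_singleton _)),
      Finset.sum_eq_single j] at h1
    · rw [← h1, lintegral_const_mul _ (hρi j)]
      simp [indicator]
    · intro i _ hij
      simp [indicator, hy.ne hij]
    · simp
  set p : Ω → EuclideanSpace ℝ ι := fun x =>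
    if ∑ i, r i x = 1 then WithLp.toLp 2 fun i => (r i x).toReal else WithLp.toLp 2 ν
  have hle : ∀ x, ∑ i, r i x = 1 → ∀ i, r i x ≠ ⊤ := fun x hx i =>
    ne_top_of_le_ne_top ENNReal.one_ne_top
      (hx ▸ Finset.single_le_sum (f := fun i => r i x) (fun j _ => zero_le) (Finset.mem_univ i))
  refine ⟨p, ⟨?_, fun x => ?_⟩, fun i => ?_, fun i => ?_⟩
  · refine Measurable.ite (measurableSet_eq_fun (Finset.measurable_sum _ fun i _ => hrm i)
      measurable_const) ?_ measurable_const
    exact (PiLp.continuous_toLp 2 _).measurable.comp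
      (measurable_pi_lambda _ fun i => (hrm i).ennreal_toReal)
  · by_cases hx : ∑ i, r i x = 1
    · simp only [p, hx, if_true]
      refine ⟨fun i => ENNReal.toReal_nonneg, ?_⟩
      change ∑ i, (r i x).toReal = 1
      rw [← ENNReal.toReal_sum fun i _ => hle x hx i, hx, ENNReal.toReal_one]
    · simpa only [p, hx, if_false] using hν
  · have e : (fun x => p x i) =ᵐ[μ] fun x => (r i x).toReal := by
      filter_upwards [hsum] with x hx
      simp only [p, hx, if_true]
    rw [integral_congr_ae e, integral_toReal (hrm i).aemeasurable
      (ae_lt_top (hrm i) (by rw [hint]; exact ENNReal.ofReal_ne_top)), hint,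
      ENNReal.toReal_ofReal (hν.1 i)]
  · filter_upwards [hsum] with x hx
    have htop : ρ (x, y i) ≠ ⊤ := fun h => hle x hx i (by
      simp only [r, h]; exact ENNReal.mul_top (hη0 i))
    simp only [p, hx, if_true, r, ENNReal.toReal_mul, ENNReal.toReal_ofReal (hη i).le]
    rw [mul_div_cancel_left₀ _ (hη i).ne', ENNReal.ofReal_toReal htop]

/-- A measurable family of probability vectors of mean `ν` comes from a measure with the prescribed
marginals and density. -/
lemma exists_measure_of_selection {ν η : ι → ℝ} (hy : Function.Injective y)
    (hη : ∀ i, 0 < η i) {p : Ω → EuclideanSpace ℝ ι}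
    (hp : p ∈ measurableSelections Ω (simplex ι)) (hpν : ∀ i, ∫ x, p x i ∂μ = ν i) :
    ∃ π : Measure (Ω × Y), IsProbabilityMeasure π ∧ π.map Prod.fst = μ ∧
      π.map Prod.snd = ∑ i, ENNReal.ofReal (ν i) • Measure.dirac (y i) ∧
      π ≪ μ.prod (∑ i, ENNReal.ofReal (η i) • Measure.dirac (y i)) ∧
      ∀ i, ∀ᵐ x ∂μ, π.rnDeriv (μ.prod (∑ i, ENNReal.ofReal (η i) • Measure.dirac (y i))) (x, y i)
        = ENNReal.ofReal (p x i / η i) := by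
  classical
  have hfin : IsFiniteMeasure (∑ i, ENNReal.ofReal (η i) • Measure.dirac (y i)) :=
    ⟨by simp [Measure.finsetSum_apply]⟩
  set d : Ω × Y → ℝ≥0∞ := fun z =>
    ∑ i, if z.2 = y i then ENNReal.ofReal (p z.1 i / η i) else 0
  have hd : ∀ x i, d (x, y i) = ENNReal.ofReal (p x i / η i) := by
    intro x i
    simp only [d]
    rw [Finset.sum_eq_single i]
    · simp
    · intro j _ hji
      simp [hy.ne hji.symm]
    · simp
  have hdm : Measurable d := Finset.measurable_sum _ fun i _ =>
    Measurable.ite (measurable_snd (measurableSet_singleton _))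
      (((measurable_coord hp.1 i).comp measurable_fst).div_const _).ennreal_ofReal
      measurable_const
  have hpm : ∀ i, Measurable fun x => ENNReal.ofReal (p x i) := fun i =>
    (measurable_coord hp.1 i).ennreal_ofReal
  have hcancel : ∀ x i, ENNReal.ofReal (η i) * ENNReal.ofReal (p x i / η i)
      = ENNReal.ofReal (p x i) := by
    intro x i
    rw [← ENNReal.ofReal_mul (hη i).le, mul_div_cancel₀ _ (hη i).ne']
  have hfst : ((μ.prod (∑ i, ENNReal.ofReal (η i) • Measure.dirac (y i))).withDensity d).map
      Prod.fst = μ := by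
    ext s hs
    rw [Measure.map_apply measurable_fst hs,
      withDensity_prod_sum_smul_dirac_apply _ _ (measurable_fst hs)]
    have e : ∀ i, ENNReal.ofReal (η i) * ∫⁻ x, (Prod.fst ⁻¹' s).indicator d (x, y i) ∂μ
        = ∫⁻ x in s, ENNReal.ofReal (p x i) ∂μ := by
      intro i
      rw [← lintegral_const_mul' _ _ ENNReal.ofReal_ne_top, ← lintegral_indicator hs]
      refine lintegral_congr fun x => ?_
      by_cases hx : x ∈ s <;> simp [indicator, hx, hd, hcancel]
    simp_rw [e]
    rw [← lintegral_finsetSum _ fun i _ => hpm i, ← setLIntegral_one]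
    refine lintegral_congr fun x => ?_
    rw [← ENNReal.ofReal_sum_of_nonneg fun i _ => (hp.2 x).1 i, (hp.2 x).2, ENNReal.ofReal_one]
  refine ⟨_, ⟨?_⟩, hfst, ?_, withDensity_absolutelyContinuous _ d, ?_⟩
  · rw [← preimage_univ (f := Prod.fst), ← Measure.map_apply measurable_fst MeasurableSet.univ,
      hfst, measure_univ]
  · ext s hs
    rw [Measure.map_apply measurable_snd hs,
      withDensity_prod_sum_smul_dirac_apply _ _ (measurable_snd hs), Measure.finsetSum_apply]
    refine Finset.sum_congr rfl fun i _ => ?_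
    rw [← lintegral_const_mul' _ _ ENNReal.ofReal_ne_top, Measure.smul_apply,
      Measure.dirac_apply, smul_eq_mul]
    by_cases hi : y i ∈ s
    · simp only [indicator, mem_preimage, hi, if_true, hd, hcancel, Pi.one_apply, mul_one]
      rw [← hpν i, ofReal_integral_eq_lintegral_ofReal (integrable_coord isCompact_simplex hp i)
        (Eventually.of_forall fun x => (hp.2 x).1 i)]
    · simp [indicator, hi]
  · intro i
    filter_upwards [(ae_prod_sum_smul_dirac_iff hη).1 (Measure.rnDeriv_withDensity
      (μ.prod (∑ i, ENNReal.ofReal (η i) • Measure.dirac (y i))) hdm) i]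
      with x hx
    rw [hx, hd]

/-- The value of the regularized transport functional in terms of the disintegration. -/
lemma regularizedCost_eq {η : ι → ℝ} (hη : ∀ i, 0 < η i) {c : Ω → Y → ℝ≥0∞}
    (hcm : ∀ i, Measurable fun x => c x (y i)) (hc : ∀ i, ∫⁻ x, c x (y i) ∂μ ≠ ⊤)
    {f : ℝ → ℝ} (hf : ContinuousOn f (Ici 0)) {p : Ω → EuclideanSpace ℝ ι}
    (hp : p ∈ measurableSelections Ω (simplex ι)) {π : Measure (Ω × Y)} [IsProbabilityMeasure π]
    {M : Measure Y} (hM : M = ∑ i, ENNReal.ofReal (η i) • Measure.dirac (y i))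
    (hac : π ≪ μ.prod M)
    (hρ : ∀ i, ∀ᵐ x ∂μ, π.rnDeriv (μ.prod M) (x, y i) = ENNReal.ofReal (p x i / η i)) :
    ((∫⁻ q, c q.1 q.2 ∂π : ℝ≥0∞) : EReal)
      + ((∫⁻ z, ENNReal.ofReal (f ((π.rnDeriv (μ.prod M) z).toReal)) ∂(μ.prod M) : ℝ≥0∞) : EReal)
      - ((∫⁻ z, ENNReal.ofReal (-f ((π.rnDeriv (μ.prod M) z).toReal)) ∂(μ.prod M) : ℝ≥0∞) : EReal)
    = ((∫ x, pointCost (fun i x => (c x (y i)).toReal) (divergence f η) x (p x) ∂μ : ℝ) : EReal) :=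
  by
  have hfin : IsFiniteMeasure M := by
    rw [hM]
    exact ⟨by simp [Measure.finsetSum_apply]⟩
  set ρ := π.rnDeriv (μ.prod M)
  have hρm : Measurable ρ := Measure.measurable_rnDeriv _ _
  set C : ι → Ω → ℝ := fun i x => (c x (y i)).toReal
  have hCm : ∀ i, Measurable (C i) := fun i => (hcm i).ennreal_toReal
  have hCi : ∀ i, Integrable (C i) μ := fun i =>
    integrable_toReal_of_lintegral_ne_top (hcm i).aemeasurable (hc i)
  have hlin : ∀ i, Integrable (fun x => C i x * p x i) μ := by
    intro i
    refine (hCi i).mul_bdd (c := 1) (measurable_coord hp.1 i).aestronglyMeasurable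
      (Eventually.of_forall fun x => ?_)
    rw [Real.norm_of_nonneg ((hp.2 x).1 i)]
    exact le_one_of_mem_simplex (hp.2 x) i
  have hfint : ∀ i, Integrable (fun x => f (p x i / η i)) μ := by
    intro i
    simpa [pointCost] using integrable_pointCost (μ := μ) (C := fun _ _ => 0) isCompact_simplex
      (continuousOn_comp_coord_div hη hf i) (fun _ => measurable_const) (fun _ => integrable_const 0) hp
  have hcost : ∫⁻ q, c q.1 q.2 ∂π = ENNReal.ofReal (∑ i, ∫ x, C i x * p x i ∂μ) := by
    rw [← Measure.withDensity_rnDeriv_eq π (μ.prod M) hac,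
      lintegral_withDensity_eq_lintegral_mul_non_measurable _ hρm (Measure.rnDeriv_lt_top _ _), hM,
      lintegral_prod_sum_smul_dirac, ENNReal.ofReal_sum_of_nonneg fun i _ =>
        integral_nonneg fun x => mul_nonneg ENNReal.toReal_nonneg ((hp.2 x).1 i)]
    refine Finset.sum_congr rfl fun i _ => ?_
    rw [ofReal_integral_eq_lintegral_ofReal (hlin i) (Eventually.of_forall fun x =>
      mul_nonneg ENNReal.toReal_nonneg ((hp.2 x).1 i)),
      ← lintegral_const_mul' _ _ ENNReal.ofReal_ne_top]
    refine lintegral_congr_ae ?_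
    filter_upwards [hρ i, ae_lt_top (hcm i) (hc i)] with x h1 h2
    rw [Pi.mul_apply, h1, ← mul_assoc, ← ENNReal.ofReal_mul (hη i).le,
      mul_div_cancel₀ _ (hη i).ne', ENNReal.ofReal_mul ENNReal.toReal_nonneg,
      ENNReal.ofReal_toReal h2.ne, mul_comm]
  have hval : ∀ i, (fun x => f (ρ (x, y i)).toReal) =ᵐ[μ] fun x => f (p x i / η i) := by
    intro i
    filter_upwards [hρ i] with x hx
    rw [hx, ENNReal.toReal_ofReal (div_nonneg ((hp.2 x).1 i) (hη i).le)]
  have hgi : ∀ i, Integrable (fun x => f (ρ (x, y i)).toReal) μ := fun i =>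
    (hfint i).congr (hval i).symm
  have hg : Integrable (fun z => f (ρ z).toReal) (μ.prod M) := by
    rw [hM]
    exact integrable_prod_sum_smul_dirac hgi
  have hgint : ∫ z, f (ρ z).toReal ∂(μ.prod M) = ∑ i, η i * ∫ x, f (p x i / η i) ∂μ := by
    conv_lhs => rw [hM]
    rw [integral_prod_sum_smul_dirac (F := fun z => f (ρ z).toReal) hη hgi]
    exact Finset.sum_congr rfl fun i _ => by rw [integral_congr_ae (hval i)]
  have hpos : ∫⁻ z, ENNReal.ofReal (f (ρ z).toReal) ∂(μ.prod M) ≠ ⊤ := hg.lintegral_lt_top.ne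
  have hneg : ∫⁻ z, ENNReal.ofReal (-f (ρ z).toReal) ∂(μ.prod M) ≠ ⊤ :=
    hg.neg.lintegral_lt_top.ne
  rw [integral_eq_lintegral_pos_part_sub_lintegral_neg_part hg] at hgint
  have hJ : ∫ x, pointCost C (divergence f η) x (p x) ∂μ
      = ∑ i, ∫ x, C i x * p x i ∂μ + ∑ i, η i * ∫ x, f (p x i / η i) ∂μ := by
    simp_rw [← integral_const_mul]
    rw [← integral_finsetSum _ fun i _ => hlin i,
      ← integral_finsetSum _ fun i _ => (hfint i).const_mul _,
      ← integral_add (integrable_finsetSum _ fun i _ => hlin i)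
        (integrable_finsetSum _ fun i _ => (hfint i).const_mul _)]
    refine integral_congr_ae (Eventually.of_forall fun x => ?_)
    simp only [pointCost, divergence, mul_comm]
  rw [hcost, hJ, ← hgint]
  lift ∫⁻ z, ENNReal.ofReal (f (ρ z).toReal) ∂(μ.prod M) to NNReal using hpos with a
  lift ∫⁻ z, ENNReal.ofReal (-f (ρ z).toReal) ∂(μ.prod M) to NNReal using hneg with b
  have h0 : 0 ≤ ∑ i, ∫ x, C i x * p x i ∂μ := Finset.sum_nonneg fun i _ =>
    integral_nonneg fun x => mul_nonneg ENNReal.toReal_nonneg ((hp.2 x).1 i)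
  rw [EReal.coe_ennreal_ofReal, max_eq_left h0]
  have ha : (((a : ℝ≥0∞)) : EReal) = ((a : ℝ) : EReal) := rfl
  have hb : (((b : ℝ≥0∞)) : EReal) = ((b : ℝ) : EReal) := rfl
  rw [ha, hb, ← EReal.coe_add, ← EReal.coe_sub, add_sub_assoc]
  rfl

end FiniteSecondMarginal

/-- Strong duality for `f`-divergence regularized semi-discrete optimal transport
(Lemma 3.2 of the paper): the regularized primal problem over couplings that are
absolutely continuous with respect to `μ ⊗ η` has the same optimal value as the
smoothed dual problem, and the primal infimum is attained. -/
theorem stmt_3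
    (m k N : ℕ) (hN : 1 ≤ N)
    (X : Set (EuclideanSpace ℝ (Fin m))) (hX : IsClosed X)
    (μ : Measure (EuclideanSpace ℝ (Fin m))) (hμ : IsProbabilityMeasure μ)
    (hμX : μ Xᶜ = 0)
    (y : Fin N → EuclideanSpace ℝ (Fin k)) (hy : Function.Injective y)
    (ν η : Fin N → ℝ)
    (hν_pos : ∀ i, 0 < ν i) (hν_sum : ∑ i, ν i = 1)
    (hη_pos : ∀ i, 0 < η i) (hη_sum : ∑ i, η i = 1)
    (c : EuclideanSpace ℝ (Fin m) → EuclideanSpace ℝ (Fin k) → ℝ≥0∞)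
    (hc_lsc : ∀ i, LowerSemicontinuous fun x => c x (y i))
    (hc_int : ∀ i, ∫⁻ x, c x (y i) ∂μ ≠ ⊤)
    (f : ℝ → ℝ) (hf_conv : ConvexOn ℝ (Ici 0) f)
    (hf_lsc : LowerSemicontinuousOn f (Ici 0)) (hf_one : f 1 = 0)
    (Mν Mη : Measure (EuclideanSpace ℝ (Fin k)))
    (hMν : Mν = ∑ i, ENNReal.ofReal (ν i) • Measure.dirac (y i))
    (hMη : Mη = ∑ i, ENNReal.ofReal (η i) • Measure.dirac (y i))
    (S : Set (Measure (EuclideanSpace ℝ (Fin m) × EuclideanSpace ℝ (Fin k))))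
    (hS : S = {π | IsProbabilityMeasure π ∧ π.map Prod.fst = μ ∧
        π.map Prod.snd = Mν ∧ π ≪ μ.prod Mη})
    (Pr : Measure (EuclideanSpace ℝ (Fin m) × EuclideanSpace ℝ (Fin k)) → EReal)
    (hPr : ∀ π, Pr π = ((∫⁻ q, c q.1 q.2 ∂π : ℝ≥0∞) : EReal)
      + ((∫⁻ z, ENNReal.ofReal (f ((π.rnDeriv (μ.prod Mη) z).toReal))
            ∂(μ.prod Mη) : ℝ≥0∞) : EReal)
      - ((∫⁻ z, ENNReal.ofReal (-f ((π.rnDeriv (μ.prod Mη) z).toReal))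
            ∂(μ.prod Mη) : ℝ≥0∞) : EReal))
    (Δ : Set (Fin N → ℝ)) (hΔ : Δ = {p | (∀ i, 0 ≤ p i) ∧ ∑ i, p i = 1})
    (D : (Fin N → ℝ) → ℝ)
    (hD : ∀ φ, D φ = ∫ x,
      (⨅ p ∈ Δ, ∑ i, (((φ i * ν i : ℝ) : EReal)
        + (((c x (y i) : ℝ≥0∞) : EReal) - ((φ i : ℝ) : EReal)) * ((p i : ℝ) : EReal)
        + ((f (p i / η i) * η i : ℝ) : EReal))).toReal ∂μ) :
    (⨅ π ∈ S, Pr π) = (⨆ φ : Fin N → ℝ, ((D φ : ℝ) : EReal)) ∧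
    ∃ π ∈ S, Pr π = ⨅ π' ∈ S, Pr π' := by
  have hfc : ContinuousOn f (Ici 0) := hf_conv.continuousOn_Ici_of_lowerSemicontinuousOn hf_lsc
  have hνΔ : WithLp.toLp 2 ν ∈ simplex (Fin N) := ⟨fun i => (hν_pos i).le, hν_sum⟩
  have hcm : ∀ i, Measurable fun x => c x (y i) := fun i => (hc_lsc i).measurable
  set C : Fin N → EuclideanSpace ℝ (Fin m) → ℝ := fun i x => (c x (y i)).toReal
  have hCm : ∀ i, Measurable (C i) := fun i => (hcm i).ennreal_toReal
  have hCi : ∀ i, Integrable (C i) μ := fun i =>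
    integrable_toReal_of_lintegral_ne_top (hcm i).aemeasurable (hc_int i)
  have hh := continuousOn_divergence hη_pos hfc
  have hDeq : ∀ φ, D φ = dualObjective μ C (divergence f η) (simplex (Fin N)) ν φ := by
    intro φ
    rw [hD, dualObjective]
    refine integral_congr_ae ?_
    filter_upwards [ae_all_iff.2 fun i => ae_lt_top (hcm i) (hc_int i)] with x hx
    rw [hΔ]
    exact iInf_extendedCost_toReal hη_pos ⟨_, hνΔ⟩ hfc φ fun i => (hx i).ne
  have hweak : ∀ π ∈ S, ∀ φ, ((D φ : ℝ) : EReal) ≤ Pr π := by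
    intro π hπ φ
    rw [hS] at hπ
    obtain ⟨hprob, hfst, hsnd, hac⟩ := hπ
    rw [hMν] at hsnd
    obtain ⟨p, hp, hpν, hρ⟩ := exists_selection_of_marginals hy hνΔ hη_pos hfst hsnd (hMη ▸ hac)
    rw [← hMη] at hρ
    rw [hPr, regularizedCost_eq hη_pos hcm hc_int hfc hp hMη hac hρ, hDeq]
    exact EReal.coe_le_coe_iff.2 (dualObjective_le isCompact_simplex hh hCm hCi hp hpν φ)
  obtain ⟨p, hp, hpν, hle⟩ := exists_selection_integral_le_iSup_dualObjective (μ := μ)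
    isCompact_simplex hh (convexOn_divergence hη_pos hf_conv) hCm hCi hνΔ
  obtain ⟨π, hprob, hfst, hsnd, hac, hρ⟩ := exists_measure_of_selection hy hη_pos hp hpν
  rw [← hMν] at hsnd
  rw [← hMη] at hac hρ
  have hπS : π ∈ S := by
    rw [hS]
    exact ⟨hprob, hfst, hsnd, hac⟩
  have hπ : Pr π ≤ ⨆ φ : Fin N → ℝ, ((D φ : ℝ) : EReal) := by
    rw [hPr, regularizedCost_eq hη_pos hcm hc_int hfc hp hMη hac hρ]
    refine le_of_forall_lt fun b hb => ?_
    obtain ⟨r, hbr, hr⟩ := EReal.lt_iff_exists_real_btwn.1 hb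
    obtain ⟨φ, hφ⟩ := exists_lt_of_lt_ciSup ((EReal.coe_lt_coe_iff.1 hr).trans_le hle)
    refine hbr.trans ((EReal.coe_lt_coe_iff.2 hφ).trans_le ?_)
    rw [← hDeq]
    exact le_iSup (fun φ : Fin N → ℝ => ((D φ : ℝ) : EReal)) φ
  have hsup : (⨆ φ : Fin N → ℝ, ((D φ : ℝ) : EReal)) ≤ ⨅ π ∈ S, Pr π :=
    iSup_le fun φ => le_iInf₂ fun π hπ => hweak π hπ φ
  have hinf : (⨅ π ∈ S, Pr π) ≤ Pr π := iInf₂_le π hπS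
  exact ⟨le_antisymm (hinf.trans hπ) hsup, π, hπS, le_antisymm (hπ.trans hsup) hinf⟩
end
end

section
/- Let X ⊆ ℝ^m be closed, μ a Borel probability measure on X, y₁,…,y_N ∈ ℝ^k distinct, ν = Σ_{i=1}^N ν_i δ_{y_i} and η = Σ_{i=1}^N η_i δ_{y_i} with ν, η ∈ Δ^N and ν_i > 0, η_i > 0 for all i, and let c : X × ℝ^k → [0,∞) be such that x ↦ c(x,y_i) is lower semicontinuous and μ-integrable for each i. Let F : ℝ → (0,∞) be a continuous, strictly increasing bijection onto (0,∞) whose inverse F^{-1} satisfies ∫_0^1 |F^{-1}(t)| dt < ∞ and ∫_0^1 F^{-1}(t) dt = 0, define the marginal cumulative distribution functions F_i(s) = min{1, max{0, 1 − η_i F(−s)}} for i ∈ {1,…,N}, and set f(s) = ∫_0^s F^{-1}(t) dt for s ≥ 0. Then sup_{φ ∈ ℝ^N} ∫_X ( Σ_{i=1}^N ν_i φ_i − ψ̄_c(φ, x) ) dμ(x) = inf { ∫ c dπ + ∫ f( dπ/d(μ⊗η) ) d(μ⊗η) : π ∈ Π(μ,ν), π ≪ μ⊗η }, where ψ̄_c(φ,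 x) = max_{p ∈ Δ^N} Σ_{i=1}^N (φ_i − c(x, y_i)) p_i + Σ_{i=1}^N ∫_{1−p_i}^1 F_i^{-1}(t) dt and F_i^{-1}(t) = inf{s ∈ ℝ : F_i(s) ≥ t} is the quantile function of F_i. -/
open MeasureTheory Set
open scoped ENNReal

noncomputable section

theorem strictMonoOn_of_rightInverse {F Finv : ℝ → ℝ} (hF_mono : StrictMono F)
    (hFinv_right : ∀ r : ℝ, 0 < r → F (Finv r) = r) : StrictMonoOn Finv (Ioi 0) := by
  intro a ha b hb hab
  by_contra! h
  have := hF_mono.monotone h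
  rw [hFinv_right a ha, hFinv_right b hb] at this
  exact absurd hab (not_lt.2 this)

theorem continuousOn_of_inverse {F Finv : ℝ → ℝ} (hF_mono : StrictMono F) (hF_pos : ∀ s, 0 < F s)
    (hFinv_left : ∀ s, Finv (F s) = s)
    (hFinv_right : ∀ r : ℝ, 0 < r → F (Finv r) = r) : ContinuousOn Finv (Ioi 0) := by
  intro a ha
  refine ((strictMonoOn_of_rightInverse hF_mono hFinv_right).continuousAt_of_image_mem_nhds
    (Ioi_mem_nhds ha) ?_).continuousWithinAt
  have : Finv '' Ioi 0 = univ :=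
    eq_univ_of_forall fun s => ⟨F s, hF_pos s, hFinv_left s⟩
  rw [this]
  exact Filter.univ_mem

theorem integrableOn_Ioc_of_continuousOn_Ioi {h : ℝ → ℝ} (hc : ContinuousOn h (Ioi 0))
    (hi : IntegrableOn h (Ioo 0 1)) (b : ℝ) : IntegrableOn h (Ioc 0 b) := by
  have h1 : IntegrableOn h (Ioc 0 1) := (integrableOn_Ioc_iff_integrableOn_Ioo (by simp)).2 hi
  have h2 : IntegrableOn h (Icc 1 b) :=
    (hc.mono fun x hx => lt_of_lt_of_le one_pos hx.1).integrableOn_Icc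
  refine (h1.union h2).mono_set fun x hx => ?_
  rcases le_total x 1 with h | h
  · exact Or.inl ⟨hx.1, h⟩
  · exact Or.inr ⟨h, hx.2⟩

theorem continuous_integral_max_zero {h : ℝ → ℝ} (hi : ∀ b, IntegrableOn h (Ioc 0 b)) :
    Continuous fun s : ℝ => ∫ t in (0 : ℝ)..(max s 0), h t := by
  have key : ∀ s : ℝ, ∫ t in (0 : ℝ)..(max s 0), h t = ∫ t in (0 : ℝ)..s, (Ioi 0).indicator h t := by
    intro s
    rcases le_total s 0 with hs | hs
    · rw [max_eq_right hs, intervalIntegral.integral_same, intervalIntegral.integral_of_ge hs,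
        setIntegral_congr_fun (g := fun _ => (0 : ℝ)) measurableSet_Ioc]
      · simp
      · intro x hx
        exact indicator_of_notMem (by simpa using hx.2) _
    · rw [max_eq_left hs]
      refine intervalIntegral.integral_congr_ae (Filter.Eventually.of_forall fun x hx => ?_)
      rw [uIoc_of_le hs] at hx
      exact (indicator_of_mem (s := Ioi (0 : ℝ)) hx.1 h).symm
  simp_rw [key]
  refine intervalIntegral.continuous_primitive (fun a b => ?_) 0
  rw [intervalIntegrable_iff, IntegrableOn, integrable_indicator_iff measurableSet_Ioi, IntegrableOn,
    Measure.restrict_restrict measurableSet_Ioi]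
  refine (hi (max a b)).mono_set fun x hx => ⟨hx.1, hx.2.2⟩

theorem strictConvexOn_integral {h : ℝ → ℝ} (hc : ContinuousOn h (Ioi 0))
    (hm : StrictMonoOn h (Ioi 0)) (hi : ∀ b, IntegrableOn h (Ioc 0 b)) :
    StrictConvexOn ℝ (Ici 0) fun s : ℝ => ∫ t in (0 : ℝ)..s, h t := by
  refine StrictMonoOn.strictConvexOn_of_deriv (convex_Ici 0) ?_ ?_
  · refine (continuous_integral_max_zero hi).continuousOn.congr fun s hs => ?_
    simp only [max_eq_left (show (0 : ℝ) ≤ s from hs)]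
  · rw [interior_Ici]
    refine hm.congr fun s hs => ?_
    refine (intervalIntegral.integral_hasDerivAt_right ?_ ?_ ?_).deriv.symm
    · rw [intervalIntegrable_iff_integrableOn_Ioc_of_le (le_of_lt hs)]
      exact hi s
    · exact hc.stronglyMeasurableAtFilter isOpen_Ioi s hs
    · exact hc.continuousAt (Ioi_mem_nhds hs)

theorem sInf_clipped_eq {F Finv : ℝ → ℝ} (hF_mono : StrictMono F)
    (hFinv_right : ∀ r : ℝ, 0 < r → F (Finv r) = r) {η t : ℝ} (hη : 0 < η) (ht0 : 0 < t)
    (ht1 : t < 1) :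
    sInf {s : ℝ | t ≤ min 1 (max 0 (1 - η * F (-s)))} = -Finv ((1 - t) / η) := by
  have hpos : 0 < (1 - t) / η := div_pos (by linarith) hη
  have : {s : ℝ | t ≤ min 1 (max 0 (1 - η * F (-s)))} = Ici (-Finv ((1 - t) / η)) := by
    ext s
    have h1 : t ≤ min 1 (max 0 (1 - η * F (-s))) ↔ F (-s) ≤ (1 - t) / η := by
      rw [le_min_iff, le_max_iff, le_div_iff₀ hη]
      constructor
      · rintro ⟨-, h | h⟩ <;> linarith
      · intro h
        exact ⟨ht1.le, Or.inr (by linarith)⟩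
    rw [mem_ofPred_eq, h1, mem_Ici, neg_le]
    conv_lhs => rw [← hFinv_right _ hpos]
    exact hF_mono.le_iff_le
  rw [this, csInf_Ici]

theorem integral_quantile_eq {Finv G : ℝ → ℝ} {η p : ℝ} (hη : 0 < η) (hp0 : 0 ≤ p) (hp1 : p ≤ 1)
    (hG : ∀ t, 0 < t → t < 1 → G t = -Finv ((1 - t) / η)) :
    ∫ t in (1 - p)..1, G t = -(η * ∫ t in (0 : ℝ)..(p / η), Finv t) := by
  have h1 : ∫ t in (1 - p)..1, G t = ∫ t in (1 - p)..1, -Finv (1 / η - t / η) := by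
    rw [intervalIntegral.integral_of_le (by linarith), intervalIntegral.integral_of_le (by linarith),
      integral_Ioc_eq_integral_Ioo, integral_Ioc_eq_integral_Ioo]
    refine setIntegral_congr_fun measurableSet_Ioo fun t ht => ?_
    simp only [hG t (by linarith [ht.1]) ht.2, sub_div]
  rw [h1, intervalIntegral.integral_neg, intervalIntegral.integral_comp_sub_div _ hη.ne',
    smul_eq_mul, sub_self, ← sub_div, sub_sub_cancel]

theorem strictConvexOn_sum_mul_div {ι : Type*} [Fintype ι] {w : ι → ℝ} (hw : ∀ i, 0 < w i)
    {f : ℝ → ℝ} (hf : StrictConvexOn ℝ (Ici 0) f) :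
    StrictConvexOn ℝ (stdSimplex ℝ ι) fun p => ∑ i, w i * f (p i / w i) := by
  refine ⟨convex_stdSimplex ℝ ι, fun p hp q hq hne a b ha hb hab => ?_⟩
  have hmem : ∀ {p : ι → ℝ}, p ∈ stdSimplex ℝ ι → ∀ i, p i / w i ∈ Ici (0 : ℝ) := fun hp i =>
    div_nonneg (hp.1 i) (hw i).le
  have harg : ∀ i, (a • p + b • q) i / w i = a • (p i / w i) + b • (q i / w i) := fun i => by
    simp only [Pi.add_apply, Pi.smul_apply, smul_eq_mul]
    ring
  simp only [harg, smul_eq_mul, Finset.mul_sum, ← Finset.sum_add_distrib]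
  obtain ⟨j, hj⟩ := Function.ne_iff.1 hne
  refine Finset.sum_lt_sum (fun i _ => ?_) ⟨j, Finset.mem_univ j, ?_⟩
  · have h := hf.convexOn.2 (hmem hp i) (hmem hq i) ha.le hb.le hab
    simp only [smul_eq_mul] at h
    have := mul_le_mul_of_nonneg_left h (hw i).le
    linarith
  · have hjne : p j / w j ≠ q j / w j := fun h => hj ((div_left_inj' (hw j).ne').1 h)
    have h := hf.2 (hmem hp j) (hmem hq j) hjne ha hb hab
    simp only [smul_eq_mul] at h
    have := mul_lt_mul_of_pos_left h (hw j)
    linarith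

section SimplexConjugate

open Filter Topology

variable {ι : Type*} [Fintype ι]

/-- The convex conjugate of `g` restricted to the standard simplex. -/
def simplexConjugate (g : (ι → ℝ) → ℝ) (u : ι → ℝ) : ℝ :=
  sSup ((fun p : ι → ℝ => ∑ i, u i * p i - g p) '' stdSimplex ℝ ι)

theorem abs_sum_mul_le_norm (u : ι → ℝ) {p : ι → ℝ} (hp : p ∈ stdSimplex ℝ ι) :
    |∑ i, u i * p i| ≤ ‖u‖ := by
  calc |∑ i, u i * p i| ≤ ∑ i, |u i * p i| := Finset.abs_sum_le_sum_abs _ _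
    _ ≤ ∑ i, ‖u‖ * p i := by
      refine Finset.sum_le_sum fun i _ => ?_
      rw [abs_mul, abs_of_nonneg (hp.1 i)]
      exact mul_le_mul_of_nonneg_right (norm_le_pi_norm u i) (hp.1 i)
    _ = ‖u‖ := by rw [← Finset.mul_sum, hp.2, mul_one]

variable {g : (ι → ℝ) → ℝ}

theorem le_simplexConjugate (hg : Continuous g) (u : ι → ℝ) {p : ι → ℝ} (hp : p ∈ stdSimplex ℝ ι) :
    ∑ i, u i * p i - g p ≤ simplexConjugate g u := by
  refine le_csSup (IsCompact.bddAbove ?_) (mem_image_of_mem _ hp)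
  exact (isCompact_stdSimplex ℝ ι).image (by fun_prop)

theorem exists_eq_simplexConjugate [Nonempty ι] (hg : Continuous g) (u : ι → ℝ) :
    ∃ p ∈ stdSimplex ℝ ι, ∑ i, u i * p i - g p = simplexConjugate g u := by
  classical
  have hne : (stdSimplex ℝ ι).Nonempty := ⟨_, single_mem_stdSimplex ℝ (Classical.arbitrary ι)⟩
  have hc : ContinuousOn (fun p : ι → ℝ => ∑ i, u i * p i - g p) (stdSimplex ℝ ι) := by fun_prop
  obtain ⟨p, hp, h⟩ := (isCompact_stdSimplex ℝ ι).exists_sSup_image_eq hne hc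
  exact ⟨p, hp, h.symm⟩

theorem simplexConjugate_le_add [Nonempty ι] (hg : Continuous g) (u v : ι → ℝ) :
    simplexConjugate g u ≤ simplexConjugate g v + ‖u - v‖ := by
  obtain ⟨p, hp, h⟩ := exists_eq_simplexConjugate hg u
  have h1 := le_simplexConjugate hg v hp
  have h2 := (abs_le.1 (abs_sum_mul_le_norm (u - v) hp)).2
  simp only [Pi.sub_apply, sub_mul, Finset.sum_sub_distrib] at h2
  linarith

theorem lipschitzWith_simplexConjugate [Nonempty ι] (hg : Continuous g) : LipschitzWith 1 (simplexConjugate g) :=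
  LipschitzWith.of_le_add fun u v => by
    rw [dist_eq_norm]; exact simplexConjugate_le_add hg u v

theorem simplexConjugate_add_const [Nonempty ι] (hg : Continuous g) (u : ι → ℝ) (t : ℝ) :
    simplexConjugate g (fun i => u i + t) = simplexConjugate g u + t := by
  have key : ∀ p ∈ stdSimplex ℝ ι,
      ∑ i, (u i + t) * p i - g p = ∑ i, u i * p i - g p + t := by
    intro p hp
    simp only [add_mul, Finset.sum_add_distrib, ← Finset.mul_sum, hp.2]
    ring
  apply le_antisymm
  · obtain ⟨p, hp, h⟩ := exists_eq_simplexConjugate hg fun i => u i + t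
    rw [← h, key p hp]
    gcongr
    exact le_simplexConjugate hg u hp
  · obtain ⟨p, hp, h⟩ := exists_eq_simplexConjugate hg u
    rw [← h, ← key p hp]
    exact le_simplexConjugate hg _ hp

theorem eq_of_eq_simplexConjugate (hg : Continuous g) (hs : StrictConvexOn ℝ (stdSimplex ℝ ι) g)
    {u p q : ι → ℝ} (hp : p ∈ stdSimplex ℝ ι) (hq : q ∈ stdSimplex ℝ ι)
    (hpu : ∑ i, u i * p i - g p = simplexConjugate g u)
    (hqu : ∑ i, u i * q i - g q = simplexConjugate g u) : p = q := by
  by_contra hne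
  have hhalf : (0 : ℝ) < 1 / 2 := by norm_num
  have hone : (1 / 2 : ℝ) + 1 / 2 = 1 := by norm_num
  have h1 := hs.2 hp hq hne hhalf hhalf hone
  have h2 := le_simplexConjugate hg u (hs.1 hp hq hhalf.le hhalf.le hone)
  have h3 : ∑ i, u i * ((1 / 2 : ℝ) • p + (1 / 2 : ℝ) • q) i
      = 1 / 2 * ∑ i, u i * p i + 1 / 2 * ∑ i, u i * q i := by
    rw [Finset.mul_sum, Finset.mul_sum, ← Finset.sum_add_distrib]
    refine Finset.sum_congr rfl fun i _ => ?_
    simp only [Pi.add_apply, Pi.smul_apply, smul_eq_mul]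
    ring
  simp only [smul_eq_mul] at h1
  linarith

theorem exists_continuous_argmax [Nonempty ι] (hg : Continuous g)
    (hs : StrictConvexOn ℝ (stdSimplex ℝ ι) g) :
    ∃ P : (ι → ℝ) → ι → ℝ, Continuous P ∧ (∀ u, P u ∈ stdSimplex ℝ ι) ∧
      ∀ u, ∑ i, u i * P u i - g (P u) = simplexConjugate g u := by
  choose P hP hPu using exists_eq_simplexConjugate hg
  refine ⟨P, continuous_iff_continuousAt.2 fun u => ?_, hP, hPu⟩
  refine (isCompact_stdSimplex ℝ ι).tendsto_nhds_of_unique_mapClusterPt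
    (Eventually.of_forall hP) fun z hz hcl => ?_
  refine eq_of_eq_simplexConjugate hg hs hz (hP u) ?_ (hPu u)
  have hcont : Continuous fun p : ι → ℝ => ∑ i, u i * p i - g p := by fun_prop
  have hcl' : MapClusterPt (∑ i, u i * z i - g z) (𝓝 u)
      ((fun p : ι → ℝ => ∑ i, u i * p i - g p) ∘ P) :=
    hcl.continuousAt_comp hcont.continuousAt
  have hlim : Tendsto ((fun p : ι → ℝ => ∑ i, u i * p i - g p) ∘ P) (𝓝 u)
      (𝓝 (simplexConjugate g u)) := by
    have hlow : Tendsto (fun v => simplexConjugate g v - ‖u - v‖) (𝓝 u)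
        (𝓝 (simplexConjugate g u)) := by
      have : Continuous fun v => simplexConjugate g v - ‖u - v‖ := by
        have := (lipschitzWith_simplexConjugate hg).continuous
        fun_prop
      simpa using this.tendsto u
    refine tendsto_of_tendsto_of_tendsto_of_le_of_le hlow tendsto_const_nhds (fun v => ?_)
      fun v => le_simplexConjugate hg u (hP v)
    have h1 := hPu v
    have h2 := (abs_le.1 (abs_sum_mul_le_norm (u - v) (hP v))).1
    simp only [Pi.sub_apply, sub_mul, Finset.sum_sub_distrib] at h2
    simp only [Function.comp]
    linarith
  exact (eq_of_nhds_neBot (hcl'.clusterPt.mono hlim)).symm ▸ rfl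

end SimplexConjugate

section SemiDual

open Filter Topology

variable {ι E : Type*} [Fintype ι] [MeasurableSpace E] {μ : Measure E} [IsProbabilityMeasure μ]
  {g : (ι → ℝ) → ℝ} {C : E → ι → ℝ}

theorem integrable_simplexConjugate_sub [Nonempty ι] (hg : Continuous g)
    (hC : ∀ i, Integrable (fun x => C x i) μ) (φ : ι → ℝ) :
    Integrable (fun x => simplexConjugate g (φ - C x)) μ := by
  have hC' : Integrable C μ := Integrable.of_eval hC
  have hL := lipschitzWith_simplexConjugate hg
  refine Integrable.mono' (g := fun x => |simplexConjugate g φ| + ‖C x‖) (by fun_prop)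
    (hL.continuous.comp_aestronglyMeasurable
      (aestronglyMeasurable_const.sub hC'.aestronglyMeasurable)) (Eventually.of_forall fun x => ?_)
  have h := hL.dist_le_mul (φ - C x) φ
  rw [Real.dist_eq, dist_eq_norm, sub_sub_cancel_left, norm_neg, NNReal.coe_one, one_mul] at h
  rw [Real.norm_eq_abs]
  have := abs_sub_abs_le_abs_sub (simplexConjugate g (φ - C x)) (simplexConjugate g φ)
  linarith

/-- The objective of the regularized semi-discrete dual problem. -/
def semiDual (μ : Measure E) (g : (ι → ℝ) → ℝ) (C : E → ι → ℝ) (ν φ : ι → ℝ) : ℝ :=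
  ∑ i, ν i * φ i - ∫ x, simplexConjugate g (φ - C x) ∂μ

theorem continuous_semiDual [Nonempty ι] (hg : Continuous g)
    (hC : ∀ i, Integrable (fun x => C x i) μ) (ν : ι → ℝ) : Continuous (semiDual μ g C ν) := by
  have hL : LipschitzWith 1 fun φ : ι → ℝ => ∫ x, simplexConjugate g (φ - C x) ∂μ := by
    refine LipschitzWith.of_le_add fun φ φ' => ?_
    have h1 := integrable_simplexConjugate_sub hg hC φ
    have h2 := integrable_simplexConjugate_sub hg hC φ'
    calc ∫ x, simplexConjugate g (φ - C x) ∂μ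
        ≤ ∫ x, (simplexConjugate g (φ' - C x) + dist φ φ') ∂μ := by
          refine integral_mono h1 (h2.add (integrable_const _)) fun x => ?_
          have := simplexConjugate_le_add hg (φ - C x) (φ' - C x)
          rwa [sub_sub_sub_cancel_right, ← dist_eq_norm] at this
      _ = _ := by rw [integral_add h2 (integrable_const _)]; simp
  have := hL.continuous
  unfold semiDual
  fun_prop

theorem semiDual_add_const [Nonempty ι] (hg : Continuous g)
    (hC : ∀ i, Integrable (fun x => C x i) μ) {ν : ι → ℝ} (hν : ∑ i, ν i = 1) (φ : ι → ℝ) (t : ℝ) :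
    semiDual μ g C ν (fun i => φ i + t) = semiDual μ g C ν φ := by
  have : ∀ x, simplexConjugate g ((fun i => φ i + t) - C x) = simplexConjugate g (φ - C x) + t := by
    intro x
    rw [← simplexConjugate_add_const hg]
    congr 1
    ext i
    simp only [Pi.sub_apply]
    ring
  unfold semiDual
  simp_rw [this]
  rw [integral_add (integrable_simplexConjugate_sub hg hC φ) (integrable_const _)]
  simp only [mul_add, Finset.sum_add_distrib, ← Finset.sum_mul, hν, integral_const, probReal_univ,
    smul_eq_mul]
  ring

theorem exists_semiDual_le [Nonempty ι] (hg : Continuous g)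
    (hC : ∀ i, Integrable (fun x => C x i) μ) (ν : ι → ℝ) :
    ∃ K, ∀ φ j, semiDual μ g C ν φ ≤ ∑ i, ν i * φ i - φ j + K := by
  classical
  refine ⟨∑ j, |∫ x, (C x j + g (Pi.single j 1)) ∂μ|, fun φ j => ?_⟩
  have h1 : ∫ x, (φ j - (C x j + g (Pi.single j 1))) ∂μ
      ≤ ∫ x, simplexConjugate g (φ - C x) ∂μ := by
    refine integral_mono (by have := hC j; fun_prop)
      (integrable_simplexConjugate_sub hg hC φ) fun x => ?_
    have := le_simplexConjugate hg (φ - C x) (single_mem_stdSimplex ℝ j)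
    simp only [Pi.single_apply, mul_ite, mul_one, mul_zero, Finset.sum_ite_eq', Finset.mem_univ,
      if_true, Pi.sub_apply] at this
    simpa only [sub_sub] using this
  rw [integral_sub (integrable_const _) (by have := hC j; fun_prop)] at h1
  simp only [integral_const, probReal_univ, one_smul] at h1
  have h2 : ∫ x, (C x j + g (Pi.single j 1)) ∂μ
      ≤ ∑ j, |∫ x, (C x j + g (Pi.single j 1)) ∂μ| :=
    (le_abs_self _).trans (Finset.single_le_sum
      (f := fun j => |∫ x, (C x j + g (Pi.single j 1)) ∂μ|) (fun _ _ => abs_nonneg _)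
      (Finset.mem_univ j))
  unfold semiDual
  linarith

theorem exists_forall_semiDual_le [Nonempty ι] (hg : Continuous g)
    (hC : ∀ i, Integrable (fun x => C x i) μ) {ν : ι → ℝ} (hν_pos : ∀ i, 0 < ν i)
    (hν : ∑ i, ν i = 1) : ∃ φ, ∀ φ', semiDual μ g C ν φ' ≤ semiDual μ g C ν φ := by
  obtain ⟨K, hK⟩ := exists_semiDual_le (μ := μ) hg hC ν
  set G := semiDual μ g C ν with hG
  set R : ℝ := ∑ i, |K - G 0| / ν i with hR
  have hRi : ∀ i, |K - G 0| ≤ R * ν i := fun i => by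
    rw [← div_le_iff₀ (hν_pos i), hR]
    exact Finset.single_le_sum (f := fun i => |K - G 0| / ν i)
      (fun i _ => div_nonneg (abs_nonneg _) (hν_pos i).le) (Finset.mem_univ i)
  have hR0 : 0 ≤ R := Finset.sum_nonneg fun i _ => div_nonneg (abs_nonneg _) (hν_pos i).le
  obtain ⟨φ, hφ, hmax⟩ := (isCompact_Icc (a := fun _ : ι => -R) (b := 0)).exists_isMaxOn
    ⟨0, ⟨fun _ => by simpa using hR0, le_rfl⟩⟩ (continuous_semiDual (μ := μ) hg hC ν).continuousOn
  refine ⟨φ, fun φ' => ?_⟩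
  obtain ⟨j, hj⟩ := Finite.exists_max φ'
  rw [hG, ← semiDual_add_const hg hC hν φ' (-φ' j)]
  set χ : ι → ℝ := fun i => φ' i + -φ' j with hχ
  have hχ0 : ∀ i, χ i ≤ 0 := fun i => by simpa [hχ] using hj i
  by_cases hbox : ∀ i, -R ≤ χ i
  · exact hmax ⟨hbox, hχ0⟩
  · push Not at hbox
    obtain ⟨i, hi⟩ := hbox
    have h0 : G 0 ≤ G φ := hmax ⟨fun _ => by simpa using hR0, le_rfl⟩
    have h1 := hK χ j
    have h2 : ∑ i, ν i * χ i ≤ ν i * χ i := by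
      have := Finset.single_le_sum (f := fun i => -(ν i * χ i))
        (fun i _ => by have := mul_nonpos_of_nonneg_of_nonpos (hν_pos i).le (hχ0 i); linarith)
        (Finset.mem_univ i)
      rw [Finset.sum_neg_distrib] at this
      linarith
    have h3 : χ j = 0 := by simp [hχ]
    have h4 : ν i * χ i ≤ ν i * (-R) := mul_le_mul_of_nonneg_left hi.le (hν_pos i).le
    have h5 := le_abs_self (K - G 0)
    have h6 := hRi i
    rw [hG] at h0 h5 h6
    linarith [mul_comm R (ν i)]

/-- At a maximizer of the dual problem, the conditional probabilities attaining the conjugate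
reproduce the prescribed marginal `ν`. -/
theorem integral_argmax_eq [Nonempty ι] (hg : Continuous g)
    (hC : ∀ i, Integrable (fun x => C x i) μ) {ν φ : ι → ℝ}
    (hφ : ∀ φ', semiDual μ g C ν φ' ≤ semiDual μ g C ν φ) {P : (ι → ℝ) → ι → ℝ}
    (hPc : Continuous P) (hP : ∀ u, P u ∈ stdSimplex ℝ ι)
    (hPu : ∀ u, ∑ i, u i * P u i - g (P u) = simplexConjugate g u) (i : ι) :
    ∫ x, P (φ - C x) i ∂μ = ν i := by
  have hC' : Integrable C μ := Integrable.of_eval hC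
  have hPm : ∀ ψ : ι → ℝ, ∀ i, AEStronglyMeasurable (fun x => P (ψ - C x) i) μ := fun ψ i =>
    ((continuous_apply i).comp hPc).comp_aestronglyMeasurable
      (aestronglyMeasurable_const.sub hC'.aestronglyMeasurable)
  have hPb : ∀ u i, ‖P u i‖ ≤ 1 := fun u i => by
    rw [Real.norm_eq_abs, abs_of_nonneg ((hP u).1 i), ← (hP u).2]
    exact Finset.single_le_sum (fun i _ => (hP u).1 i) (Finset.mem_univ i)
  have hPi : ∀ ψ : ι → ℝ, ∀ i, Integrable (fun x => P (ψ - C x) i) μ := fun ψ i =>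
    Integrable.of_bound (hPm ψ i) 1 (Eventually.of_forall fun x => hPb _ i)
  have step : ∀ (d : ι → ℝ) (ε : ℝ), 0 < ε →
      ∑ i, d i * ν i ≤ ∑ i, d i * ∫ x, P (φ + ε • d - C x) i ∂μ := by
    intro d ε hε
    have h1 : ∫ x, simplexConjugate g (φ + ε • d - C x) ∂μ
        ≤ ∫ x, (simplexConjugate g (φ - C x) + ε * ∑ i, d i * P (φ + ε • d - C x) i) ∂μ := by
      refine integral_mono (integrable_simplexConjugate_sub hg hC _)
        ((integrable_simplexConjugate_sub hg hC _).add
          ((integrable_finsetSum _ fun i _ => (hPi _ i).const_mul _).const_mul _)) fun x => ?_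
      have h1 := hPu (φ + ε • d - C x)
      have h2 := le_simplexConjugate hg (φ - C x) (hP (φ + ε • d - C x))
      have h3 : ∑ i, (φ + ε • d - C x) i * P (φ + ε • d - C x) i
          = ∑ i, (φ - C x) i * P (φ + ε • d - C x) i + ε * ∑ i, d i * P (φ + ε • d - C x) i := by
        rw [Finset.mul_sum, ← Finset.sum_add_distrib]
        refine Finset.sum_congr rfl fun i _ => ?_
        simp only [Pi.sub_apply, Pi.add_apply, Pi.smul_apply, smul_eq_mul]
        ring
      simp only
      linarith
    rw [integral_add (integrable_simplexConjugate_sub hg hC _)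
      ((integrable_finsetSum _ fun i _ => (hPi _ i).const_mul _).const_mul _), integral_const_mul,
      integral_finsetSum _ fun i _ => (hPi _ i).const_mul _] at h1
    simp_rw [integral_const_mul] at h1
    have h2 := hφ (φ + ε • d)
    unfold semiDual at h2
    have h3 : ∑ i, ν i * (φ + ε • d) i = ∑ i, ν i * φ i + ε * ∑ i, d i * ν i := by
      rw [Finset.mul_sum, ← Finset.sum_add_distrib]
      refine Finset.sum_congr rfl fun i _ => ?_
      simp only [Pi.add_apply, Pi.smul_apply, smul_eq_mul]
      ring
    refine le_of_mul_le_mul_left ?_ hε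
    linarith
  have lim : ∀ d : ι → ℝ, ∑ i, d i * ν i ≤ ∑ i, d i * ∫ x, P (φ - C x) i ∂μ := by
    intro d
    have ht : Tendsto (fun ε : ℝ => ∑ i, d i * ∫ x, P (φ + ε • d - C x) i ∂μ) (𝓝[>] 0)
        (𝓝 (∑ i, d i * ∫ x, P (φ - C x) i ∂μ)) := by
      refine tendsto_finsetSum _ fun i _ => Tendsto.const_mul _ ?_
      refine tendsto_integral_filter_of_dominated_convergence (fun _ => 1)
        (Eventually.of_forall fun ε => hPm _ i)
        (Eventually.of_forall fun ε => Eventually.of_forall fun x => hPb _ i)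
        (integrable_const _) (Eventually.of_forall fun x => ?_)
      have : Continuous fun ε : ℝ => P (φ + ε • d - C x) i := by fun_prop
      refine (Tendsto.mono_left ?_ nhdsWithin_le_nhds)
      simpa using this.tendsto 0
    refine ge_of_tendsto ht ?_
    filter_upwards [self_mem_nhdsWithin] with ε hε using step d ε hε
  classical
  have h1 := lim (Pi.single i 1)
  have h2 := lim (-Pi.single i 1)
  simp only [Pi.neg_apply, Pi.single_apply, neg_mul, ite_mul, one_mul, zero_mul,
    Finset.sum_neg_distrib, Finset.sum_ite_eq', Finset.mem_univ, if_true] at h1 h2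
  linarith

end SemiDual

section DiscreteProduct

variable {ι α β : Type*} [Fintype ι] [MeasurableSpace α] [MeasurableSpace β]
  [MeasurableSingletonClass β]

/-- The measure `∑ᵢ wᵢ δ_{yᵢ}`. -/
def weightedDirac (w : ι → ℝ) (y : ι → β) : Measure β :=
  ∑ i, ENNReal.ofReal (w i) • Measure.dirac (y i)

instance (w : ι → ℝ) (y : ι → β) : IsFiniteMeasure (weightedDirac w y) := by
  refine ⟨?_⟩
  simp only [weightedDirac, Measure.finsetSum_apply, Measure.smul_apply, measure_univ, smul_eq_mul,
    mul_one]
  exact ENNReal.sum_lt_top.2 fun i _ => ENNReal.ofReal_lt_top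

variable (μ : Measure α) [IsProbabilityMeasure μ] (w : ι → ℝ) (y : ι → β)

theorem prod_weightedDirac :
    μ.prod (weightedDirac w y) = ∑ i, ENNReal.ofReal (w i) • μ.map fun x => (x, y i) := by
  ext s hs
  rw [Measure.prod_apply_symm hs, weightedDirac, lintegral_finsetSum_measure,
    Measure.finsetSum_apply]
  refine Finset.sum_congr rfl fun i _ => ?_
  rw [lintegral_smul_measure, lintegral_dirac, Measure.smul_apply,
    Measure.map_apply measurable_prodMk_right hs]

theorem lintegral_prod_weightedDirac (h : α × β → ℝ≥0∞) :
    ∫⁻ z, h z ∂(μ.prod (weightedDirac w y))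
      = ∑ i, ENNReal.ofReal (w i) * ∫⁻ x, h (x, y i) ∂μ := by
  rw [prod_weightedDirac, lintegral_finsetSum_measure]
  refine Finset.sum_congr rfl fun i _ => ?_
  rw [lintegral_smul_measure, (measurableEmbedding_prod_mk_right (y i)).lintegral_map, smul_eq_mul]

theorem integrable_prod_weightedDirac {h : α × β → ℝ}
    (hh : ∀ i, Integrable (fun x => h (x, y i)) μ) :
    Integrable h (μ.prod (weightedDirac w y)) := by
  rw [prod_weightedDirac, integrable_finsetSum_measure]
  intro i _
  refine Integrable.smul_measure ?_ ENNReal.ofReal_ne_top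
  exact (measurableEmbedding_prod_mk_right (y i)).integrable_map_iff.2 (hh i)

variable {w}

theorem integral_prod_weightedDirac (hw : ∀ i, 0 ≤ w i) {h : α × β → ℝ}
    (hh : ∀ i, Integrable (fun x => h (x, y i)) μ) :
    ∫ z, h z ∂(μ.prod (weightedDirac w y)) = ∑ i, w i * ∫ x, h (x, y i) ∂μ := by
  rw [prod_weightedDirac, integral_finsetSum_measure]
  · refine Finset.sum_congr rfl fun i _ => ?_
    rw [integral_smul_measure, (measurableEmbedding_prod_mk_right (y i)).integral_map,
      ENNReal.toReal_ofReal (hw i), smul_eq_mul]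
  · intro i _
    refine Integrable.smul_measure ?_ ENNReal.ofReal_ne_top
    exact (measurableEmbedding_prod_mk_right (y i)).integrable_map_iff.2 (hh i)

theorem ae_prod_weightedDirac_iff (hw : ∀ i, 0 < w i) {Q : α × β → Prop} :
    (∀ᵐ z ∂(μ.prod (weightedDirac w y)), Q z) ↔ ∀ i, ∀ᵐ x ∂μ, Q (x, y i) := by
  rw [prod_weightedDirac, ae_finsetSum_measure_iff]
  refine ⟨fun h i => ?_, fun h i _ => ?_⟩
  · have := (Measure.ae_ennreal_smul_measure_iff (by simpa using hw i)).1 (h i (Finset.mem_univ i))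
    exact (measurableEmbedding_prod_mk_right (y i)).ae_map_iff.1 this
  · refine (Measure.ae_ennreal_smul_measure_iff (by simpa using hw i)).2 ?_
    exact (measurableEmbedding_prod_mk_right (y i)).ae_map_iff.2 (h i)

theorem lintegral_withDensity_prod_weightedDirac (hw : ∀ i, 0 < w i) {ρ : α × β → ℝ≥0∞}
    (hρ : Measurable ρ) (hρ_top : ∀ᵐ z ∂(μ.prod (weightedDirac w y)), ρ z < ∞)
    {c : α → β → ℝ} (hc : ∀ x z, 0 ≤ c x z)
    (hint : ∀ i, Integrable (fun x => (ρ (x, y i)).toReal * c x (y i)) μ) :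
    ∫⁻ q, ENNReal.ofReal (c q.1 q.2) ∂((μ.prod (weightedDirac w y)).withDensity ρ)
      = ENNReal.ofReal (∑ i, w i * ∫ x, (ρ (x, y i)).toReal * c x (y i) ∂μ) := by
  rw [lintegral_withDensity_eq_lintegral_mul_non_measurable _ hρ hρ_top]
  have h1 := integral_prod_weightedDirac (h := fun z => (ρ z).toReal * c z.1 z.2) μ y
    (fun i => (hw i).le) hint
  rw [← h1, ofReal_integral_eq_lintegral_ofReal
    (integrable_prod_weightedDirac (h := fun z => (ρ z).toReal * c z.1 z.2) μ w y hint)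
    (Filter.Eventually.of_forall fun z => mul_nonneg ENNReal.toReal_nonneg (hc _ _))]
  refine lintegral_congr_ae ?_
  filter_upwards [hρ_top] with z hz
  rw [Pi.mul_apply, ENNReal.ofReal_mul ENNReal.toReal_nonneg, ENNReal.ofReal_toReal hz.ne]

theorem coe_lintegral_sub_lintegral_neg {Ω : Type*} [MeasurableSpace Ω] {P : Measure Ω} {h : Ω → ℝ}
    (hh : Integrable h P) :
    ((∫⁻ z, ENNReal.ofReal (h z) ∂P : ℝ≥0∞) : EReal)
      - ((∫⁻ z, ENNReal.ofReal (-h z) ∂P : ℝ≥0∞) : EReal) = ((∫ z, h z ∂P : ℝ) : EReal) := by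
  have fin : ∀ {h : Ω → ℝ}, Integrable h P → ∫⁻ z, ENNReal.ofReal (h z) ∂P ≠ ∞ := fun hh =>
    ((lintegral_mono fun z => Real.ofReal_le_enorm _).trans_lt hh.hasFiniteIntegral).ne
  rw [integral_eq_lintegral_pos_part_sub_lintegral_neg_part hh, EReal.coe_sub,
    EReal.coe_ennreal_toReal (fin hh), EReal.coe_ennreal_toReal (fin (h := fun z => -h z) hh.neg)]

/-- The regularized transport cost of a plan, in terms of its conditional probabilities `p`. -/
theorem regularizedCost_eq_s7 (hw : ∀ i, 0 < w i) {c : α → β → ℝ} (hc : ∀ x z, 0 ≤ c x z)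
    (hc_int : ∀ i, Integrable (fun x => c x (y i)) μ) {f f₀ : ℝ → ℝ} (hf₀ : Continuous f₀)
    (hff₀ : ∀ s, 0 ≤ s → f s = f₀ s) {π : Measure (α × β)} [IsFiniteMeasure π]
    (hπ : π ≪ μ.prod (weightedDirac w y)) {p : α → ι → ℝ}
    (hp_meas : ∀ i, AEStronglyMeasurable (fun x => p x i) μ)
    (hp : ∀ᵐ x ∂μ, p x ∈ stdSimplex ℝ ι)
    (hρ : ∀ i, ∀ᵐ x ∂μ,
      (π.rnDeriv (μ.prod (weightedDirac w y)) (x, y i)).toReal = p x i / w i) :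
    Integrable (fun x => ∑ i, c x (y i) * p x i + ∑ i, w i * f₀ (p x i / w i)) μ ∧
    ((∫⁻ q, ENNReal.ofReal (c q.1 q.2) ∂π : ℝ≥0∞) : EReal)
      + ((∫⁻ z, ENNReal.ofReal (f ((π.rnDeriv (μ.prod (weightedDirac w y)) z).toReal))
            ∂(μ.prod (weightedDirac w y)) : ℝ≥0∞) : EReal)
      - ((∫⁻ z, ENNReal.ofReal (-f ((π.rnDeriv (μ.prod (weightedDirac w y)) z).toReal))
            ∂(μ.prod (weightedDirac w y)) : ℝ≥0∞) : EReal)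
      = ((∫ x, (∑ i, c x (y i) * p x i + ∑ i, w i * f₀ (p x i / w i)) ∂μ : ℝ) : EReal) := by
  set M := μ.prod (weightedDirac w y) with hM
  have hp01 : ∀ᵐ x ∂μ, ∀ i, p x i ∈ Icc (0 : ℝ) 1 := by
    filter_upwards [hp] with x hx i
    exact ⟨hx.1 i, hx.2 ▸ Finset.single_le_sum (fun i _ => hx.1 i) (Finset.mem_univ i)⟩
  have hcp : ∀ i, Integrable (fun x => c x (y i) * p x i) μ := fun i => by
    refine (hc_int i).mono' ((hc_int i).aestronglyMeasurable.mul (hp_meas i)) ?_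
    filter_upwards [hp01] with x hx
    rw [Real.norm_eq_abs, abs_of_nonneg (mul_nonneg (hc _ _) (hx i).1)]
    exact mul_le_of_le_one_right (hc _ _) (hx i).2
  have hfp : ∀ i, Integrable (fun x => f₀ (p x i / w i)) μ := fun i => by
    obtain ⟨B, hB⟩ := (isCompact_Icc (a := (0 : ℝ)) (b := 1)).exists_bound_of_continuousOn
      (f := fun t => f₀ (t / w i)) (by fun_prop)
    refine Integrable.of_bound ((show Continuous fun t => f₀ (t / w i) by
      fun_prop).comp_aestronglyMeasurable (hp_meas i)) B ?_
    filter_upwards [hp01] with x hx using hB _ (hx i)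
  have hfρ : ∀ i, (fun x => f ((π.rnDeriv M (x, y i)).toReal)) =ᵐ[μ] fun x => f₀ (p x i / w i) :=
    fun i => by
      filter_upwards [hρ i] with x hx
      rw [hff₀ _ ENNReal.toReal_nonneg, hx]
  have hfρ_int : ∀ i, Integrable (fun x => f ((π.rnDeriv M (x, y i)).toReal)) μ := fun i =>
    (hfp i).congr (hfρ i).symm
  have hcρ : ∀ i, (fun x => (π.rnDeriv M (x, y i)).toReal * c x (y i))
      =ᵐ[μ] fun x => (w i)⁻¹ * (c x (y i) * p x i) := fun i => by
    filter_upwards [hρ i] with x hx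
    rw [hx]
    ring
  have hcρ_int : ∀ i, Integrable (fun x => (π.rnDeriv M (x, y i)).toReal * c x (y i)) μ := fun i =>
    ((hcp i).const_mul _).congr (hcρ i).symm
  refine ⟨(integrable_finsetSum _ fun i _ => hcp i).add
    (integrable_finsetSum _ fun i _ => (hfp i).const_mul _), ?_⟩
  have h1 : ∫⁻ q, ENNReal.ofReal (c q.1 q.2) ∂π = ENNReal.ofReal (∑ i, ∫ x, c x (y i) * p x i ∂μ) := by
    have := lintegral_withDensity_prod_weightedDirac μ y hw (Measure.measurable_rnDeriv π M)
      (Measure.rnDeriv_lt_top π M) hc hcρ_int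
    rw [Measure.withDensity_rnDeriv_eq _ _ hπ] at this
    rw [this]
    congr 1
    refine Finset.sum_congr rfl fun i _ => ?_
    rw [integral_congr_ae (hcρ i), integral_const_mul, mul_inv_cancel_left₀ (hw i).ne']
  have h2 : ∫ z, f ((π.rnDeriv M z).toReal) ∂M = ∑ i, w i * ∫ x, f₀ (p x i / w i) ∂μ := by
    have := integral_prod_weightedDirac (h := fun z => f ((π.rnDeriv M z).toReal)) μ y
      (fun i => (hw i).le) hfρ_int
    rw [← hM] at this
    rw [this]
    exact Finset.sum_congr rfl fun i _ => by rw [integral_congr_ae (hfρ i)]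
  have h3 : 0 ≤ ∑ i, ∫ x, c x (y i) * p x i ∂μ := Finset.sum_nonneg fun i _ =>
    integral_nonneg_of_ae (by
      filter_upwards [hp01] with x hx using mul_nonneg (hc _ _) (hx i).1)
  rw [add_sub_assoc, coe_lintegral_sub_lintegral_neg
    (integrable_prod_weightedDirac (h := fun z => f ((π.rnDeriv M z).toReal)) μ w y hfρ_int), h1, h2,
    EReal.coe_ennreal_ofReal, max_eq_left h3, ← EReal.coe_add,
    integral_add (integrable_finsetSum _ fun i _ => hcp i)
      (integrable_finsetSum _ fun i _ => (hfp i).const_mul _),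
    integral_finsetSum _ fun i _ => hcp i, integral_finsetSum _ fun i _ => (hfp i).const_mul _]
  simp_rw [integral_const_mul]

variable {y}

/-- The conditional probabilities of a plan with marginals `μ` and `∑ᵢ νᵢ δ_{yᵢ}`. -/
theorem exists_conditional_of_marginals (hy : Function.Injective y) (hw : ∀ i, 0 < w i)
    {ν : ι → ℝ} (hν : ∀ i, 0 < ν i) {π : Measure (α × β)} [IsFiniteMeasure π]
    (hfst : π.map Prod.fst = μ) (hsnd : π.map Prod.snd = weightedDirac ν y)
    (hπ : π ≪ μ.prod (weightedDirac w y)) :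
    ∃ p : α → ι → ℝ, (∀ i, Measurable fun x => p x i) ∧ (∀ᵐ x ∂μ, p x ∈ stdSimplex ℝ ι) ∧
      (∀ i, ∫ x, p x i ∂μ = ν i) ∧
      ∀ i, ∀ᵐ x ∂μ, (π.rnDeriv (μ.prod (weightedDirac w y)) (x, y i)).toReal = p x i / w i := by
  classical
  set M := μ.prod (weightedDirac w y) with hM
  set ρ := π.rnDeriv M with hρ
  have hρm : Measurable ρ := Measure.measurable_rnDeriv π M
  have hρi : ∀ i, Measurable fun x => ρ (x, y i) := fun i => hρm.comp measurable_prodMk_right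
  have hπρ : ∀ s, MeasurableSet s →
      π s = ∑ i, ENNReal.ofReal (w i) * ∫⁻ x, s.indicator ρ (x, y i) ∂μ := by
    intro s hs
    conv_lhs => rw [← Measure.withDensity_rnDeriv_eq _ _ hπ]
    rw [withDensity_apply _ hs, ← lintegral_indicator hs, hM, lintegral_prod_weightedDirac]
  have htop : ∀ i, ∀ᵐ x ∂μ, ρ (x, y i) < ∞ :=
    (ae_prod_weightedDirac_iff μ y hw).1 (Measure.rnDeriv_lt_top π M)
  have hsum : (fun x => ∑ i, ENNReal.ofReal (w i) * ρ (x, y i)) =ᵐ[μ] fun _ => 1 := by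
    have hmeas : Measurable fun x => ∑ i, ENNReal.ofReal (w i) * ρ (x, y i) :=
      Finset.measurable_fun_sum _ fun i _ => (hρi i).const_mul _
    have heq : μ.withDensity (fun x => ∑ i, ENNReal.ofReal (w i) * ρ (x, y i)) = μ := by
      ext s hs
      conv_rhs => rw [← hfst]
      rw [Measure.map_apply measurable_fst hs, hπρ _ (measurable_fst hs), withDensity_apply _ hs,
        lintegral_finsetSum _ fun i _ => (hρi i).const_mul _]
      refine Finset.sum_congr rfl fun i _ => ?_
      rw [lintegral_const_mul _ (hρi i), ← lintegral_indicator hs]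
      rfl
    refine (withDensity_eq_iff_of_sigmaFinite hmeas.aemeasurable aemeasurable_const).1 ?_
    rw [heq]
    exact withDensity_one.symm
  refine ⟨fun x i => w i * (ρ (x, y i)).toReal, fun i => (hρi i).ennreal_toReal.const_mul _, ?_,
    fun i => ?_, fun i => Filter.Eventually.of_forall fun x => ?_⟩
  · filter_upwards [hsum, Filter.eventually_all.2 htop] with x hx ht
    refine ⟨fun i => mul_nonneg (hw i).le ENNReal.toReal_nonneg, ?_⟩
    have := congrArg ENNReal.toReal hx
    rw [ENNReal.toReal_sum fun i _ => ENNReal.mul_ne_top ENNReal.ofReal_ne_top (ht i).ne] at this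
    simpa [ENNReal.toReal_mul, ENNReal.toReal_ofReal (hw _).le] using this
  · have h1 : π (Prod.snd ⁻¹' {y i}) = ENNReal.ofReal (ν i) := by
      rw [← Measure.map_apply measurable_snd (measurableSet_singleton _), hsnd, weightedDirac,
        Measure.finsetSum_apply, Finset.sum_eq_single i]
      · simp
      · intro j _ hj
        simp [hy.ne hj]
      · simp
    rw [hπρ _ (measurable_snd (measurableSet_singleton _)), Finset.sum_eq_single i] at h1
    · have h2 : ∀ x, (Prod.snd ⁻¹' {y i}).indicator ρ (x, y i) = ρ (x, y i) := fun x =>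
        indicator_of_mem (by simp) _
      simp_rw [h2] at h1
      rw [integral_const_mul, integral_toReal (hρi i).aemeasurable (htop i),
        ← ENNReal.toReal_ofReal (hw i).le, ← ENNReal.toReal_mul, h1,
        ENNReal.toReal_ofReal (hν i).le]
    · intro j _ hj
      have h2 : ∀ x, (Prod.snd ⁻¹' {y i}).indicator ρ (x, y j) = 0 := fun x =>
        indicator_of_notMem (by simpa using hy.ne hj) _
      simp [h2]
    · simp
  · rw [mul_div_cancel_left₀ _ (hw i).ne']

/-- A plan with prescribed conditional probabilities. -/
theorem exists_plan_of_conditional (hy : Function.Injective y) (hw : ∀ i, 0 < w i) {ν : ι → ℝ}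
    {p : α → ι → ℝ} (hpm : ∀ i, Measurable fun x => p x i) (hp : ∀ x, p x ∈ stdSimplex ℝ ι)
    (hpν : ∀ i, ∫ x, p x i ∂μ = ν i) :
    ∃ π : Measure (α × β), IsProbabilityMeasure π ∧ π.map Prod.fst = μ ∧
      π.map Prod.snd = weightedDirac ν y ∧ π ≪ μ.prod (weightedDirac w y) ∧
      ∀ i, ∀ᵐ x ∂μ, (π.rnDeriv (μ.prod (weightedDirac w y)) (x, y i)).toReal = p x i / w i := by
  classical
  set M := μ.prod (weightedDirac w y) with hM
  set ρ : α × β → ℝ≥0∞ := fun z => ∑ i, if z.2 = y i then ENNReal.ofReal (p z.1 i / w i) else 0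
    with hρ
  have hρm : Measurable ρ := Finset.measurable_fun_sum _ fun i _ =>
    Measurable.ite (measurable_snd (measurableSet_singleton (y i)))
      (((hpm i).comp measurable_fst).div_const _).ennreal_ofReal measurable_const
  have hρi : ∀ x i, ρ (x, y i) = ENNReal.ofReal (p x i / w i) := by
    intro x i
    simp only [hρ, hy.eq_iff]
    simp
  have hwρ : ∀ x i, ENNReal.ofReal (w i) * ρ (x, y i) = ENNReal.ofReal (p x i) := by
    intro x i
    rw [hρi, ← ENNReal.ofReal_mul (hw i).le, mul_div_cancel₀ _ (hw i).ne']
  have hπρ : ∀ s, MeasurableSet s → M.withDensity ρ s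
      = ∑ i, ENNReal.ofReal (w i) * ∫⁻ x, s.indicator ρ (x, y i) ∂μ := by
    intro s hs
    rw [withDensity_apply _ hs, ← lintegral_indicator hs, hM, lintegral_prod_weightedDirac]
  have hρim : ∀ i, Measurable fun x => ρ (x, y i) := fun i => hρm.comp measurable_prodMk_right
  have hfst : (M.withDensity ρ).map Prod.fst = μ := by
    ext s hs
    rw [Measure.map_apply measurable_fst hs, hπρ _ (measurable_fst hs)]
    have h1 : ∀ i, ENNReal.ofReal (w i) * ∫⁻ x, (Prod.fst ⁻¹' s).indicator ρ (x, y i) ∂μ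
        = ∫⁻ x in s, ENNReal.ofReal (p x i) ∂μ := fun i => by
      simp_rw [← hwρ]
      rw [lintegral_const_mul _ (hρim i), ← lintegral_indicator hs]
      rfl
    simp_rw [h1]
    rw [← lintegral_finsetSum _ fun i _ => (hpm i).ennreal_ofReal]
    have h2 : ∀ x, ∑ i, ENNReal.ofReal (p x i) = 1 := fun x => by
      rw [← ENNReal.ofReal_sum_of_nonneg fun i _ => (hp x).1 i, (hp x).2, ENNReal.ofReal_one]
    simp [h2]
  refine ⟨M.withDensity ρ, ⟨?_⟩, hfst, ?_, withDensity_absolutelyContinuous _ _, ?_⟩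
  · rw [← preimage_univ (f := Prod.fst), ← Measure.map_apply measurable_fst MeasurableSet.univ, hfst,
      measure_univ]
  · ext s hs
    rw [Measure.map_apply measurable_snd hs, hπρ _ (measurable_snd hs), weightedDirac,
      Measure.finsetSum_apply]
    refine Finset.sum_congr rfl fun i _ => ?_
    rw [Measure.smul_apply, Measure.dirac_apply, smul_eq_mul]
    by_cases hi : y i ∈ s
    · have h1 : ∀ x, (Prod.snd ⁻¹' s).indicator ρ (x, y i) = ρ (x, y i) := fun x =>
        indicator_of_mem (show (x, y i) ∈ Prod.snd ⁻¹' s from hi) _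
      have h2 : Integrable (fun x => p x i) μ :=
        Integrable.of_bound (hpm i).aestronglyMeasurable 1 (Filter.Eventually.of_forall fun x => by
          rw [Real.norm_eq_abs, abs_of_nonneg ((hp x).1 i), ← (hp x).2]
          exact Finset.single_le_sum (fun i _ => (hp x).1 i) (Finset.mem_univ i))
      simp_rw [h1]
      rw [← lintegral_const_mul _ (hρim i)]
      simp_rw [hwρ]
      rw [← ofReal_integral_eq_lintegral_ofReal h2
        (Filter.Eventually.of_forall fun x => (hp x).1 i), hpν, indicator_of_mem hi, Pi.one_apply,
        mul_one]
    · have h1 : ∀ x, (Prod.snd ⁻¹' s).indicator ρ (x, y i) = 0 := fun x =>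
        indicator_of_notMem (show (x, y i) ∉ Prod.snd ⁻¹' s from hi) _
      simp_rw [h1]
      simp [hi]
  · intro i
    have h := (ae_prod_weightedDirac_iff μ y hw).1 (Measure.rnDeriv_withDensity M hρm) i
    filter_upwards [h] with x hx
    rw [hx, hρi, ENNReal.toReal_ofReal (div_nonneg ((hp x).1 i) (hw i).le)]

end DiscreteProduct

/-- Fréchet regularization (Theorem 3.6 of the paper): for marginal ambiguity sets with
marginals `Fᵢ(s) = min{1, max{0, 1 − ηᵢ F(−s)}}` generated by a strictly increasing
continuous bijection `F` of `ℝ` onto `(0,∞)` with `∫₀¹ F⁻¹ = 0`, the smooth dual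
semi-discrete optimal transport problem equals the primal optimal transport problem
regularized by the `f`-divergence with `f(s) = ∫₀^s F⁻¹(t) dt`. -/
theorem stmt_7
    (m k N : ℕ) (hN : 1 ≤ N)
    (X : Set (EuclideanSpace ℝ (Fin m))) (hX : IsClosed X)
    (μ : Measure (EuclideanSpace ℝ (Fin m))) (hμ : IsProbabilityMeasure μ)
    (hμX : μ Xᶜ = 0)
    (y : Fin N → EuclideanSpace ℝ (Fin k)) (hy : Function.Injective y)
    (ν η : Fin N → ℝ)
    (hν_pos : ∀ i, 0 < ν i) (hν_sum : ∑ i, ν i = 1)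
    (hη_pos : ∀ i, 0 < η i) (hη_sum : ∑ i, η i = 1)
    (c : EuclideanSpace ℝ (Fin m) → EuclideanSpace ℝ (Fin k) → ℝ)
    (hc_nonneg : ∀ x y', 0 ≤ c x y')
    (hc_lsc : ∀ i, LowerSemicontinuous fun x => c x (y i))
    (hc_int : ∀ i, Integrable (fun x => c x (y i)) μ)
    (F : ℝ → ℝ) (hF_cont : Continuous F) (hF_mono : StrictMono F)
    (hF_pos : ∀ s, 0 < F s) (hF_surj : ∀ r : ℝ, 0 < r → ∃ s, F s = r)
    (Finv : ℝ → ℝ)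
    (hFinv_left : ∀ s, Finv (F s) = s)
    (hFinv_right : ∀ r : ℝ, 0 < r → F (Finv r) = r)
    (hFinv_int : IntegrableOn Finv (Ioo 0 1) volume)
    (hFinv_zero : ∫ t in (0 : ℝ)..1, Finv t = 0)
    (Fi : Fin N → ℝ → ℝ)
    (hFi : ∀ i s, Fi i s = min 1 (max 0 (1 - η i * F (-s))))
    (Fiinv : Fin N → ℝ → ℝ)
    (hFiinv : ∀ i t, Fiinv i t = sInf {s : ℝ | t ≤ Fi i s})
    (f : ℝ → ℝ) (hf : ∀ s, f s = ∫ t in (0 : ℝ)..s, Finv t)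
    (Δ : Set (Fin N → ℝ)) (hΔ : Δ = {p | (∀ i, 0 ≤ p i) ∧ ∑ i, p i = 1})
    (ψ : (Fin N → ℝ) → EuclideanSpace ℝ (Fin m) → ℝ)
    (hψ : ∀ φ x, ψ φ x = sSup ((fun p : Fin N → ℝ =>
      ∑ i, (φ i - c x (y i)) * p i + ∑ i, ∫ t in (1 - p i)..1, Fiinv i t) '' Δ))
    (Mν Mη : Measure (EuclideanSpace ℝ (Fin k)))
    (hMν : Mν = ∑ i, ENNReal.ofReal (ν i) • Measure.dirac (y i))
    (hMη : Mη = ∑ i, ENNReal.ofReal (η i) • Measure.dirac (y i))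
    (S : Set (Measure (EuclideanSpace ℝ (Fin m) × EuclideanSpace ℝ (Fin k))))
    (hS : S = {π | IsProbabilityMeasure π ∧ π.map Prod.fst = μ ∧
        π.map Prod.snd = Mν ∧ π ≪ μ.prod Mη})
    (Pr : Measure (EuclideanSpace ℝ (Fin m) × EuclideanSpace ℝ (Fin k)) → EReal)
    (hPr : ∀ π, Pr π = ((∫⁻ q, ENNReal.ofReal (c q.1 q.2) ∂π : ℝ≥0∞) : EReal)
      + ((∫⁻ z, ENNReal.ofReal (f ((π.rnDeriv (μ.prod Mη) z).toReal))
            ∂(μ.prod Mη) : ℝ≥0∞) : EReal)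
      - ((∫⁻ z, ENNReal.ofReal (-f ((π.rnDeriv (μ.prod Mη) z).toReal))
            ∂(μ.prod Mη) : ℝ≥0∞) : EReal)) :
    (⨆ φ : Fin N → ℝ,
        ((∫ x, (∑ i, ν i * φ i - ψ φ x) ∂μ : ℝ) : EReal)) = ⨅ π ∈ S, Pr π := by
  have : Nonempty (Fin N) := ⟨⟨0, hN⟩⟩
  have hΔ' : Δ = stdSimplex ℝ (Fin N) := hΔ
  have hcont := continuousOn_of_inverse hF_mono hF_pos hFinv_left hFinv_right
  have hint := integrableOn_Ioc_of_continuousOn_Ioi hcont hFinv_int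
  set f₀ : ℝ → ℝ := fun s => ∫ t in (0 : ℝ)..(max s 0), Finv t with hf₀
  have hf₀c : Continuous f₀ := continuous_integral_max_zero hint
  have hff₀ : ∀ s, 0 ≤ s → f s = f₀ s := fun s hs => by simp only [hf, hf₀, max_eq_left hs]
  have hfs : StrictConvexOn ℝ (Ici 0) f₀ :=
    (strictConvexOn_integral hcont (strictMonoOn_of_rightInverse hF_mono hFinv_right) hint).congr
      fun s hs => by rw [← hff₀ s hs, hf]
  set g : (Fin N → ℝ) → ℝ := fun p => ∑ i, η i * f₀ (p i / η i) with hg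
  have hgc : Continuous g := by fun_prop
  have hgs : StrictConvexOn ℝ (stdSimplex ℝ (Fin N)) g := strictConvexOn_sum_mul_div hη_pos hfs
  set C : EuclideanSpace ℝ (Fin m) → Fin N → ℝ := fun x i => c x (y i) with hC
  have hCm : Measurable C := measurable_pi_lambda _ fun i => (hc_lsc i).measurable
  have hψ' : ∀ φ x, ψ φ x = simplexConjugate g (φ - C x) := by
    intro φ x
    rw [hψ, simplexConjugate, hΔ']
    congr 1
    refine image_congr fun p hp => ?_
    simp only [hg, Pi.sub_apply, hC, sub_eq_add_neg, ← Finset.sum_neg_distrib]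
    congr 1
    refine Finset.sum_congr rfl fun i _ => ?_
    have hp1 : p i ≤ 1 :=
      hp.2 ▸ Finset.single_le_sum (fun i _ => hp.1 i) (Finset.mem_univ i)
    rw [← hff₀ _ (div_nonneg (hp.1 i) (hη_pos i).le), hf, ← sub_eq_add_neg]
    refine integral_quantile_eq (hη_pos i) (hp.1 i) hp1 fun t ht0 ht1 => ?_
    rw [hFiinv, ← sInf_clipped_eq hF_mono hFinv_right (hη_pos i) ht0 ht1]
    simp only [hFi]
  have hdual : ∀ φ, ∫ x, (∑ i, ν i * φ i - ψ φ x) ∂μ = semiDual μ g C ν φ := by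
    intro φ
    simp_rw [hψ']
    rw [integral_sub (integrable_const _) (integrable_simplexConjugate_sub hgc hc_int φ)]
    rw [integral_const, probReal_univ, one_smul]
    rfl
  simp_rw [hdual]
  have hMν' : Mν = weightedDirac ν y := hMν
  have hMη' : Mη = weightedDirac η y := hMη
  subst hMν' hMη' hS
  have hsum_int : ∀ {p : EuclideanSpace ℝ (Fin m) → Fin N → ℝ} (φ : Fin N → ℝ),
      (∀ i, ∫ x, p x i ∂μ = ν i) →
      Integrable (fun x => ∑ i, φ i * p x i) μ ∧
        ∫ x, ∑ i, φ i * p x i ∂μ = ∑ i, ν i * φ i := by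
    intro p φ hpν
    have hpi : ∀ i, Integrable (fun x => p x i) μ := fun i =>
      Integrable.of_integral_ne_zero (by rw [hpν]; exact (hν_pos i).ne')
    refine ⟨integrable_finsetSum _ fun i _ => (hpi i).const_mul _, ?_⟩
    rw [integral_finsetSum _ fun i _ => (hpi i).const_mul _]
    exact Finset.sum_congr rfl fun i _ => by rw [integral_const_mul, hpν, mul_comm]
  have hsplit : ∀ (φ p : Fin N → ℝ) x, ∑ i, (φ - C x) i * p i - g p
      = ∑ i, φ i * p i - (∑ i, c x (y i) * p i + ∑ i, η i * f₀ (p i / η i)) := by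
    intro φ p x
    simp only [Pi.sub_apply, sub_mul, Finset.sum_sub_distrib, hg, hC]
    ring
  apply le_antisymm
  · refine iSup_le fun φ => le_iInf₂ fun π hπ => ?_
    obtain ⟨hπ_prob, hfst, hsnd, hac⟩ := hπ
    obtain ⟨p, hpm, hp, hpν, hρ⟩ := exists_conditional_of_marginals μ hy hη_pos hν_pos hfst hsnd hac
    obtain ⟨hcost_int, hcost⟩ := regularizedCost_eq_s7 μ y hη_pos hc_nonneg hc_int hf₀c hff₀ hac
      (fun i => (hpm i).aestronglyMeasurable) hp hρ
    rw [hPr, hcost, EReal.coe_le_coe_iff, semiDual]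
    obtain ⟨h1, h2⟩ := hsum_int φ hpν
    rw [← h2, sub_le_iff_le_add, ← sub_le_iff_le_add', ← integral_sub h1 hcost_int]
    refine integral_mono_ae (h1.sub hcost_int) (integrable_simplexConjugate_sub hgc hc_int φ) ?_
    filter_upwards [hp] with x hx
    exact (hsplit φ (p x) x).symm.trans_le (le_simplexConjugate hgc (φ - C x) hx)
  · obtain ⟨φ, hφ⟩ := exists_forall_semiDual_le (μ := μ) hgc hc_int hν_pos hν_sum
    obtain ⟨P, hPc, hP, hPu⟩ := exists_continuous_argmax hgc hgs
    have hpν := integral_argmax_eq hgc hc_int hφ hPc hP hPu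
    have hpm : ∀ i, Measurable fun x => P (φ - C x) i := fun i =>
      (measurable_pi_apply i).comp (hPc.measurable.comp (hCm.const_sub φ))
    obtain ⟨π, hπ_prob, hfst, hsnd, hac, hρ⟩ :=
      exists_plan_of_conditional μ hy hη_pos hpm (fun x => hP _) hpν
    obtain ⟨hcost_int, hcost⟩ := regularizedCost_eq_s7 μ y hη_pos hc_nonneg hc_int hf₀c hff₀ hac
      (fun i => (hpm i).aestronglyMeasurable) (Filter.Eventually.of_forall fun x => hP _) hρ
    refine (iInf₂_le π ⟨hπ_prob, hfst, hsnd, hac⟩).trans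
      (le_trans ?_ (le_iSup (fun φ => ((semiDual μ g C ν φ : ℝ) : EReal)) φ))
    obtain ⟨h1, h2⟩ := hsum_int φ hpν
    rw [hPr, hcost, EReal.coe_le_coe_iff, semiDual, ← h2,
      ← integral_sub h1 (integrable_simplexConjugate_sub hgc hc_int φ)]
    refine integral_mono hcost_int (h1.sub (integrable_simplexConjugate_sub hgc hc_int φ)) fun x => ?_
    have := hPu (φ - C x)
    rw [hsplit] at this
    simp only
    linarith
end
end

section
/- Let F : ℝ → (0,∞) be a continuous, strictly increasing bijection onto (0,∞) with inverse F^{-1} : (0,∞) → ℝ, let η ∈ (0,1], and define F_η : ℝ → [0,1] by F_η(s) = min{1, max{0, 1 − η F(−s)}}, with quantile function F_η^{-1}(t) = inf{s ∈ ℝ : F_η(s) ≥ t}. Then: (a) F_η^{-1}(t) = −F^{-1}((1−t)/η) for every t ∈ (0,1); and (b) if additionally ∫_0^1 |F^{-1}(t)| dt < ∞, then for every s ∈ [0, 1/η], ∫_0^s F^{-1}(t) dt = −(1/η) ∫_{1−sη}^1 F_η^{-1}(z) dz. -/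
open MeasureTheory Set
open scoped ENNReal

noncomputable section

/-- Quantile identities for the marginal distribution functions
`F_η(s) = min{1, max{0, 1 − η F(−s)}}` generated by a marginal generating function `F`:
(a) `F_η⁻¹(t) = −F⁻¹((1−t)/η)` on `(0,1)`, and
(b) `∫₀^s F⁻¹ = −(1/η) ∫_{1−sη}^1 F_η⁻¹` for `s ∈ [0, 1/η]`. -/
theorem stmt_8
    (F : ℝ → ℝ) (hF_cont : Continuous F) (hF_mono : StrictMono F)
    (hF_pos : ∀ s, 0 < F s) (hF_surj : ∀ r : ℝ, 0 < r → ∃ s, F s = r)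
    (Finv : ℝ → ℝ)
    (hFinv_left : ∀ s, Finv (F s) = s)
    (hFinv_right : ∀ r : ℝ, 0 < r → F (Finv r) = r)
    (η : ℝ) (hη : η ∈ Ioc (0 : ℝ) 1)
    (Fη : ℝ → ℝ) (hFη : ∀ s, Fη s = min 1 (max 0 (1 - η * F (-s))))
    (Fηinv : ℝ → ℝ) (hFηinv : ∀ t, Fηinv t = sInf {s : ℝ | t ≤ Fη s}) :
    (∀ t ∈ Ioo (0 : ℝ) 1, Fηinv t = -Finv ((1 - t) / η)) ∧
    (IntegrableOn Finv (Ioo 0 1) volume →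
      ∀ s ∈ Icc (0 : ℝ) (1 / η),
        ∫ t in (0 : ℝ)..s, Finv t = -(1 / η) * ∫ z in (1 - s * η)..1, Fηinv z) := by
  obtain ⟨hη0, -⟩ := hη
  have quantile : ∀ t ∈ Ioo (0 : ℝ) 1, Fηinv t = -Finv ((1 - t) / η) := by
    rintro t ⟨ht0, ht1⟩
    have hpos : 0 < (1 - t) / η := div_pos (by linarith) hη0
    have hset : {s : ℝ | t ≤ Fη s} = Ici (-Finv ((1 - t) / η)) := by
      ext s
      rw [mem_ofPred_eq, mem_Ici, neg_le, ← hF_mono.le_iff_le (a := -s), hFinv_right _ hpos,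
        le_div_iff₀ hη0, hFη, le_min_iff, le_max_iff]
      constructor
      · rintro ⟨-, h | h⟩ <;> linarith
      · intro h
        exact ⟨ht1.le, Or.inr (by linarith)⟩
    rw [hFηinv, hset, csInf_Ici]
  refine ⟨quantile, fun _ s hs => ?_⟩
  have hsη : s * η ≤ 1 := (le_div_iff₀ hη0).mp hs.2
  have hsη0 : 0 ≤ s * η := mul_nonneg hs.1 hη0.le
  have hcongr : ∫ z in (1 - s * η)..1, Fηinv z
      = ∫ z in (1 - s * η)..1, -Finv (1 / η - z / η) := by
    rw [intervalIntegral.integral_of_le (by linarith),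
      intervalIntegral.integral_of_le (by linarith),
      integral_Ioc_eq_integral_Ioo, integral_Ioc_eq_integral_Ioo]
    refine setIntegral_congr_fun measurableSet_Ioo fun z hz => ?_
    have hz0 : 0 < z := by linarith [hz.1]
    simp only [quantile z ⟨hz0, hz.2⟩, sub_div]
  have hlim : 1 / η - (1 - s * η) / η = s := by
    field_simp
    ring
  rw [hcongr, intervalIntegral.integral_neg,
    intervalIntegral.integral_comp_sub_div Finv hη0.ne', sub_self, hlim, smul_eq_mul]
  field_simp
end
end

section
/- In the smooth c-transform setup, the function ψ̄ is convex and differentiable on ℝ^N; for each φ ∈ ℝ^N the maximum defining ψ̄(φ) is attained at a unique point p*(φ) ∈ Δ^N, the gradient satisfies ∇ψ̄(φ) = p*(φ), and consequently ‖∇ψ̄(φ)‖ ≤ 1 for all φ ∈ ℝ^N. -/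
open MeasureTheory Set Filter

noncomputable section

/-- The function `x ↦ max_{q ∈ K} ⟪x, q⟫ + G q` over a compact set `K` is differentiable
wherever the maximizer is unique, and its gradient is that maximizer. -/
theorem hasGradientAt_of_unique_isMaxOn {E : Type*} [NormedAddCommGroup E]
    [InnerProductSpace ℝ E] [CompleteSpace E] {K : Set E} (hK : IsCompact K) {G : E → ℝ}
    (hG : ContinuousOn G K) {ψ : E → ℝ} (hle : ∀ x, ∀ p ∈ K, inner ℝ x p + G p ≤ ψ x)
    (hattain : ∀ x, ∃ p ∈ K, inner ℝ x p + G p = ψ x) {φ p : E} (hp : p ∈ K)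
    (hpφ : inner ℝ φ p + G p = ψ φ)
    (huniq : ∀ q ∈ K, inner ℝ φ q + G q = ψ φ → q = p) :
    HasGradientAt ψ p φ := by
  obtain ⟨R, hRpos, hR⟩ := hK.isBounded.exists_pos_norm_le
  rw [hasGradientAt_iff_isLittleO, Asymptotics.isLittleO_iff]
  intro ε hε
  have hKε : IsCompact (K \ Metric.ball p ε) := hK.diff Metric.isOpen_ball
  have hcont : ContinuousOn (fun q => inner ℝ φ q + G q) (K \ Metric.ball p ε) :=
    (by fun_prop : Continuous fun q => inner ℝ φ q).continuousOn.add (hG.mono sdiff_subset)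
  obtain ⟨δ, hδ, hgap⟩ : ∃ δ > 0, ∀ q ∈ K \ Metric.ball p ε,
      inner ℝ φ q + G q ≤ ψ φ - δ := by
    rcases (K \ Metric.ball p ε).eq_empty_or_nonempty with hemp | hne
    · exact ⟨1, one_pos, by simp [hemp]⟩
    · obtain ⟨q, hq, hmax⟩ := hKε.exists_isMaxOn hne hcont
      have hlt : inner ℝ φ q + G q < ψ φ := by
        refine lt_of_le_of_ne (hle φ q hq.1) fun h => hq.2 ?_
        rw [huniq q hq.1 h]
        exact Metric.mem_ball_self hε
      refine ⟨ψ φ - (inner ℝ φ q + G q), by linarith, fun r hr => ?_⟩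
      have := hmax hr
      simp only [mem_ofPred_eq] at this
      linarith
  have hr : 0 < δ / (2 * R) := by positivity
  filter_upwards [Metric.ball_mem_nhds φ hr] with x hx
  rw [Metric.mem_ball, dist_eq_norm, lt_div_iff₀ (by positivity)] at hx
  obtain ⟨q, hq, hqx⟩ := hattain x
  have hlower := hle x p hp
  have hupper := hle φ q hq
  have hcs := real_inner_le_norm (x - φ) (q - p)
  have hinner : inner ℝ (x - φ) (q - p)
      = inner ℝ x q - inner ℝ φ q - (inner ℝ x p - inner ℝ φ p) := by
    simp only [inner_sub_left, inner_sub_right]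
  have hcomm : inner ℝ p (x - φ) = inner ℝ x p - inner ℝ φ p := by
    rw [real_inner_comm, inner_sub_left]
  have hdist : ‖q - p‖ < ε := by
    by_contra hfar
    have hgapq := hgap q ⟨hq, by rwa [Metric.mem_ball, dist_eq_norm]⟩
    have hdiam : ‖q - p‖ ≤ 2 * R := by
      linarith [norm_sub_le q p, hR q hq, hR p hp]
    have := mul_le_mul_of_nonneg_left hdiam (norm_nonneg (x - φ))
    linarith
  have hbound := mul_le_mul_of_nonneg_left hdist.le (norm_nonneg (x - φ))
  rw [hcomm, Real.norm_eq_abs, abs_of_nonneg (by linarith)]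
  linarith

/-- The quantile function of a continuous distribution function is strictly increasing. -/
theorem strictMonoOn_sInf_le_of_continuous {F : ℝ → ℝ} (hcont : Continuous F)
    (hmono : Monotone F) (hbot : Tendsto F atBot (nhds 0)) (htop : Tendsto F atTop (nhds 1)) :
    StrictMonoOn (fun t => sInf {s : ℝ | t ≤ F s}) (Ioo 0 1) := by
  have hF : ∀ t ∈ Ioo (0 : ℝ) 1, F (sInf {s : ℝ | t ≤ F s}) = t := by
    intro t ht
    obtain ⟨a, ha⟩ := (hbot.eventually (gt_mem_nhds ht.1)).exists
    obtain ⟨b, hb⟩ := (htop.eventually (lt_mem_nhds ht.2)).exists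
    obtain ⟨s, hs⟩ := mem_range_of_exists_le_of_exists_ge hcont ⟨a, ha.le⟩ ⟨b, hb.le⟩
    have hbdd : BddBelow {s : ℝ | t ≤ F s} :=
      ⟨a, fun r hr => (hmono.reflect_lt (ha.trans_le hr)).le⟩
    refine le_antisymm ?_ ((isClosed_le continuous_const hcont).csInf_mem ⟨s, hs.ge⟩ hbdd)
    exact (hmono (csInf_le hbdd hs.ge)).trans hs.le
  intro t ht u hu htu
  apply hmono.reflect_lt
  rwa [hF t ht, hF u hu]

/-- The upper tail integral of a strictly increasing function is strictly concave. -/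
theorem tail_integral_add_lt_two_mul_midpoint {g : ℝ → ℝ} (hg : StrictMonoOn g (Ioo 0 1))
    (hintegrable : IntervalIntegrable g volume 0 1) {p q : ℝ} (hp : 0 ≤ p) (hpq : p < q) (hq : q ≤ 1) :
    (∫ t in (1 - p)..1, g t) + ∫ t in (1 - q)..1, g t
      < 2 * ∫ t in (1 - (p + q) / 2)..1, g t := by
  have hsub : ∀ {a b : ℝ}, a ∈ Icc (0 : ℝ) 1 → b ∈ Icc (0 : ℝ) 1 →
      IntervalIntegrable g volume a b := fun ha hb =>
    hintegrable.mono_set (by rw [uIcc_of_le zero_le_one]; exact ordConnected_Icc.uIcc_subset ha hb)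
  have h1 : (1 : ℝ) ∈ Icc (0 : ℝ) 1 := by simp
  have ha : 1 - q ∈ Icc (0 : ℝ) 1 := ⟨by linarith, by linarith⟩
  have hb : 1 - (p + q) / 2 ∈ Icc (0 : ℝ) 1 := ⟨by linarith, by linarith⟩
  have hd : 1 - p ∈ Icc (0 : ℝ) 1 := ⟨by linarith, by linarith⟩
  have e1 := intervalIntegral.integral_add_adjacent_intervals (hsub ha hb) (hsub hb h1)
  have e2 := intervalIntegral.integral_add_adjacent_intervals (hsub hb hd) (hsub hd h1)
  have hshift : IntervalIntegrable (fun t => g (t + (q - p) / 2)) volume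
      (1 - q) (1 - (p + q) / 2) := by
    have := (hsub hb hd).comp_add_right ((q - p) / 2)
    convert this using 1 <;> ring
  have hpos := intervalIntegral.intervalIntegral_pos_of_pos_on
    (hshift.sub (hsub ha hb)) (fun t ht => sub_pos.2 (hg
      (a := t) (b := t + (q - p) / 2)
      ⟨by linarith [ht.1, ht.2], by linarith [ht.1, ht.2]⟩
      ⟨by linarith [ht.1, ht.2], by linarith [ht.1, ht.2]⟩ (by linarith))) (by linarith)
  rw [intervalIntegral.integral_sub hshift (hsub ha hb),
    intervalIntegral.integral_comp_add_right (fun t => g t)] at hpos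
  rw [show 1 - q + (q - p) / 2 = 1 - (p + q) / 2 by ring,
    show 1 - (p + q) / 2 + (q - p) / 2 = 1 - p by ring] at hpos
  linarith

/-- Smooth `c`-transform for marginal ambiguity sets: `ψ̄` is convex and differentiable,
its defining maximum is attained at a unique point of the simplex, and its gradient is
that maximizer (hence has norm at most 1). -/
theorem stmt_15
    (N : ℕ) (hN : 2 ≤ N)
    (c : Fin N → ℝ)
    (F : Fin N → ℝ → ℝ)
    (hF_cont : ∀ i, Continuous (F i)) (hF_mono : ∀ i, Monotone (F i))
    (hF_range : ∀ i s, F i s ∈ Icc (0 : ℝ) 1)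
    (hF_bot : ∀ i, Tendsto (F i) atBot (nhds 0))
    (hF_top : ∀ i, Tendsto (F i) atTop (nhds 1))
    (Finv : Fin N → ℝ → ℝ)
    (hFinv : ∀ i t, Finv i t = sInf {s : ℝ | t ≤ F i s})
    (hmoment : ∀ i, IntegrableOn (Finv i) (Ioo 0 1) volume)
    (Δ : Set (EuclideanSpace ℝ (Fin N)))
    (hΔ : Δ = {p : EuclideanSpace ℝ (Fin N) | (∀ i, 0 ≤ p i) ∧ ∑ i, p i = 1})
    (obj : EuclideanSpace ℝ (Fin N) → EuclideanSpace ℝ (Fin N) → ℝ)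
    (hobj : ∀ φ p, obj φ p =
      ∑ i, (φ i - c i) * p i + ∑ i, ∫ t in (1 - p i)..1, Finv i t)
    (ψ : EuclideanSpace ℝ (Fin N) → ℝ)
    (hψ : ∀ φ, ψ φ = sSup (obj φ '' Δ)) :
    ConvexOn ℝ Set.univ ψ ∧ Differentiable ℝ ψ ∧
    (∀ φ, ∃ pstar ∈ Δ, obj φ pstar = ψ φ ∧
      (∀ p ∈ Δ, obj φ p = ψ φ → p = pstar) ∧
      gradient ψ φ = pstar) ∧
    (∀ φ, ‖gradient ψ φ‖ ≤ 1) := by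
  have hintegrable : ∀ i, IntervalIntegrable (Finv i) volume 0 1 := fun i =>
    (intervalIntegrable_iff_integrableOn_Ioo_of_le zero_le_one).2 (hmoment i)
  have hstrict : ∀ i, StrictMonoOn (Finv i) (Ioo 0 1) := fun i => by
    rw [show Finv i = fun t => sInf {s : ℝ | t ≤ F i s} from funext (hFinv i)]
    exact strictMonoOn_sInf_le_of_continuous (hF_cont i) (hF_mono i) (hF_bot i) (hF_top i)
  have hmem : ∀ p, p ∈ Δ ↔ (∀ i, 0 ≤ p i) ∧ ∑ i, p i = 1 := fun p => by rw [hΔ]; rfl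
  have hle_one : ∀ p ∈ Δ, ∀ i, p i ≤ 1 := fun p hp i => by
    rw [hmem] at hp
    rw [← hp.2]
    exact Finset.single_le_sum (fun j _ => hp.1 j) (Finset.mem_univ i)
  have hnorm : ∀ p ∈ Δ, ‖p‖ ≤ 1 := fun p hp => by
    rw [EuclideanSpace.norm_eq, Real.sqrt_le_iff, one_pow, ← ((hmem p).1 hp).2]
    refine ⟨((hmem p).1 hp).2 ▸ zero_le_one, ?_⟩
    refine Finset.sum_le_sum fun i _ => ?_
    rw [Real.norm_eq_abs, sq_abs]
    nlinarith [((hmem p).1 hp).1 i, hle_one p hp i]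
  have hcompact : IsCompact Δ := by
    refine Metric.isCompact_of_isClosed_isBounded ?_
      ((Metric.isBounded_closedBall (x := 0) (r := 1)).subset fun p hp => by
        simpa using hnorm p hp)
    rw [hΔ, ofPred_and, ofPred_forall]
    exact (isClosed_iInter fun i => isClosed_le continuous_const (by fun_prop)).inter
      (isClosed_eq (by fun_prop) continuous_const)
  have hne : Δ.Nonempty := by
    refine ⟨EuclideanSpace.single ⟨0, by omega⟩ 1, (hmem _).2 ⟨fun i => ?_, ?_⟩⟩
    · rw [PiLp.single_apply]; split_ifs <;> norm_num
    · simp [PiLp.single_apply]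
  set G : EuclideanSpace ℝ (Fin N) → ℝ := fun p =>
    ∑ i, (∫ t in (1 - p i)..1, Finv i t) - ∑ i, c i * p i with hGdef
  have hobj' : ∀ φ p, obj φ p = inner ℝ φ p + G p := fun φ p => by
    simp only [hobj, hGdef, PiLp.inner_apply, RCLike.inner_apply, conj_trivial, sub_mul,
      Finset.sum_sub_distrib, mul_comm (p.ofLp _)]
    ring
  have hG : ContinuousOn G Δ := by
    refine ContinuousOn.sub (continuousOn_finsetSum _ fun i _ => ?_)
      (by fun_prop)
    have hprim : ContinuousOn (fun x => ∫ t in x..1, Finv i t) (Icc 0 1) := by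
      have := intervalIntegral.continuousOn_primitive_interval_left
        (f := Finv i) (μ := volume) (a := 0) (b := 1)
        (by rw [uIcc_of_le zero_le_one]
            exact (intervalIntegrable_iff_integrableOn_Icc_of_le zero_le_one).1 (hintegrable i))
      rwa [uIcc_of_le zero_le_one] at this
    refine hprim.comp (t := Icc 0 1) (f := fun p : EuclideanSpace ℝ (Fin N) => 1 - p i)
      (by fun_prop) fun p hp => ?_
    exact ⟨by linarith [hle_one p hp i], by linarith [((hmem p).1 hp).1 i]⟩
  have hcont : ∀ φ, ContinuousOn (obj φ) Δ := fun φ => by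
    rw [show obj φ = fun p => inner ℝ φ p + G p from funext (hobj' φ)]
    exact (by fun_prop : Continuous fun q => inner ℝ φ q).continuousOn.add hG
  have hle : ∀ φ, ∀ p ∈ Δ, obj φ p ≤ ψ φ := fun φ p hp => by
    rw [hψ]
    exact le_csSup (hcompact.image_of_continuousOn (hcont φ)).bddAbove (mem_image_of_mem _ hp)
  have hattain : ∀ φ, ∃ p ∈ Δ, obj φ p = ψ φ := fun φ => by
    rw [hψ]
    exact (hcompact.image_of_continuousOn (hcont φ)).sSup_mem (hne.image _)
  have htail : ∀ p ∈ Δ, ∀ q ∈ Δ, ∀ i, p i ≠ q i →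
      (∫ t in (1 - p i)..1, Finv i t) + ∫ t in (1 - q i)..1, Finv i t
        < 2 * ∫ t in (1 - (p i + q i) / 2)..1, Finv i t := by
    intro p hp q hq i hpq
    rcases hpq.lt_or_gt with h | h
    · exact tail_integral_add_lt_two_mul_midpoint (hstrict i) (hintegrable i)
        (((hmem p).1 hp).1 i) h (hle_one q hq i)
    · have := tail_integral_add_lt_two_mul_midpoint (hstrict i) (hintegrable i)
        (((hmem q).1 hq).1 i) h (hle_one p hp i)
      rwa [add_comm (q i), add_comm (∫ t in (1 - q i)..1, Finv i t)] at this
  have huniq : ∀ φ, ∀ p ∈ Δ, ∀ q ∈ Δ, obj φ p = ψ φ → obj φ q = ψ φ → q = p := by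
    intro φ p hp q hq hpφ hqφ
    by_contra hqp
    obtain ⟨j, hj⟩ : ∃ j, p j ≠ q j := by
      by_contra! h
      exact hqp (PiLp.ext fun i => (h i).symm)
    set m : EuclideanSpace ℝ (Fin N) := (1 / 2 : ℝ) • (p + q) with hm
    have hmi : ∀ i, m i = (p i + q i) / 2 := fun i => by
      simp only [hm, PiLp.smul_apply, PiLp.add_apply, smul_eq_mul]; ring
    have hmΔ : m ∈ Δ := by
      refine (hmem m).2 ⟨fun i => ?_, ?_⟩
      · rw [hmi]; linarith [((hmem p).1 hp).1 i, ((hmem q).1 hq).1 i]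
      · simp only [hmi, ← Finset.sum_div, Finset.sum_add_distrib, ((hmem p).1 hp).2,
          ((hmem q).1 hq).2]
        norm_num
    have hsum : obj φ p + obj φ q < 2 * obj φ m := by
      simp only [hobj, ← Finset.sum_add_distrib, Finset.mul_sum, hmi]
      refine Finset.sum_lt_sum (fun i _ => ?_) ⟨j, Finset.mem_univ j, ?_⟩
      · by_cases hi : p i = q i
        · simp only [hi, add_self_div_two]
          linarith
        · linarith [htail p hp q hq i hi]
      · linarith [htail p hp q hq j hj]
    linarith [hle φ m hmΔ]
  have hgrad : ∀ φ, ∀ p ∈ Δ, obj φ p = ψ φ → HasGradientAt ψ p φ := by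
    intro φ p hp hpφ
    have huniqφ : ∀ q ∈ Δ, obj φ q = ψ φ → q = p := fun q hq hqφ => huniq φ p hp q hq hpφ hqφ
    simp only [hobj'] at hle hattain hpφ huniqφ
    exact hasGradientAt_of_unique_isMaxOn hcompact hG hle hattain hp hpφ huniqφ
  refine ⟨⟨convex_univ, fun x _ y _ a b ha hb hab => ?_⟩, fun φ => ?_, fun φ => ?_, fun φ => ?_⟩
  · obtain ⟨p, hp, hpx⟩ := hattain (a • x + b • y)
    have hx := mul_le_mul_of_nonneg_left (hle x p hp) ha
    have hy := mul_le_mul_of_nonneg_left (hle y p hp) hb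
    rw [← hpx, smul_eq_mul, smul_eq_mul]
    refine le_trans (le_of_eq ?_) (add_le_add hx hy)
    simp only [hobj', inner_add_left, real_inner_smul_left]
    linear_combination (-G p) * hab
  · obtain ⟨p, hp, hpφ⟩ := hattain φ
    exact (hgrad φ p hp hpφ).differentiableAt
  · obtain ⟨p, hp, hpφ⟩ := hattain φ
    exact ⟨p, hp, hpφ, fun q hq hqφ => huniq φ p hp q hq hpφ hqφ, (hgrad φ p hp hpφ).gradient⟩
  · obtain ⟨p, hp, hpφ⟩ := hattain φ
    rw [(hgrad φ p hp hpφ).gradient]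
    exact hnorm p hp
end
end
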